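/- arXiv:2408.09693 — 4 statements merged into one kernel-verified Lean document; each statement's English description precedes it below -/
import Mathlib

section
/- For every initial condition γ₀ ∈ [0, γ_max], there exists a continuous admissible control h* : [0,∞) → [0, h_max] attaining the infimum defining the value function, i.e. J(h*; γ₀) = v(γ₀). -/
section helpers
open Set Filter Topology MeasureTheory
open scoped NNReal ENNReal

lemma aux_locInt {φ : ℝ → ℝ} {C : ℝ} (hm : Measurable φ) (hb : ∀ t, |φ t| ≤ C) :
    LocallyIntegrable φ volume := by
  have h1 : LocallyIntegrable (fun _ : ℝ => C) (volume : Measure ℝ) := locallyIntegrable_const C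
  refine h1.mono hm.aestronglyMeasurable (ae_of_all _ fun t => ?_)
  rw [Real.norm_eq_abs, Real.norm_eq_abs]
  exact (hb t).trans (le_abs_self C)

lemma aux_intInt {φ : ℝ → ℝ} {C : ℝ} (hm : Measurable φ) (hb : ∀ t, |φ t| ≤ C) (s t : ℝ) :
    IntervalIntegrable φ volume s t :=
  intervalIntegrable_iff.mpr
    (((aux_locInt hm hb).integrableOn_isCompact isCompact_uIcc).mono_set uIoc_subset_uIcc)

lemma aux_ftc {F f : ℝ → ℝ} {s t : ℝ} (hF : AbsolutelyContinuousOnInterval F s t)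
    (hd : ∀ᵐ x, x ∈ uIoc s t → HasDerivAt F (f x) x) :
    ∫ x in s..t, f x = F t - F s := by
  rw [← hF.integral_deriv_eq_sub]
  apply intervalIntegral.integral_congr_ae
  filter_upwards [hd] with x hx hx2
  exact (hx hx2).deriv.symm

lemma aux_lip {F : ℝ → ℝ} {C : ℝ} (hC : 0 ≤ C)
    (h : ∀ s t, s ≤ t → |F t - F s| ≤ C * (t - s)) : LipschitzWith (Real.toNNReal C) F := by
  refine LipschitzWith.of_dist_le_mul fun x y => ?_
  rw [Real.coe_toNNReal _ hC, Real.dist_eq, Real.dist_eq]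
  rcases le_total x y with hxy | hxy
  · rw [abs_sub_comm, abs_sub_comm x y, abs_of_nonneg (sub_nonneg.2 hxy)]
    exact h x y hxy
  · rw [abs_of_nonneg (sub_nonneg.2 hxy)]
    exact h y x hxy

lemma aux_int_abs_le {φ : ℝ → ℝ} {C s t : ℝ} (hst : s ≤ t) (hb : ∀ x, s < x → |φ x| ≤ C) :
    |∫ x in s..t, φ x| ≤ C * (t - s) := by
  have := intervalIntegral.norm_integral_le_of_norm_le_const (a := s) (b := t) (f := φ) (C := C)
    (by
      intro x hx
      rw [uIoc_of_le hst] at hx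
      exact hb x hx.1)
  rwa [Real.norm_eq_abs, abs_of_nonneg (sub_nonneg.2 hst)] at this

lemma aux_adjoint {δ abar A1 : ℝ} (hδ : 0 < δ) (hab : 0 < abar) {A : ℝ → ℝ}
    (hm : Measurable A) (hA0 : ∀ t, 0 ≤ A t) (hA1 : ∀ t, A t ≤ A1) :
    ∃ q : ℝ → ℝ, (∀ t, 0 ≤ q t) ∧ (∀ t, q t ≤ abar / δ) ∧
      LipschitzWith (Real.toNNReal ((δ + A1) * (abar / δ) + abar)) q ∧
      ∀ᵐ t, HasDerivAt q ((δ + A t) * q t - abar) t := by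
  have hA10 : 0 ≤ A1 := (hA0 0).trans (hA1 0)
  have hint : ∀ s t, IntervalIntegrable (fun x => δ + A x) volume s t :=
    aux_intInt (C := δ + A1) (by fun_prop) (fun t => by
      rw [abs_of_nonneg (by linarith [hA0 t])]; linarith [hA1 t])
  set β : ℝ → ℝ := fun t => ∫ x in (0:ℝ)..t, (δ + A x) with hβ
  have hβd : ∀ᵐ t, HasDerivAt β (δ + A t) t := by
    have := LocallyIntegrable.ae_hasDerivAt_integral
      (aux_locInt (φ := fun x => δ + A x) (C := δ + A1) (by fun_prop) (fun t => by
        rw [abs_of_nonneg (by linarith [hA0 t])]; linarith [hA1 t]))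
    filter_upwards [this] with t ht using ht 0
  have hβsub : ∀ s t, β t - β s = ∫ x in s..t, (δ + A x) := fun s t =>
    intervalIntegral.integral_interval_sub_left (hint _ _) (hint _ _)
  have hβlow : ∀ s t, s ≤ t → δ * (t - s) ≤ β t - β s := by
    intro s t hst
    rw [hβsub]
    have := intervalIntegral.integral_mono_on hst (f := fun _ => δ) (g := fun x => δ + A x)
      (by simp) (hint _ _) (fun x _ => by linarith [hA0 x])
    simp only [intervalIntegral.integral_const, smul_eq_mul] at this
    linarith
  have hβlip : LipschitzWith (Real.toNNReal (δ + A1)) β := by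
    refine aux_lip (by linarith) fun s t hst => ?_
    rw [hβsub]
    refine aux_int_abs_le hst fun x _ => ?_
    rw [abs_of_nonneg (by linarith [hA0 x])]; linarith [hA1 x]
  have hβc : Continuous β := hβlip.continuous
  set Ψ : ℝ → ℝ := fun t => abar * Real.exp (-β t) with hΨ
  have hΨc : Continuous Ψ := by fun_prop
  have hΨle : ∀ t s, t ≤ s → Ψ s ≤ (Ψ t * Real.exp (δ * t)) * Real.exp (-δ * s) := by
    intro t s hts
    simp only [hΨ]
    rw [mul_assoc, mul_assoc, ← Real.exp_add, ← Real.exp_add]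
    gcongr
    have := hβlow t s hts
    nlinarith
  have hΨ0 : ∀ t, 0 < Ψ t := fun t => by simp only [hΨ]; positivity
  have hΨint : ∀ t, IntegrableOn Ψ (Ioi t) := by
    intro t
    refine Integrable.mono' (((integrableOn_exp_mul_Ioi (neg_lt_zero.2 hδ) t)).const_mul
      (Ψ t * Real.exp (δ * t))) hΨc.aestronglyMeasurable ?_
    filter_upwards [ae_restrict_mem measurableSet_Ioi] with s hs
    rw [Real.norm_eq_abs, abs_of_pos (hΨ0 s)]
    exact hΨle t s (le_of_lt hs)
  set Q : ℝ → ℝ := fun t => ∫ s in Ioi t, Ψ s with hQ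
  have hQ0 : ∀ t, 0 ≤ Q t := fun t => setIntegral_nonneg measurableSet_Ioi fun s _ => (hΨ0 s).le
  have hQ1 : ∀ t, Q t ≤ Ψ t / δ := by
    intro t
    have : Q t ≤ ∫ s in Ioi t, (Ψ t * Real.exp (δ * t)) * Real.exp (-δ * s) :=
      setIntegral_mono_on (hΨint t) ((integrableOn_exp_mul_Ioi (neg_lt_zero.2 hδ) t).const_mul _)
        measurableSet_Ioi (fun s hs => hΨle t s (le_of_lt hs))
    rw [integral_const_mul, integral_exp_mul_Ioi (neg_lt_zero.2 hδ)] at this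
    refine this.trans (le_of_eq ?_)
    have : Real.exp (δ * t) * Real.exp (-δ * t) = 1 := by rw [← Real.exp_add]; simp
    field_simp
    rw [mul_assoc, show -(δ * t) = -δ * t by ring, this, mul_one]
  have hQsub : ∀ s t, Q t = Q s - ∫ x in s..t, Ψ x := by
    intro s t
    have := intervalIntegral.integral_Ioi_sub_Ioi' (hΨint s) (hΨint t)
    simp only [hQ]; linarith
  have hQd : ∀ t, HasDerivAt Q (-Ψ t) t := by
    intro t
    have h1 : HasDerivAt (fun u => ∫ x in (0:ℝ)..u, Ψ x) (Ψ t) t :=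
      (hΨc.integral_hasStrictDerivAt 0 t).hasDerivAt
    have h2 := h1.const_sub (Q 0)
    have : Q = fun u => Q 0 - ∫ x in (0:ℝ)..u, Ψ x := funext fun u => hQsub 0 u
    rw [this]; exact h2
  have hQac : ∀ s t, AbsolutelyContinuousOnInterval Q s t := by
    intro s t
    have h1 : ContDiff ℝ 1 Q := by
      rw [contDiff_one_iff_deriv]
      refine ⟨fun t => (hQd t).differentiableAt, ?_⟩
      have : deriv Q = fun t => -Ψ t := funext fun t => (hQd t).deriv
      rw [this]; exact hΨc.neg
    exact h1.contDiffOn.absolutelyContinuousOnInterval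
  have hEac : ∀ s t, AbsolutelyContinuousOnInterval (fun x => Real.exp (β x)) s t := by
    intro s t
    obtain ⟨R, hR⟩ := (isCompact_uIcc (a := s) (b := t)).exists_bound_of_continuousOn
      hβc.continuousOn
    obtain ⟨K, hK⟩ := (Real.contDiff_exp (n := 1)).contDiffOn.exists_lipschitzOnWith (by decide)
      (convex_Icc (-R) R) isCompact_Icc
    have : LipschitzOnWith (K * Real.toNNReal (δ + A1)) (Real.exp ∘ β) (uIcc s t) :=
      hK.comp (hβlip.lipschitzOnWith) (fun x hx => abs_le.1 (hR x hx))
    exact this.absolutelyContinuousOnInterval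
  set q : ℝ → ℝ := fun t => (1 : ℝ) * (Q t * Real.exp (β t)) with hq
  have hq0 : ∀ t, 0 ≤ q t := fun t => by
    simp only [hq, one_mul]; exact mul_nonneg (hQ0 t) (Real.exp_pos _).le
  have hee : ∀ t, Ψ t * Real.exp (β t) = abar := by
    intro t
    simp only [hΨ]; rw [mul_assoc, ← Real.exp_add]; simp
  have hq1 : ∀ t, q t ≤ abar / δ := fun t => by
    simp only [hq, one_mul]
    calc Q t * Real.exp (β t) ≤ Ψ t / δ * Real.exp (β t) := by gcongr; exact hQ1 t
      _ = (Ψ t * Real.exp (β t)) / δ := by ring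
      _ = _ := by rw [hee]
  have hqd : ∀ᵐ t, HasDerivAt q ((δ + A t) * q t - abar) t := by
    filter_upwards [hβd] with t ht
    have := ((hQd t).mul ht.exp).const_mul 1
    have h2 : (1 * (-Ψ t * Real.exp (β t) + Q t * (Real.exp (β t) * (δ + A t))))
        = (δ + A t) * q t - abar := by
      rw [← hee t]; simp only [hq]; ring
    rw [h2] at this
    exact this
  have hqac : ∀ s t, AbsolutelyContinuousOnInterval q s t := fun s t =>
    ((hQac s t).fun_mul (hEac s t)).const_mul 1
  refine ⟨q, hq0, hq1, ?_, hqd⟩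
  refine aux_lip (by positivity) fun s t hst => ?_
  rw [← aux_ftc (hqac s t) (hqd.mono fun x hx _ => hx)]
  refine aux_int_abs_le hst fun x _ => ?_
  have h1 := hq0 x
  have h2 := hq1 x
  have h3 := hA0 x
  have h4 := hA1 x
  have h5 : (δ + A x) * q x ≤ (δ + A1) * (abar / δ) := by gcongr
  have h6 : 0 ≤ (δ + A x) * q x := by positivity
  rw [abs_le]; constructor <;> nlinarith [h5, h6]

structure IsSol (a l s2 G H x0 : ℝ) (h y : ℝ → ℝ) : Prop where
  hm : Measurable h
  h0 : ∀ t, 0 ≤ h t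
  h1 : ∀ t, h t ≤ H
  yc : Continuous y
  y0 : ∀ t, 0 ≤ y t
  y1 : ∀ t, y t ≤ G
  neg : ∀ t, y t = y (max t 0)
  eq : ∀ t, 0 ≤ t → y t = x0 + ∫ s in (0:ℝ)..t, (-(a + h s) * y s ^ 2 - 2 * l * y s + s2)

lemma IsSol.bound {a l s2 G H x0 : ℝ} {h y : ℝ → ℝ} (S : IsSol a l s2 G H x0 h y)
    (ha : 0 ≤ a) (hl : 0 ≤ l) (hs : 0 ≤ s2) (t : ℝ) :
    |(-(a + h t) * y t ^ 2 - 2 * l * y t + s2)| ≤ (a + H) * G ^ 2 + 2 * l * G + s2 := by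
  have h1 := S.h0 t
  have h2 := S.h1 t
  have h3 := S.y0 t
  have h4 := S.y1 t
  have hG : 0 ≤ G := h3.trans h4
  have h5 : (a + h t) * y t ^ 2 ≤ (a + H) * G ^ 2 := by
    have : 0 ≤ a + H := by linarith
    gcongr
  have h6 : 0 ≤ (a + h t) * y t ^ 2 := by positivity
  have h7 : 2 * l * y t ≤ 2 * l * G := by gcongr
  have h8 : 0 ≤ 2 * l * y t := by positivity
  rw [abs_le]; constructor <;> nlinarith

lemma IsSol.meas {a l s2 G H x0 : ℝ} {h y : ℝ → ℝ} (S : IsSol a l s2 G H x0 h y) :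
    Measurable (fun s => (-(a + h s) * y s ^ 2 - 2 * l * y s + s2)) := by
  have := S.hm
  have := S.yc.measurable
  fun_prop

lemma IsSol.lip {a l s2 G H x0 : ℝ} {h y : ℝ → ℝ} (S : IsSol a l s2 G H x0 h y)
    (ha : 0 ≤ a) (hl : 0 ≤ l) (hs : 0 ≤ s2) :
    LipschitzWith (Real.toNNReal ((a + H) * G ^ 2 + 2 * l * G + s2)) y := by
  have hC : 0 ≤ (a + H) * G ^ 2 + 2 * l * G + s2 := (abs_nonneg _).trans (S.bound ha hl hs 0)
  refine aux_lip hC fun s t hst => ?_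
  have hint := aux_intInt S.meas (S.bound ha hl hs)
  rw [S.neg t, S.neg s, S.eq _ (le_max_right t 0), S.eq _ (le_max_right s 0),
    add_sub_add_left_eq_sub, intervalIntegral.integral_interval_sub_left (hint _ _) (hint _ _)]
  have hm : max s 0 ≤ max t 0 := max_le_max_right 0 hst
  refine (aux_int_abs_le hm fun x _ => S.bound ha hl hs x).trans ?_
  refine mul_le_mul_of_nonneg_left ?_ hC
  rcases le_total s 0 with h | h <;> rcases le_total t 0 with h' | h' <;>
    simp only [max_eq_left, max_eq_right, h, h'] <;> linarith

lemma IsSol.deriv {a l s2 G H x0 : ℝ} {h y : ℝ → ℝ} (S : IsSol a l s2 G H x0 h y)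
    (ha : 0 ≤ a) (hl : 0 ≤ l) (hs : 0 ≤ s2) :
    ∀ᵐ t, 0 < t → HasDerivAt y (-(a + h t) * y t ^ 2 - 2 * l * y t + s2) t := by
  filter_upwards [LocallyIntegrable.ae_hasDerivAt_integral
    (aux_locInt S.meas (S.bound ha hl hs))] with t ht ht0
  refine ((ht 0).const_add x0).congr_of_eventuallyEq ?_
  filter_upwards [lt_mem_nhds ht0] with u hu
  exact S.eq u hu.le

lemma aux_diff {a l s2 G H x0 : ℝ} {h y k z : ℝ → ℝ} (S : IsSol a l s2 G H x0 h y)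
    (S' : IsSol a l s2 G H x0 k z)
    (ha : 0 ≤ a) (hl : 0 ≤ l) (hs : 0 ≤ s2) {T : ℝ} (hT : 0 ≤ T) :
    |z T - y T| ≤ ∫ t in (0:ℝ)..T, |k t - h t| * G ^ 2 := by
  have hlip := (S'.lip ha hl hs).sub (S.lip ha hl hs)
  have hac : AbsolutelyContinuousOnInterval (fun t => |z t - y t|) 0 T := by
    have h1 : LipschitzWith 1 (fun x : ℝ => |x|) := by
      simpa [Real.norm_eq_abs] using! (lipschitzWith_one_norm (E := ℝ))
    exact (h1.comp hlip).lipschitzOnWith.absolutelyContinuousOnInterval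
  have h0 : |z 0 - y 0| = 0 := by
    rw [S.eq 0 le_rfl, S'.eq 0 le_rfl]; simp
  have hG : 0 ≤ G := (S.y0 0).trans (S.y1 0)
  have h1 := hac.integral_deriv_eq_sub
  simp only [h0, sub_zero] at h1
  rw [← h1]
  have hm1 := S.hm
  have hm2 := S'.hm
  have hH : 0 ≤ H := (S.h0 0).trans (S.h1 0)
  refine intervalIntegral.integral_mono_ae_restrict hT hac.intervalIntegrable_deriv
    (aux_intInt (C := H * G ^ 2) (by fun_prop) (fun t => ?_) _ _) ?_
  · rw [abs_of_nonneg (by positivity)]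
    gcongr
    rw [abs_le]
    constructor <;> linarith [S.h0 t, S.h1 t, S'.h0 t, S'.h1 t]
  · have hne : ∀ᵐ t : ℝ, t ≠ 0 := by simp [ae_iff, measure_singleton]
    filter_upwards [ae_restrict_mem measurableSet_Icc, ae_restrict_of_ae (S.deriv ha hl hs),
      ae_restrict_of_ae (S'.deriv ha hl hs), ae_restrict_of_ae hne] with t ht hy hz htne
    have ht0 : 0 < t := lt_of_le_of_ne ht.1 (Ne.symm htne)
    have hd := (hz ht0).sub (hy ht0)
    have hrhs : 0 ≤ |k t - h t| * G ^ 2 := by positivity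
    have y0 := S.y0 t
    have z0 := S'.y0 t
    have k0 := S'.h0 t
    have hy2 : y t ^ 2 ≤ G ^ 2 := by gcongr; exact S.y1 t
    have hA : 0 ≤ (a + k t) * (z t + y t) + 2 * l := by positivity
    have hkey : (-(a + k t) * z t ^ 2 - 2 * l * z t + s2) - (-(a + h t) * y t ^ 2 - 2 * l * y t + s2)
        = -((a + k t) * (z t + y t) + 2 * l) * (z t - y t) - (k t - h t) * y t ^ 2 := by ring
    rw [hkey] at hd
    have hb : |k t - h t| * y t ^ 2 ≤ |k t - h t| * G ^ 2 := by gcongr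
    rcases lt_trichotomy (z t - y t) 0 with hneg | hzero | hpos
    · have : HasDerivAt (fun t => |z t - y t|)
          (-(-((a + k t) * (z t + y t) + 2 * l) * (z t - y t) - (k t - h t) * y t ^ 2)) t := by
        refine hd.neg.congr_of_eventuallyEq ?_
        filter_upwards [hd.continuousAt.eventually_lt continuousAt_const hneg] with u hu
        exact abs_of_neg hu
      rw [this.deriv]
      have h3 := mul_le_mul_of_nonneg_right (le_abs_self (k t - h t)) (sq_nonneg (y t))
      nlinarith [mul_nonneg hA (neg_nonneg.2 hneg.le)]
    · have : IsLocalMin (fun t => |z t - y t|) t := by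
        refine Eventually.of_forall fun u => ?_
        simp only [hzero, abs_zero]; positivity
      rw [this.deriv_eq_zero]; exact hrhs
    · have : HasDerivAt (fun t => |z t - y t|)
          ((-((a + k t) * (z t + y t) + 2 * l) * (z t - y t) - (k t - h t) * y t ^ 2)) t := by
        refine hd.congr_of_eventuallyEq ?_
        filter_upwards [continuousAt_const.eventually_lt hd.continuousAt hpos] with u hu
        exact abs_of_pos hu
      rw [this.deriv]
      have h3 := mul_le_mul_of_nonneg_right (neg_abs_le (k t - h t)) (sq_nonneg (y t))
      nlinarith [mul_nonneg hA hpos.le]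

lemma aux_expInt {δ C : ℝ} (hδ : 0 < δ) {φ : ℝ → ℝ} (hm : Measurable φ)
    (hb : ∀ t, 0 < t → |φ t| ≤ C * Real.exp (δ / 2 * t)) :
    IntegrableOn (fun t => Real.exp (-δ * t) * φ t) (Ioi 0) ∧
      |∫ t in Ioi (0:ℝ), Real.exp (-δ * t) * φ t| ≤ C * (2 / δ) := by
  have hneg : -(δ / 2) < 0 := by linarith
  have hi : IntegrableOn (fun t => C * Real.exp (-(δ / 2) * t)) (Ioi 0) :=
    (integrableOn_exp_mul_Ioi hneg 0).const_mul C
  have hle : ∀ᵐ t ∂(volume.restrict (Ioi (0:ℝ))),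
      ‖Real.exp (-δ * t) * φ t‖ ≤ C * Real.exp (-(δ / 2) * t) := by
    filter_upwards [ae_restrict_mem measurableSet_Ioi] with t ht
    rw [norm_mul, Real.norm_eq_abs, Real.norm_eq_abs, abs_of_pos (Real.exp_pos _)]
    calc _ ≤ Real.exp (-δ * t) * (C * Real.exp (δ / 2 * t)) := by gcongr; exact hb t ht
      _ = C * (Real.exp (-δ * t) * Real.exp (δ / 2 * t)) := by ring
      _ = _ := by rw [← Real.exp_add]; congr 2; ring
  refine ⟨Integrable.mono' hi (by fun_prop) hle, ?_⟩
  have := norm_integral_le_of_norm_le hi hle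
  rw [Real.norm_eq_abs, integral_const_mul, integral_exp_mul_Ioi hneg] at this
  refine this.trans (le_of_eq ?_)
  simp

lemma aux_expInt' {δ C : ℝ} (hδ : 0 < δ) {φ : ℝ → ℝ} (hm : Measurable φ)
    (hb : ∀ t, |φ t| ≤ C) :
    IntegrableOn (fun t => Real.exp (-δ * t) * φ t) (Ioi 0) := by
  refine (aux_expInt (C := C) hδ hm fun t ht => (hb t).trans ?_).1
  have hC : 0 ≤ C := (abs_nonneg _).trans (hb 0)
  exact le_mul_of_one_le_right hC (Real.one_le_exp (by positivity))

lemma aux_var {a l s2 G H x0 δ abar : ℝ} (hδ : 0 < δ) (hab : 0 < abar)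
    (ha : 0 ≤ a) (hl : 0 ≤ l) (hs : 0 ≤ s2) {h y k z q : ℝ → ℝ} {ε : ℝ} (hε : 0 ≤ ε)
    (S : IsSol a l s2 G H x0 h y) (hk : Measurable k) (hk0 : ∀ t, 0 ≤ k t) (hk1 : ∀ t, k t ≤ H)
    (S' : IsSol a l s2 G H x0 (fun t => h t + ε * (k t - h t)) z)
    (hq0 : ∀ t, 0 ≤ q t) (hq1 : ∀ t, q t ≤ abar / δ) {L : ℝ≥0} (hqL : LipschitzWith L q)
    (hqd : ∀ᵐ t, HasDerivAt q ((δ + (2 * (a + h t) * y t + 2 * l)) * q t - abar) t) :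
    ∫ t in Ioi (0:ℝ), Real.exp (-δ * t) * (abar * (z t - y t)) ≤
      - (ε * ∫ t in Ioi (0:ℝ), Real.exp (-δ * t) * (q t * y t ^ 2 * (k t - h t))) +
      (abar / δ * (H * G ^ 2 * (4 / δ)) * ((a + H) * (H * G ^ 2 * (4 / δ)) + 2 * H * G)) * (2 / δ)
        * ε ^ 2 := by
  have hG : 0 ≤ G := (S.y0 0).trans (S.y1 0)
  have hH : 0 ≤ H := (S.h0 0).trans (S.h1 0)
  have hm := S.hm
  have hym := S.yc.measurable
  have hzm := S'.yc.measurable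
  have hqm := hqL.continuous.measurable
  have hkh : ∀ t, |k t - h t| ≤ H := fun t => by
    rw [abs_le]; constructor <;> linarith [S.h0 t, S.h1 t, hk0 t, hk1 t]
  set e4 : ℝ → ℝ := fun t => Real.exp (δ / 4 * t) with he4
  have hD : ∀ t, 0 < t → |z t - y t| ≤ ε * (H * G ^ 2 * (4 / δ)) * e4 t := by
    intro t ht
    refine (aux_diff S S' ha hl hs ht.le).trans ?_
    have h1 := aux_int_abs_le (φ := fun t => |h t + ε * (k t - h t) - h t| * G ^ 2)
      (C := ε * H * G ^ 2) ht.le (fun x _ => by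
        rw [add_sub_cancel_left, abs_mul, abs_abs, abs_mul, abs_of_nonneg hε,
          abs_of_nonneg (sq_nonneg G)]
        gcongr; exact hkh x)
    refine (le_abs_self _).trans (h1.trans ?_)
    have h2 : t ≤ 4 / δ * e4 t := by
      have := Real.add_one_le_exp (δ / 4 * t)
      have h3 : δ / 4 * t ≤ e4 t := by simp only [he4]; linarith
      calc t = 4 / δ * (δ / 4 * t) := by field_simp
        _ ≤ _ := by gcongr
    calc ε * H * G ^ 2 * (t - 0) ≤ ε * H * G ^ 2 * (4 / δ * e4 t) := by
          rw [sub_zero]; gcongr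
      _ = _ := by ring
  set R : ℝ → ℝ := fun t =>
    -(q t * (z t - y t) * (2 * (ε * (k t - h t)) * y t + (a + (h t + ε * (k t - h t))) * (z t - y t)))
    with hR
  have he41 : ∀ t, 0 < t → 1 ≤ e4 t := fun t ht => Real.one_le_exp (by positivity)
  have hRb : ∀ t, 0 < t → |R t| ≤ (abar / δ * (H * G ^ 2 * (4 / δ)) *
      ((a + H) * (H * G ^ 2 * (4 / δ)) + 2 * H * G)) * ε ^ 2 * Real.exp (δ / 2 * t) := by
    intro t ht
    have h1 := hD t ht
    have h2 := he41 t ht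
    have hk' := S'.h0 t
    have hk'' := S'.h1 t
    simp only [hR]
    rw [abs_neg, abs_mul, abs_mul, abs_of_nonneg (hq0 t)]
    have h3 : |2 * (ε * (k t - h t)) * y t + (a + (h t + ε * (k t - h t))) * (z t - y t)| ≤
        ε * ((a + H) * (H * G ^ 2 * (4 / δ)) + 2 * H * G) * e4 t := by
      refine (abs_add_le _ _).trans ?_
      rw [abs_mul, abs_mul, abs_mul, abs_mul, abs_of_nonneg hε, abs_of_nonneg (S.y0 t),
        abs_of_nonneg (show 0 ≤ (a + (h t + ε * (k t - h t))) by linarith),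
        abs_of_nonneg (zero_le_two (α := ℝ))]
      have h5 : 2 * (ε * |k t - h t|) * y t ≤ 2 * (ε * H) * G * e4 t := by
        have : 2 * (ε * |k t - h t|) * y t ≤ 2 * (ε * H) * G := by
          gcongr
          · exact S.y0 t
          · exact hkh t
          · exact S.y1 t
        exact this.trans (le_mul_of_one_le_right (by positivity) h2)
      have h6 : (a + (h t + ε * (k t - h t))) * |z t - y t| ≤
          (a + H) * (ε * (H * G ^ 2 * (4 / δ)) * e4 t) := by
        gcongr
      nlinarith
    have h7 : e4 t * e4 t = Real.exp (δ / 2 * t) := by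
      simp only [he4]; rw [← Real.exp_add]; congr 1; ring
    rw [← h7]
    calc q t * |z t - y t| * |2 * (ε * (k t - h t)) * y t + (a + (h t + ε * (k t - h t))) * (z t - y t)|
        ≤ abar / δ * (ε * (H * G ^ 2 * (4 / δ)) * e4 t) *
          (ε * ((a + H) * (H * G ^ 2 * (4 / δ)) + 2 * H * G) * e4 t) := by
          gcongr
          exact hq1 t
      _ = _ := by ring
  have hRm : Measurable R := by simp only [hR]; fun_prop
  obtain ⟨hRi, hRI⟩ := aux_expInt hδ hRm hRb
  have hzy : ∀ t, |z t - y t| ≤ G := fun t => by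
    rw [abs_le]; constructor <;> linarith [S.y0 t, S.y1 t, S'.y0 t, S'.y1 t]
  have hDi : IntegrableOn (fun t => Real.exp (-δ * t) * (abar * (z t - y t))) (Ioi 0) :=
    aux_expInt' (C := abar * G) hδ (by fun_prop) fun t => by
      rw [abs_mul, abs_of_pos hab]; gcongr; exact hzy t
  have hqi : IntegrableOn (fun t => Real.exp (-δ * t) * (q t * y t ^ 2 * (k t - h t))) (Ioi 0) :=
    aux_expInt' (C := abar / δ * G ^ 2 * H) hδ (by fun_prop) fun t => by
      rw [abs_mul, abs_mul, abs_of_nonneg (hq0 t), abs_of_nonneg (sq_nonneg (y t))]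
      gcongr
      · exact hq1 t
      · exact S.y0 t
      · exact S.y1 t
      · exact hkh t
  set F : ℝ → ℝ := fun t => Real.exp (-δ * t) * (q t * (z t - y t)) with hF
  have hFac : ∀ T, AbsolutelyContinuousOnInterval F 0 T := by
    intro T
    have h1 : AbsolutelyContinuousOnInterval (fun t => Real.exp (-δ * t)) 0 T := by
      have : ContDiff ℝ 1 (fun t => Real.exp (-δ * t)) := by fun_prop
      exact this.contDiffOn.absolutelyContinuousOnInterval
    exact h1.fun_mul ((hqL.lipschitzOnWith.absolutelyContinuousOnInterval).fun_mul
      ((S'.lip ha hl hs).lipschitzOnWith.absolutelyContinuousOnInterval.fun_sub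
        (S.lip ha hl hs).lipschitzOnWith.absolutelyContinuousOnInterval))
  set g : ℝ → ℝ := fun t => Real.exp (-δ * t) * R t - Real.exp (-δ * t) * (abar * (z t - y t))
    - ε * (Real.exp (-δ * t) * (q t * y t ^ 2 * (k t - h t))) with hg
  have hgi : IntegrableOn g (Ioi 0) := (hRi.sub hDi).sub (hqi.const_mul ε)
  have hFd : ∀ᵐ t, 0 < t → HasDerivAt F (g t) t := by
    filter_upwards [S.deriv ha hl hs, S'.deriv ha hl hs, hqd] with t hy hz hq' ht
    have h1 : HasDerivAt (fun t => Real.exp (-δ * t)) (Real.exp (-δ * t) * (-δ * 1)) t :=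
      ((hasDerivAt_id t).const_mul (-δ)).exp
    have h2 := h1.mul (hq'.mul ((hz ht).sub (hy ht)))
    refine h2.congr_deriv ?_
    simp only [hg, hR, Pi.mul_apply, Pi.sub_apply]
    ring
  have hlim := intervalIntegral_tendsto_integral_Ioi 0 hgi tendsto_id
  have hF0 : F 0 = 0 := by
    simp only [hF]; rw [S.eq 0 le_rfl, S'.eq 0 le_rfl]; simp
  have hlim2 : Tendsto (fun T : ℝ => ∫ x in (0:ℝ)..id T, g x) atTop (𝓝 0) := by
    have h1 : Tendsto F atTop (𝓝 0) := by
      have h2 : Tendsto (fun t => Real.exp (-δ * t) * (abar / δ * G)) atTop (𝓝 0) := by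
        have h3 : Tendsto (fun t : ℝ => -δ * t) atTop atBot :=
          tendsto_id.const_mul_atTop_of_neg (neg_lt_zero.2 hδ)
        simpa using (Real.tendsto_exp_atBot.comp h3).mul_const (abar / δ * G)
      refine squeeze_zero_norm (fun t => ?_) h2
      rw [Real.norm_eq_abs, abs_mul, abs_mul, abs_of_pos (Real.exp_pos _), abs_of_nonneg (hq0 t)]
      gcongr
      · exact hq1 t
      · exact hzy t
    refine h1.congr' ?_
    filter_upwards [eventually_ge_atTop 0] with T hT
    rw [id, aux_ftc (hFac T) (hFd.mono fun x hx hx2 => hx (by rw [uIoc_of_le hT] at hx2; exact hx2.1)),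
      hF0, sub_zero]
  have h0 := tendsto_nhds_unique hlim hlim2
  have hsplit : ∫ t in Ioi (0:ℝ), g t = (∫ t in Ioi (0:ℝ), Real.exp (-δ * t) * R t)
      - (∫ t in Ioi (0:ℝ), Real.exp (-δ * t) * (abar * (z t - y t)))
      - ε * ∫ t in Ioi (0:ℝ), Real.exp (-δ * t) * (q t * y t ^ 2 * (k t - h t)) := by
    simp only [hg]
    rw [integral_sub, integral_sub, integral_const_mul]
    · exact hRi
    · exact hDi
    · exact hRi.sub hDi
    · exact hqi.const_mul ε
  rw [hsplit] at h0
  have := (abs_le.1 hRI).2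
  nlinarith

lemma aux_K {c : ℝ → ℝ} {H : ℝ} (hH : 0 ≤ H) (hc : Continuous c)
    (hconv : StrictConvexOn ℝ (Icc 0 H) c) :
    ∃ K : ℝ → ℝ, (∀ m, K m ∈ Icc 0 H) ∧
      (∀ m, ∀ w ∈ Icc 0 H, m * w - c w ≤ m * K m - c (K m)) ∧
      (∀ (M : ℕ → ℝ) (m : ℝ) (u g : ℕ → ℝ), Tendsto M atTop (𝓝 m) → (∀ n, u n ∈ Icc 0 H) →
        Tendsto g atTop (𝓝 0) →
        (∀ n, ∀ w ∈ Icc 0 H, M n * w - c w ≤ M n * u n - c (u n) + g n) →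
        Tendsto u atTop (𝓝 (K m))) ∧ Continuous K := by
  have hex : ∀ m : ℝ, ∃ u ∈ Icc 0 H, ∀ w ∈ Icc 0 H, m * w - c w ≤ m * u - c u := by
    intro m
    obtain ⟨u, hu, hmax⟩ := (isCompact_Icc (a := (0:ℝ)) (b := H)).exists_isMaxOn
      ⟨0, le_rfl, hH⟩ (f := fun w => m * w - c w) (by fun_prop)
    exact ⟨u, hu, fun w hw => hmax hw⟩
  choose K hK1 hK2 using hex
  have huniq : ∀ m u, u ∈ Icc 0 H → (∀ w ∈ Icc 0 H, m * w - c w ≤ m * u - c u) → u = K m := by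
    intro m u hu hmax
    by_contra hne
    have h1 := hconv.2 hu (hK1 m) hne (show (0:ℝ) < 1 / 2 by norm_num)
      (show (0:ℝ) < 1 / 2 by norm_num) (by norm_num)
    have h2 := hconv.1 hu (hK1 m) (show (0:ℝ) ≤ 1 / 2 by norm_num)
      (show (0:ℝ) ≤ 1 / 2 by norm_num) (by norm_num)
    simp only [smul_eq_mul] at h1 h2
    have h3 := hmax _ h2
    have h4 := hK2 m _ h2
    nlinarith
  have hconvg : ∀ (M : ℕ → ℝ) (m : ℝ) (u g : ℕ → ℝ), Tendsto M atTop (𝓝 m) →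
        (∀ n, u n ∈ Icc 0 H) → Tendsto g atTop (𝓝 0) →
        (∀ n, ∀ w ∈ Icc 0 H, M n * w - c w ≤ M n * u n - c (u n) + g n) →
        Tendsto u atTop (𝓝 (K m)) := by
    intro M m u g hM hu hg hle
    refine tendsto_of_subseq_tendsto fun ns hns => ?_
    obtain ⟨x, hx, φ, hφ, hlim⟩ := (isCompact_Icc (a := (0:ℝ)) (b := H)).tendsto_subseq
      (fun n => hu (ns n))
    refine ⟨φ, ?_⟩
    have hsub : Tendsto (fun n => ns (φ n)) atTop atTop := hns.comp hφ.tendsto_atTop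
    have : x = K m := by
      refine huniq m x hx fun w hw => ?_
      have h1 : Tendsto (fun n => M (ns (φ n)) * w - c w) atTop (𝓝 (m * w - c w)) :=
        ((hM.comp hsub).mul_const w).sub_const _
      have h2 : Tendsto (fun n => M (ns (φ n)) * u (ns (φ n)) - c (u (ns (φ n))) + g (ns (φ n)))
          atTop (𝓝 (m * x - c x + 0)) :=
        (((hM.comp hsub).mul hlim).sub ((hc.tendsto x).comp hlim)).add (hg.comp hsub)
      rw [add_zero] at h2
      exact le_of_tendsto_of_tendsto' h1 h2 fun n => hle _ w hw
    rw [← this]; exact hlim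
  refine ⟨K, hK1, hK2, hconvg, ?_⟩
  rw [continuous_iff_seqContinuous]
  intro M m hM
  exact hconvg M m (K ∘ M) (fun _ => 0) hM (fun n => hK1 _) tendsto_const_nhds
    (fun n w hw => by simpa using hK2 (M n) w hw)

lemma aux_arzela {M : ℕ → ℝ → ℝ} {L : ℝ≥0} {B : ℝ} (hL : ∀ n, LipschitzWith L (M n))
    (hB : ∀ n t, M n t ∈ Icc 0 B) :
    ∃ φ : ℕ → ℕ, StrictMono φ ∧ ∃ m : ℝ → ℝ, Continuous m ∧
      ∀ t, Tendsto (fun n => M (φ n) t) atTop (𝓝 (m t)) := by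
  have hcpt : IsCompact (Set.pi univ (fun _ : ℚ => Icc (0:ℝ) B)) :=
    isCompact_univ_pi fun _ => isCompact_Icc
  obtain ⟨x, -, φ, hφ, hlim⟩ := hcpt.tendsto_subseq (x := fun n (r : ℚ) => M n (r : ℝ))
    (fun n r _ => hB n r)
  rw [tendsto_pi_nhds] at hlim
  have hcau : ∀ t, CauchySeq (fun n => M (φ n) t) := by
    intro t
    rw [Metric.cauchySeq_iff]
    intro ε hε
    obtain ⟨r, hr1, hr2⟩ := exists_rat_btwn (show t < t + ε / (4 * (L + 1)) by
      have : 0 < ε / (4 * ((L:ℝ) + 1)) := by positivity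
      linarith)
    have hd : (L:ℝ) * dist t r ≤ ε / 4 := by
      rw [Real.dist_eq, abs_sub_comm, abs_of_pos (by linarith)]
      have h1 : (r:ℝ) - t ≤ ε / (4 * (L + 1)) := by linarith
      calc (L:ℝ) * (r - t) ≤ (L + 1) * (ε / (4 * (L + 1))) := by
            gcongr
            linarith
        _ = ε / 4 := by field_simp
    obtain ⟨N, hN⟩ := (Metric.cauchySeq_iff.1 (hlim r).cauchySeq) (ε / 4) (by positivity)
    refine ⟨N, fun i hi j hj => ?_⟩
    have h1 := (hL (φ i)).dist_le_mul t r
    have h2 := (hL (φ j)).dist_le_mul t r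
    have h3 := hN i hi j hj
    have h4 := dist_triangle4 (M (φ i) t) (M (φ i) r) (M (φ j) r) (M (φ j) t)
    rw [dist_comm (M (φ j) r)] at h4
    simp only [Function.comp] at h3
    linarith
  choose m hm using fun t => cauchySeq_tendsto_of_complete (hcau t)
  refine ⟨φ, hφ, m, ?_, hm⟩
  have : LipschitzWith L m := LipschitzWith.of_dist_le_mul fun s t =>
    le_of_tendsto' ((hm s).dist (hm t)) fun n => (hL _).dist_le_mul s t
  exact this.continuous

lemma aux_ae_subseq {μ : Measure ℝ} {g : ℕ → ℝ → ℝ} (hi : ∀ n, Integrable (g n) μ)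
    (h0 : ∀ n t, 0 ≤ g n t) (hl : Tendsto (fun n => ∫ t, g n t ∂μ) atTop (𝓝 0)) :
    ∃ φ : ℕ → ℕ, StrictMono φ ∧ ∀ᵐ t ∂μ, Tendsto (fun n => g (φ n) t) atTop (𝓝 0) := by
  have h1 : Tendsto (fun n => eLpNorm (g n - 0) 1 μ) atTop (𝓝 0) := by
    have : ∀ n, eLpNorm (g n - 0) 1 μ = ENNReal.ofReal (∫ t, g n t ∂μ) := by
      intro n
      rw [sub_zero, eLpNorm_one_eq_lintegral_enorm, ofReal_integral_eq_lintegral_ofReal (hi n)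
        (ae_of_all _ (h0 n))]
      refine lintegral_congr fun t => ?_
      rw [Real.enorm_eq_ofReal (h0 n t)]
    simp_rw [this]
    simpa using ENNReal.tendsto_ofReal hl
  exact (tendstoInMeasure_of_tendsto_eLpNorm one_ne_zero (fun n => (hi n).aestronglyMeasurable)
    aestronglyMeasurable_zero h1).exists_seq_tendsto_ae

lemma aux_gap {a l s2 G H x0 δ abar Cb V : ℝ} (hδ : 0 < δ) (hab : 0 < abar)
    (ha : 0 ≤ a) (hl : 0 ≤ l) (hs : 0 ≤ s2) {c h y k z q : ℝ → ℝ} {ε : ℝ} (hε : 0 < ε) (hε1 : ε ≤ 1)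
    (hc : Continuous c) (hcb : ∀ x, |c x| ≤ Cb) (hconv : ConvexOn ℝ (Icc 0 H) c)
    (S : IsSol a l s2 G H x0 h y) (hk : Measurable k) (hk0 : ∀ t, 0 ≤ k t) (hk1 : ∀ t, k t ≤ H)
    (S' : IsSol a l s2 G H x0 (fun t => h t + ε * (k t - h t)) z)
    (hq0 : ∀ t, 0 ≤ q t) (hq1 : ∀ t, q t ≤ abar / δ) {L : ℝ≥0} (hqL : LipschitzWith L q)
    (hqd : ∀ᵐ t, HasDerivAt q ((δ + (2 * (a + h t) * y t + 2 * l)) * q t - abar) t)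
    (hV1 : V ≤ ∫ t in Ioi (0:ℝ), Real.exp (-δ * t) * (abar * z t + c (h t + ε * (k t - h t))))
    (hV2 : ∫ t in Ioi (0:ℝ), Real.exp (-δ * t) * (abar * y t + c (h t)) ≤ V + ε ^ 2) :
    IntegrableOn (fun t => Real.exp (-δ * t) *
      ((q t * y t ^ 2 * k t - c (k t)) - (q t * y t ^ 2 * h t - c (h t)))) (Ioi 0) ∧
    ∫ t in Ioi (0:ℝ), Real.exp (-δ * t) *
      ((q t * y t ^ 2 * k t - c (k t)) - (q t * y t ^ 2 * h t - c (h t))) ≤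
      (1 + (abar / δ * (H * G ^ 2 * (4 / δ)) * ((a + H) * (H * G ^ 2 * (4 / δ)) + 2 * H * G))
        * (2 / δ)) * ε := by
  have hvar := aux_var hδ hab ha hl hs hε.le S hk hk0 hk1 S' hq0 hq1 hqL hqd
  set C := (abar / δ * (H * G ^ 2 * (4 / δ)) * ((a + H) * (H * G ^ 2 * (4 / δ)) + 2 * H * G))
        * (2 / δ) with hC
  have hG : 0 ≤ G := (S.y0 0).trans (S.y1 0)
  have hH : 0 ≤ H := (S.h0 0).trans (S.h1 0)
  have hm := S.hm
  have hym := S.yc.measurable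
  have hzm := S'.yc.measurable
  have hqm := hqL.continuous.measurable
  have hcm := hc.measurable
  have hkh : ∀ t, |k t - h t| ≤ H := fun t => by
    rw [abs_le]; constructor <;> linarith [S.h0 t, S.h1 t, hk0 t, hk1 t]
  have hzy : ∀ t, |z t - y t| ≤ G := fun t => by
    rw [abs_le]; constructor <;> linarith [S.y0 t, S.y1 t, S'.y0 t, S'.y1 t]
  have hDi : IntegrableOn (fun t => Real.exp (-δ * t) * (abar * (z t - y t))) (Ioi 0) :=
    aux_expInt' (C := abar * G) hδ (by fun_prop) fun t => by
      rw [abs_mul, abs_of_pos hab]; gcongr; exact hzy t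
  have hqi : IntegrableOn (fun t => Real.exp (-δ * t) * (q t * y t ^ 2 * (k t - h t))) (Ioi 0) :=
    aux_expInt' (C := abar / δ * G ^ 2 * H) hδ (by fun_prop) fun t => by
      rw [abs_mul, abs_mul, abs_of_nonneg (hq0 t), abs_of_nonneg (sq_nonneg (y t))]
      gcongr
      · exact hq1 t
      · exact S.y0 t
      · exact S.y1 t
      · exact hkh t
  have hci : ∀ f1 f2 : ℝ → ℝ, Measurable f1 → Measurable f2 →
      IntegrableOn (fun t => Real.exp (-δ * t) * (c (f1 t) - c (f2 t))) (Ioi 0) := by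
    intro f1 f2 hf1 hf2
    refine aux_expInt' (C := Cb + Cb) hδ (by fun_prop) fun t => ?_
    exact (abs_sub _ _).trans (add_le_add (hcb _) (hcb _))
  have hJi : ∀ f1 f2 : ℝ → ℝ, Measurable f1 → Measurable f2 → (∀ t, 0 ≤ f2 t) → (∀ t, f2 t ≤ G) →
      IntegrableOn (fun t => Real.exp (-δ * t) * (abar * f2 t + c (f1 t))) (Ioi 0) := by
    intro f1 f2 hf1 hf2 h20 h21
    refine aux_expInt' (C := abar * G + Cb) hδ (by fun_prop) fun t => ?_
    refine (abs_add_le _ _).trans (add_le_add ?_ (hcb _))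
    rw [abs_of_nonneg (mul_nonneg hab.le (h20 t))]
    gcongr; exact h21 t
  have hci1 := hci k h hk hm
  have hci2 := hci _ h S'.hm hm
  have e1 : (∫ t in Ioi (0:ℝ), Real.exp (-δ * t) * (abar * z t + c (h t + ε * (k t - h t)))) -
      (∫ t in Ioi (0:ℝ), Real.exp (-δ * t) * (abar * y t + c (h t))) =
      (∫ t in Ioi (0:ℝ), Real.exp (-δ * t) * (abar * (z t - y t))) +
      ∫ t in Ioi (0:ℝ), Real.exp (-δ * t) * (c (h t + ε * (k t - h t)) - c (h t)) := by
    rw [← integral_sub (hJi _ _ S'.hm hzm S'.y0 S'.y1) (hJi _ _ hm hym S.y0 S.y1),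
      ← integral_add hDi hci2]
    refine integral_congr_ae (ae_of_all _ fun t => ?_)
    ring
  have e2 : (∫ t in Ioi (0:ℝ), Real.exp (-δ * t) * (c (h t + ε * (k t - h t)) - c (h t))) ≤
      ε * ∫ t in Ioi (0:ℝ), Real.exp (-δ * t) * (c (k t) - c (h t)) := by
    rw [← integral_const_mul]
    refine integral_mono hci2 (hci1.const_mul ε) fun t => ?_
    have h1 := hconv.2 (x := h t) (y := k t) ⟨S.h0 t, S.h1 t⟩ ⟨hk0 t, hk1 t⟩
      (sub_nonneg.2 hε1) hε.le (by ring)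
    simp only [smul_eq_mul] at h1
    rw [show (1 - ε) * h t + ε * k t = h t + ε * (k t - h t) by ring] at h1
    have := mul_le_mul_of_nonneg_left (show c (h t + ε * (k t - h t)) - c (h t) ≤
      ε * (c (k t) - c (h t)) by linarith) (Real.exp_pos (-δ * t)).le
    simp only
    linarith
  have efun : (fun t => Real.exp (-δ * t) *
      ((q t * y t ^ 2 * k t - c (k t)) - (q t * y t ^ 2 * h t - c (h t)))) =
      fun t => Real.exp (-δ * t) * (q t * y t ^ 2 * (k t - h t)) -
        Real.exp (-δ * t) * (c (k t) - c (h t)) := by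
    funext t; ring
  rw [efun]
  refine ⟨hqi.sub hci1, ?_⟩
  rw [integral_sub hqi hci1]
  have e3 : ε * ((∫ t in Ioi (0:ℝ), Real.exp (-δ * t) * (q t * y t ^ 2 * (k t - h t))) -
      ∫ t in Ioi (0:ℝ), Real.exp (-δ * t) * (c (k t) - c (h t))) ≤ ε * ((1 + C) * ε) := by
    nlinarith
  exact le_of_mul_le_mul_left e3 hε

lemma aux_core {a l s2 G H x0 δ abar Cb : ℝ} (hδ : 0 < δ) (hab : 0 < abar)
    (ha : 0 ≤ a) (hl : 0 ≤ l) (hs : 0 ≤ s2) (hH : 0 ≤ H) {c : ℝ → ℝ}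
    (hc : Continuous c) (hcb : ∀ x, |c x| ≤ Cb) (hc0 : ∀ x, 0 ≤ c x)
    (hconv : StrictConvexOn ℝ (Icc 0 H) c) (Y : (ℝ → ℝ) → ℝ → ℝ)
    (hY : ∀ h : ℝ → ℝ, Measurable h → (∀ t, h t ∈ Icc 0 H) → IsSol a l s2 G H x0 h (Y h))
    (J : (ℝ → ℝ) → ℝ)
    (hJ : ∀ h : ℝ → ℝ, Measurable h → (∀ t, h t ∈ Icc 0 H) →
      J h = ∫ t in Ioi (0:ℝ), Real.exp (-δ * t) * (abar * Y h t + c (h t))) :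
    ∃ k : ℝ → ℝ, Continuous k ∧ (∀ t, k t ∈ Icc 0 H) ∧
      ∀ h : ℝ → ℝ, Measurable h → (∀ t, h t ∈ Icc 0 H) → J k ≤ J h := by
  obtain ⟨K, hK1, hK2, hK3, hKc⟩ := aux_K hH hc hconv
  set Ad : Set (ℝ → ℝ) := {h | Measurable h ∧ ∀ t, h t ∈ Icc 0 H} with hAd
  have hcm := hc.measurable
  set V := sInf (J '' Ad) with hVdef
  have hne : (J '' Ad).Nonempty := ⟨J (fun _ => 0), fun _ => 0, ⟨measurable_const, fun _ => ⟨le_rfl, hH⟩⟩, rfl⟩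
  have hbdd : BddBelow (J '' Ad) := by
    refine ⟨0, ?_⟩
    rintro _ ⟨h, ⟨h1, h2⟩, rfl⟩
    rw [hJ h h1 h2]
    refine integral_nonneg fun t => ?_
    have := (hY h h1 h2).y0 t
    have := hc0 (h t)
    simp only [Pi.zero_apply]
    positivity
  have hVle : ∀ h : ℝ → ℝ, Measurable h → (∀ t, h t ∈ Icc 0 H) → V ≤ J h := fun h h1 h2 =>
    csInf_le hbdd ⟨h, ⟨h1, h2⟩, rfl⟩
  set ε : ℕ → ℝ := fun n => 1 / ((n:ℝ) + 1) with hεdef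
  have hε0 : ∀ n, 0 < ε n := fun n => by simp only [hεdef]; positivity
  have hε1 : ∀ n, ε n ≤ 1 := fun n => by
    simp only [hεdef]; rw [div_le_one (by positivity)]
    have : (0:ℝ) ≤ n := Nat.cast_nonneg n
    linarith
  have hεl : Tendsto ε atTop (𝓝 0) := tendsto_one_div_add_atTop_nhds_zero_nat
  have hseq : ∀ n, ∃ h : ℝ → ℝ, (Measurable h ∧ ∀ t, h t ∈ Icc 0 H) ∧ J h ≤ V + ε n ^ 2 := by
    intro n
    obtain ⟨_, ⟨h, hh, rfl⟩, hlt⟩ := Real.lt_sInf_add_pos hne (pow_pos (hε0 n) 2)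
    exact ⟨h, hh, hlt.le⟩
  choose h hh hJh using hseq
  set y : ℕ → ℝ → ℝ := fun n => Y (h n) with hydef
  have S : ∀ n, IsSol a l s2 G H x0 (h n) (y n) := fun n => hY _ (hh n).1 (hh n).2
  have hG : 0 ≤ G := ((S 0).y0 0).trans ((S 0).y1 0)
  have hadj : ∀ n, ∃ q : ℝ → ℝ, (∀ t, 0 ≤ q t) ∧ (∀ t, q t ≤ abar / δ) ∧
      LipschitzWith (Real.toNNReal ((δ + (2 * (a + H) * G + 2 * l)) * (abar / δ) + abar)) q ∧
      ∀ᵐ t, HasDerivAt q ((δ + (2 * (a + h n t) * y n t + 2 * l)) * q t - abar) t := by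
    intro n
    have h1 := (S n).hm
    have h2 := (S n).yc.measurable
    refine aux_adjoint (A := fun t => 2 * (a + h n t) * y n t + 2 * l) hδ hab (by fun_prop) ?_ ?_
    · intro t
      have := (S n).h0 t
      have := (S n).y0 t
      positivity
    · intro t
      have h3 := (S n).h0 t
      have h4 := (S n).y0 t
      have h5 := (S n).h1 t
      have h6 := (S n).y1 t
      have h7 : 0 ≤ a + H := by positivity
      gcongr
  choose q hq0 hq1 hqL hqd using hadj
  set Lq : ℝ := (δ + (2 * (a + H) * G + 2 * l)) * (abar / δ) + abar with hLq
  set Ly : ℝ := (a + H) * G ^ 2 + 2 * l * G + s2 with hLy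
  have hLq0 : 0 ≤ Lq := by positivity
  have hLy0 : 0 ≤ Ly := by positivity
  set m : ℕ → ℝ → ℝ := fun n t => q n t * y n t ^ 2 with hmdef
  have hmL : ∀ n, LipschitzWith (Real.toNNReal (Lq * G ^ 2 + abar / δ * (Ly * (2 * G)))) (m n) := by
    intro n
    refine aux_lip (by positivity) fun s t hst => ?_
    have h1 := (hqL n).dist_le_mul t s
    have h2 := ((S n).lip ha hl hs).dist_le_mul t s
    rw [Real.dist_eq, Real.dist_eq, Real.coe_toNNReal _ hLq0, abs_of_nonneg (sub_nonneg.2 hst)] at h1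
    rw [Real.dist_eq, Real.dist_eq, Real.coe_toNNReal _ hLy0, abs_of_nonneg (sub_nonneg.2 hst)] at h2
    have e : m n t - m n s = (q n t - q n s) * y n t ^ 2
        + q n s * ((y n t - y n s) * (y n t + y n s)) := by simp only [hmdef]; ring
    rw [e]
    refine (abs_add_le _ _).trans ?_
    have y1 := (S n).y0 t
    have y2 := (S n).y1 t
    have y3 := (S n).y0 s
    have y4 := (S n).y1 s
    rw [abs_mul, abs_mul, abs_mul, abs_of_nonneg (hq0 n s), abs_of_nonneg (sq_nonneg (y n t)),
      abs_of_nonneg (show 0 ≤ y n t + y n s by linarith)]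
    have hts : 0 ≤ t - s := sub_nonneg.2 hst
    calc _ ≤ Lq * (t - s) * G ^ 2 + abar / δ * (Ly * (t - s) * (2 * G)) := by
          gcongr
          · exact hq1 n s
          · linarith
      _ = _ := by ring
  have hmB : ∀ n t, m n t ∈ Icc 0 (abar / δ * G ^ 2) := by
    intro n t
    have y1 := (S n).y0 t
    have y2 := (S n).y1 t
    have := hq0 n t
    refine ⟨by simp only [hmdef]; positivity, ?_⟩
    simp only [hmdef]
    gcongr
    exact hq1 n t
  set g : ℕ → ℝ → ℝ := fun n t => Real.exp (-δ * t) *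
      ((q n t * y n t ^ 2 * K (m n t) - c (K (m n t))) - (q n t * y n t ^ 2 * h n t - c (h n t))) with hg
  set C := (1 + (abar / δ * (H * G ^ 2 * (4 / δ)) * ((a + H) * (H * G ^ 2 * (4 / δ)) + 2 * H * G))
        * (2 / δ)) with hC
  have hkn : ∀ n, Measurable (fun t => K (m n t)) := fun n =>
    (hKc.comp (hmL n).continuous).measurable
  have hgap : ∀ n, IntegrableOn (g n) (Ioi 0) ∧ ∫ t in Ioi (0:ℝ), g n t ≤ C * ε n := by
    intro n
    have hkm := hkn n
    have hhm := (S n).hm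
    have hadm1 : Measurable (fun t => h n t + ε n * (K (m n t) - h n t)) :=
      hhm.add ((hkm.sub hhm).const_mul _)
    have hadm2 : ∀ t, h n t + ε n * (K (m n t) - h n t) ∈ Icc 0 H := by
      intro t
      have h1 := (convex_Icc 0 H) ((hh n).2 t) (hK1 (m n t)) (sub_nonneg.2 (hε1 n)) (hε0 n).le
        (by ring)
      simp only [smul_eq_mul] at h1
      rwa [show (1 - ε n) * h n t + ε n * K (m n t) = h n t + ε n * (K (m n t) - h n t) by ring] at h1
    refine aux_gap (V := V) hδ hab ha hl hs (hε0 n) (hε1 n) hc hcb hconv.convexOn (S n) hkm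
      (fun t => (hK1 _).1) (fun t => (hK1 _).2) (hY _ hadm1 hadm2) (hq0 n) (hq1 n) (hqL n) (hqd n)
      ?_ ?_
    · rw [← hJ _ hadm1 hadm2]; exact hVle _ hadm1 hadm2
    · rw [← hJ _ (hh n).1 (hh n).2]; exact hJh n
  have hopt : ∀ n t, 0 ≤ (q n t * y n t ^ 2 * K (m n t) - c (K (m n t))) -
      (q n t * y n t ^ 2 * h n t - c (h n t)) := fun n t =>
    sub_nonneg.2 (hK2 (m n t) _ ((hh n).2 t))
  have hg0 : ∀ n t, 0 ≤ g n t := fun n t => mul_nonneg (Real.exp_pos _).le (hopt n t)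
  have hgl : Tendsto (fun n => ∫ t in Ioi (0:ℝ), g n t) atTop (𝓝 0) := by
    refine squeeze_zero (fun n => integral_nonneg (hg0 n)) (fun n => (hgap n).2) ?_
    simpa using hεl.const_mul C
  obtain ⟨φ₁, hφ₁, M, hMc, hM⟩ := aux_arzela hmL hmB
  obtain ⟨φ₂, hφ₂, hae⟩ := aux_ae_subseq (μ := volume.restrict (Ioi (0:ℝ)))
    (g := fun n => g (φ₁ n)) (fun n => (hgap _).1) (fun n => hg0 _) (hgl.comp hφ₁.tendsto_atTop)
  set ψ : ℕ → ℕ := fun n => φ₁ (φ₂ n) with hψ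
  have hψl : Tendsto ψ atTop atTop := hφ₁.tendsto_atTop.comp hφ₂.tendsto_atTop
  set k : ℝ → ℝ := fun t => K (M t) with hk
  have hkc : Continuous k := hKc.comp hMc
  have hkI : ∀ t, k t ∈ Icc 0 H := fun t => hK1 _
  have hconv_ae : ∀ᵐ t ∂(volume.restrict (Ioi (0:ℝ))),
      Tendsto (fun n => h (ψ n) t) atTop (𝓝 (k t)) := by
    filter_upwards [hae] with t ht
    refine hK3 (fun n => m (ψ n) t) (M t) (fun n => h (ψ n) t)
      (fun n => Real.exp (δ * t) * g (ψ n) t) ((hM t).comp hφ₂.tendsto_atTop)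
      (fun n => (hh _).2 t) ?_ ?_
    · simpa using ht.const_mul (Real.exp (δ * t))
    · intro n w hw
      have h1 := hK2 (m (ψ n) t) w hw
      have h2 : Real.exp (δ * t) * g (ψ n) t = (m (ψ n) t * K (m (ψ n) t) - c (K (m (ψ n) t))) -
          (m (ψ n) t * h (ψ n) t - c (h (ψ n) t)) := by
        simp only [hg]
        rw [← mul_assoc, ← Real.exp_add]; simp [hmdef]
      rw [h2]; linarith
  have Sk := hY k hkc.measurable hkI
  have hyl : ∀ t, 0 < t → Tendsto (fun n => y (ψ n) t) atTop (𝓝 (Y k t)) := by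
    intro t ht
    rw [tendsto_iff_dist_tendsto_zero]
    have hb : ∀ n x, |h n x - k x| ≤ H := fun n x => by
      have h1 := (hh n).2 x
      have h2 := hkI x
      rw [abs_le]; constructor <;> linarith [h1.1, h1.2, h2.1, h2.2]
    have hlim : Tendsto (fun n => ∫ x in (0:ℝ)..t, |h (ψ n) x - k x| * G ^ 2) atTop
        (𝓝 (∫ x in (0:ℝ)..t, (0:ℝ))) := by
      refine intervalIntegral.tendsto_integral_filter_of_dominated_convergence
        (fun _ => H * G ^ 2) ?_ ?_ ?_ ?_
      · refine Eventually.of_forall fun n => ?_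
        have := (hh (ψ n)).1
        have := hkc.measurable
        exact Measurable.aestronglyMeasurable (by fun_prop)
      · refine Eventually.of_forall fun n => ae_of_all _ fun x _ => ?_
        rw [Real.norm_eq_abs, abs_of_nonneg (by positivity)]
        gcongr
        exact hb _ x
      · simp
      · have := (ae_restrict_iff' measurableSet_Ioi).1 hconv_ae
        filter_upwards [this] with x hx hx2
        rw [uIoc_of_le ht.le] at hx2
        have h1 := (((hx hx2.1).sub_const (k x)).abs).mul_const (G ^ 2)
        simpa using h1
    simp only [intervalIntegral.integral_zero] at hlim
    refine squeeze_zero (fun n => dist_nonneg) (fun n => ?_) hlim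
    rw [Real.dist_eq]
    exact aux_diff Sk (S (ψ n)) ha hl hs ht.le
  have hJl : Tendsto (fun n => J (h (ψ n))) atTop (𝓝 (J k)) := by
    rw [hJ k hkc.measurable hkI]
    simp_rw [fun n => hJ (h (ψ n)) (hh _).1 (hh _).2]
    refine tendsto_integral_of_dominated_convergence
      (fun t => (abar * G + Cb) * Real.exp (-δ * t)) ?_ ?_ ?_ ?_
    · intro n
      have := (hh (ψ n)).1
      have := (S (ψ n)).yc.measurable
      simp only [hydef] at this
      exact Measurable.aestronglyMeasurable (by fun_prop)
    · exact (integrableOn_exp_mul_Ioi (neg_lt_zero.2 hδ) 0).const_mul _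
    · intro n
      refine ae_of_all _ fun t => ?_
      rw [Real.norm_eq_abs, abs_mul, abs_of_pos (Real.exp_pos _), mul_comm]
      gcongr
      refine (abs_add_le _ _).trans (add_le_add ?_ (hcb _))
      rw [abs_of_nonneg (mul_nonneg hab.le ((S (ψ n)).y0 t))]
      gcongr; exact (S (ψ n)).y1 t
    · filter_upwards [hconv_ae, ae_restrict_mem measurableSet_Ioi] with t h1 h2
      exact (((hyl t h2).const_mul abar).add ((hc.tendsto _).comp h1)).const_mul _
  have hJV : J k ≤ V := by
    have h1 : Tendsto (fun n => V + ε (ψ n) ^ 2) atTop (𝓝 (V + 0 ^ 2)) :=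
      ((hεl.comp hψl).pow 2).const_add V
    have := le_of_tendsto_of_tendsto' hJl h1 fun n => hJh _
    simpa using this
  exact ⟨k, hkc, hkI, fun h' h1 h2 => hJV.trans (hVle h' h1 h2)⟩

end helpers



/-- For every initial condition γ₀ ∈ [0, γ_max], there exists a continuous
admissible control h* attaining the infimum defining the value function of the reduced
deterministic control problem, i.e. J(h*; γ₀) = v(γ₀). -/
theorem stmt_8
    (σ₁ σ₂ lam δ abar γmax hmax : ℝ)
    (hσ₁ : 0 < σ₁) (hσ₂ : 0 ≤ σ₂) (hlam : 0 ≤ lam) (hδ : 0 < δ) (habar : 0 < abar)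
    (f : ℝ → ℝ → ℝ)
    (hf : ∀ γ h : ℝ, f γ h = -(1 / σ₁ ^ 2 + h) * γ ^ 2 - 2 * lam * γ + σ₂ ^ 2)
    (γinf : ℝ)
    (hγinf : γinf = -lam * σ₁ ^ 2 + Real.sqrt (lam ^ 2 * σ₁ ^ 4 + σ₁ ^ 2 * σ₂ ^ 2))
    (hγmax : γinf < γmax)
    (c c' : ℝ → ℝ)
    (hc_nonneg : ∀ x : ℝ, 0 ≤ x → 0 ≤ c x)
    (hc_conv : StrictConvexOn ℝ (Set.Ici 0) c)
    (hc_mono : StrictMonoOn c (Set.Ici 0))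
    (hc_smooth : ContDiffOn ℝ 2 c (Set.Ici 0))
    (hc_deriv : ∀ x ∈ Set.Ici (0 : ℝ), HasDerivWithinAt c (c' x) (Set.Ici 0) x)
    (hhmax : 0 < hmax) (hc_hmax : c' hmax = γmax ^ 2 * (abar / δ))
    (Adm : (ℝ → ℝ) → Prop)
    (hAdm : ∀ h : ℝ → ℝ, Adm h ↔ Measurable h ∧ ∀ t : ℝ, h t ∈ Set.Icc 0 hmax)
    (sol : (ℝ → ℝ) → ℝ → ℝ → ℝ)
    (hsol : ∀ h : ℝ → ℝ, Adm h → ∀ γ₀ ∈ Set.Icc (0 : ℝ) γmax,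
      sol h γ₀ 0 = γ₀ ∧
      ContinuousOn (sol h γ₀) (Set.Ici 0) ∧
      (∀ t ∈ Set.Ici (0 : ℝ), sol h γ₀ t ∈ Set.Icc 0 γmax) ∧
      (∀ t ∈ Set.Ici (0 : ℝ),
        sol h γ₀ t = γ₀ + ∫ s in (0 : ℝ)..t, f (sol h γ₀ s) (h s)))
    (J : (ℝ → ℝ) → ℝ → ℝ)
    (hJ : ∀ (h : ℝ → ℝ) (γ₀ : ℝ), J h γ₀ =
      ∫ t in Set.Ioi (0 : ℝ), Real.exp (-δ * t) * (abar * sol h γ₀ t + c (h t)))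
    (v : ℝ → ℝ)
    (hv : ∀ γ₀ ∈ Set.Icc (0 : ℝ) γmax,
      v γ₀ = sInf ((fun h => J h γ₀) '' {h : ℝ → ℝ | Adm h}))
    (γ₀ : ℝ) (hγ₀ : γ₀ ∈ Set.Icc (0 : ℝ) γmax) :
    ∃ hstar : ℝ → ℝ, ContinuousOn hstar (Set.Ici 0) ∧ Adm hstar ∧
      J hstar γ₀ = v γ₀ := by
  have hH : (0:ℝ) ≤ hmax := hhmax.le
  set p : ℝ → ℝ := fun x => max 0 (min x hmax) with hp
  have hp1 : ∀ x, p x ∈ Set.Icc 0 hmax := fun x =>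
    ⟨le_max_left _ _, max_le hH (min_le_right _ _)⟩
  have hp2 : ∀ x ∈ Set.Icc 0 hmax, p x = x := fun x hx => by
    simp only [hp]; rw [min_eq_left hx.2, max_eq_right hx.1]
  have hpc : Continuous p := by fun_prop
  have hcc : ContinuousOn c (Set.Ici 0) := hc_smooth.continuousOn
  have hcpc : Continuous (fun x => c (p x)) :=
    hcc.comp_continuous hpc fun x => (hp1 x).1
  obtain ⟨Cb, hCb⟩ := (isCompact_Icc (a := (0:ℝ)) (b := hmax)).exists_bound_of_continuousOn
    (hcc.mono fun x hx => hx.1)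
  have hconv : StrictConvexOn ℝ (Set.Icc 0 hmax) (fun x => c (p x)) := by
    refine (hc_conv.subset (fun x hx => hx.1) (convex_Icc 0 hmax)).congr fun x hx => ?_
    simp only [hp2 x hx]
  have hY : ∀ h : ℝ → ℝ, Measurable h → (∀ t, h t ∈ Set.Icc 0 hmax) →
      IsSol (1 / σ₁ ^ 2) lam (σ₂ ^ 2) γmax hmax γ₀ h (fun t => sol h γ₀ (max t 0)) := by
    intro h h1 h2
    obtain ⟨e0, ec, er, ee⟩ := hsol h ((hAdm h).2 ⟨h1, h2⟩) γ₀ hγ₀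
    refine ⟨h1, fun t => (h2 t).1, fun t => (h2 t).2, ?_, fun t => (er _ (le_max_right t 0)).1,
      fun t => (er _ (le_max_right t 0)).2, fun t => by simp, fun t ht => ?_⟩
    · exact ec.comp_continuous (by fun_prop) fun t => le_max_right t 0
    · rw [max_eq_left ht, ee t ht]
      congr 1
      refine intervalIntegral.integral_congr fun s hs => ?_
      rw [Set.uIcc_of_le ht] at hs
      simp only [hf]
      rw [max_eq_left hs.1]
  obtain ⟨k, hkc, hkI, hkmin⟩ := aux_core (Cb := Cb) hδ habar (by positivity) hlam (by positivity) hH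
    hcpc (fun x => hCb _ (hp1 x)) (fun x => hc_nonneg _ (hp1 x).1) hconv _ hY
    (fun h => J h γ₀) (by
      intro h h1 h2
      rw [hJ]
      refine MeasureTheory.setIntegral_congr_fun measurableSet_Ioi fun t ht => ?_
      rw [max_eq_left (le_of_lt ht), hp2 _ (h2 t)])
  have hka : Adm k := (hAdm k).2 ⟨hkc.measurable, hkI⟩
  refine ⟨k, hkc.continuousOn, hka, ?_⟩
  rw [hv γ₀ hγ₀]
  symm
  refine IsLeast.csInf_eq ⟨⟨k, hka, rfl⟩, ?_⟩
  rintro _ ⟨h, hh, rfl⟩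
  exact hkmin h ((hAdm h).1 hh).1 ((hAdm h).1 hh).2
end

section
/- The value function v : [0, γ_max] → [0,∞) of the reduced deterministic control problem is strictly increasing, strictly concave, and Lipschitz continuous with Lipschitz constant L_v = ā/δ. -/
open MeasureTheory Set in
lemma aux_nonneg (d g : ℝ → ℝ) (hd : ContinuousOn d (Ici 0))
    (hg : ∀ t, 0 ≤ t → IntervalIntegrable g volume 0 t) (h0 : 0 ≤ d 0)
    (heq : ∀ t, 0 ≤ t → d t = d 0 + ∫ s in (0:ℝ)..t, g s)
    (hneg : ∀ r, 0 ≤ r → d r < 0 → 0 ≤ g r) : ∀ t, 0 ≤ t → 0 ≤ d t := by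
  intro t ht
  by_contra hlt
  push Not at hlt
  have hdc : ContinuousOn d (Icc 0 t) := hd.mono (fun s hs => hs.1)
  have hcl : IsClosed (Icc 0 t ∩ d ⁻¹' (Ici 0)) :=
    hdc.preimage_isClosed_of_isClosed isClosed_Icc isClosed_Ici
  have hcomp : IsCompact (Icc 0 t ∩ d ⁻¹' (Ici 0)) :=
    isCompact_Icc.of_isClosed_subset hcl inter_subset_left
  obtain ⟨s, ⟨⟨hs0, hst⟩, hds⟩, hsup⟩ := hcomp.exists_isGreatest ⟨0, ⟨le_refl _, ht⟩, h0⟩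
  have hds' : 0 ≤ d s := hds
  have hsub := intervalIntegral.integral_interval_sub_left (hg t ht) (hg s hs0)
  have hnn : 0 ≤ ∫ r in s..t, g r := by
    rw [intervalIntegral.integral_of_le hst]
    apply setIntegral_nonneg measurableSet_Ioc
    intro r hr
    have hr0 : 0 ≤ r := hs0.trans hr.1.le
    apply hneg r hr0
    by_contra hc
    push Not at hc
    have := hsup ⟨⟨hr0, hr.2⟩, hc⟩
    exact absurd hr.1 (not_lt.mpr this)
  have e1 := heq t ht
  have e2 := heq s hs0
  linarith

open MeasureTheory Set in
lemma aux_comp (u g ψ ψ' : ℝ → ℝ) (hu : ContinuousOn u (Ici 0))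
    (hg : ∀ t, 0 ≤ t → IntervalIntegrable g volume 0 t)
    (heq : ∀ t, 0 ≤ t → u t = u 0 + ∫ s in (0:ℝ)..t, g s)
    (hψ : ∀ t, HasDerivAt ψ (ψ' t) t) (hψ' : Continuous ψ') (h0 : ψ 0 ≤ u 0)
    (hlt : ∀ r, 0 ≤ r → u r < ψ r → ψ' r ≤ g r) : ∀ t, 0 ≤ t → ψ t ≤ u t := by
  have hψc : Continuous ψ := continuous_iff_continuousAt.mpr fun t => (hψ t).continuousAt
  have key := aux_nonneg (fun t => u t - ψ t) (fun t => g t - ψ' t)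
    (hu.sub hψc.continuousOn) (fun t ht => (hg t ht).sub (hψ'.intervalIntegrable _ _))
    (by simpa using h0)
    (by
      intro t ht
      rw [intervalIntegral.integral_sub (hg t ht) (hψ'.intervalIntegrable _ _),
        intervalIntegral.integral_eq_sub_of_hasDerivAt (fun x _ => hψ x)
          (hψ'.intervalIntegrable _ _)]
      have := heq t ht
      linarith)
    (by
      intro r hr h
      have := hlt r hr (by simpa using h)
      simpa using this)
  intro t ht
  simpa using key t ht

open MeasureTheory Set in
structure AuxTr (p l q gm : ℝ) (h γ : ℝ → ℝ) (x : ℝ) : Prop where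
  cont : ContinuousOn γ (Ici 0)
  mem : ∀ t, 0 ≤ t → γ t ∈ Icc 0 gm
  eq : ∀ t, 0 ≤ t → γ t = x + ∫ s in (0:ℝ)..t, (-(p + h s) * γ s ^ 2 - l * γ s + q)

open MeasureTheory Set in
lemma AuxTr.init {p l q gm : ℝ} {h γ : ℝ → ℝ} {x : ℝ} (T : AuxTr p l q gm h γ x) : γ 0 = x := by
  have := T.eq 0 le_rfl
  simpa using this

open MeasureTheory Set in
lemma AuxTr.int {p l q gm hm : ℝ} {h γ : ℝ → ℝ} {x : ℝ} (T : AuxTr p l q gm h γ x)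
    (hh : Measurable h) (hb : ∀ t, h t ∈ Icc 0 hm) (t : ℝ) (ht : 0 ≤ t) :
    IntervalIntegrable (fun s => -(p + h s) * γ s ^ 2 - l * γ s + q) volume 0 t := by
  have hi : IntervalIntegrable h volume 0 t := by
    rw [intervalIntegrable_iff]
    refine Measure.integrableOn_of_bounded (M := hm) (by simp) hh.aestronglyMeasurable ?_
    refine Filter.Eventually.of_forall fun s => ?_
    rw [Real.norm_eq_abs, abs_of_nonneg (hb s).1]
    exact (hb s).2
  have hc : ContinuousOn γ (uIcc 0 t) := by
    rw [uIcc_of_le ht]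
    exact T.cont.mono fun s hs => hs.1
  have h1 : IntervalIntegrable (fun s => h s * (- γ s ^ 2)) volume 0 t :=
    hi.mul_continuousOn (hc.pow 2).neg
  have h2 : IntervalIntegrable (fun s => -p * γ s ^ 2 - l * γ s + q) volume 0 t := by
    apply ContinuousOn.intervalIntegrable
    fun_prop
  refine (h1.add h2).congr ?_
  intro s _
  ring

section
open MeasureTheory Set
variable {p l q gm hm : ℝ} {h γx γy γz : ℝ → ℝ} {x y z a b K : ℝ}

lemma aux_rate (hb : ∀ t, h t ∈ Icc 0 hm) (hp : 0 < p) (hl : 0 ≤ l)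
    (hK : K = 2 * (p + hm) * gm + l) {t u w : ℝ} (hu : u ∈ Icc 0 gm) (hw : w ∈ Icc 0 gm) :
    0 ≤ (p + h t) * (u + w) + l ∧ (p + h t) * (u + w) + l ≤ K := by
  obtain ⟨h1, h2⟩ := hb t
  obtain ⟨u1, u2⟩ := hu
  obtain ⟨w1, w2⟩ := hw
  refine ⟨by positivity, ?_⟩
  have : (p + h t) * (u + w) ≤ (p + hm) * (gm + gm) := by
    apply mul_le_mul <;> linarith
  rw [hK]; linarith

lemma aux_lower (hh : Measurable h) (hb : ∀ t, h t ∈ Icc 0 hm) (hp : 0 < p) (hl : 0 ≤ l)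
    (hK : K = 2 * (p + hm) * gm + l)
    (Tx : AuxTr p l q gm h γx x) (Ty : AuxTr p l q gm h γy y) (hxy : x ≤ y) :
    ∀ t, 0 ≤ t → (y - x) * Real.exp (-K * t) ≤ γy t - γx t := by
  apply aux_comp (fun t => γy t - γx t)
    (fun s => (-(p + h s) * γy s ^ 2 - l * γy s + q) - (-(p + h s) * γx s ^ 2 - l * γx s + q))
    (fun t => (y - x) * Real.exp (-K * t)) (fun t => (y - x) * (Real.exp (-K * t) * (-K)))
    (Ty.cont.sub Tx.cont) (fun t ht => (Ty.int hh hb t ht).sub (Tx.int hh hb t ht))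
  · intro t ht
    rw [intervalIntegral.integral_sub (Ty.int hh hb t ht) (Tx.int hh hb t ht)]
    rw [Tx.init, Ty.init]
    have := Tx.eq t ht
    have := Ty.eq t ht
    linarith
  · intro t
    have : HasDerivAt (fun t : ℝ => -K * t) (-K) t := by
      simpa using (hasDerivAt_id t).const_mul (-K)
    exact (this.exp).const_mul _
  · fun_prop
  · simp [Tx.init, Ty.init]
  · intro r hr hlt
    obtain ⟨r1, r2⟩ := aux_rate (t := r) hb hp hl hK (Tx.mem r hr) (Ty.mem r hr)
    set A := (p + h r) * (γx r + γy r) + l with hA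
    have hg : (-(p + h r) * γy r ^ 2 - l * γy r + q) - (-(p + h r) * γx r ^ 2 - l * γx r + q)
      = - A * (γy r - γx r) := by rw [hA]; ring
    rw [hg]
    have hφ : 0 ≤ (y - x) * Real.exp (-K * r) := mul_nonneg (by linarith) (Real.exp_pos _).le
    nlinarith

lemma aux_upper (hh : Measurable h) (hb : ∀ t, h t ∈ Icc 0 hm) (hp : 0 < p) (hl : 0 ≤ l)
    (Tx : AuxTr p l q gm h γx x) (Ty : AuxTr p l q gm h γy y) (hxy : x ≤ y) :
    ∀ t, 0 ≤ t → γy t - γx t ≤ y - x := by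
  have hlow := aux_lower hh hb hp hl rfl Tx Ty hxy
  have key := aux_comp (fun t => γx t - γy t)
    (fun s => (-(p + h s) * γx s ^ 2 - l * γx s + q) - (-(p + h s) * γy s ^ 2 - l * γy s + q))
    (fun _ => x - y) (fun _ => 0)
    (Tx.cont.sub Ty.cont) (fun t ht => (Tx.int hh hb t ht).sub (Ty.int hh hb t ht))
    (by
      intro t ht
      rw [intervalIntegral.integral_sub (Tx.int hh hb t ht) (Ty.int hh hb t ht)]
      rw [Tx.init, Ty.init]
      have := Tx.eq t ht
      have := Ty.eq t ht
      linarith)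
    (fun t => hasDerivAt_const _ _) continuous_const (by simp [Tx.init, Ty.init])
    (by
      intro r hr _
      obtain ⟨r1, r2⟩ := aux_rate (t := r) hb hp hl rfl (Tx.mem r hr) (Ty.mem r hr)
      have := hlow r hr
      have hφ : 0 ≤ (y - x) * Real.exp (-(2 * (p + hm) * gm + l) * r) :=
        mul_nonneg (by linarith) (Real.exp_pos _).le
      have h3 : 0 ≤ ((p + h r) * (γx r + γy r) + l) * (γy r - γx r) :=
        mul_nonneg r1 (by linarith)
      linarith)
  intro t ht
  have := key t ht
  linarith

lemma aux_conc (hh : Measurable h) (hb : ∀ t, h t ∈ Icc 0 hm) (hp : 0 < p) (hl : 0 ≤ l)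
    (hK : K = 2 * (p + hm) * gm + l) (hKpos : 0 < K)
    (ha : 0 < a) (hb' : 0 < b) (hab : a + b = 1) (hz : z = a * x + b * y)
    (Tx : AuxTr p l q gm h γx x) (Ty : AuxTr p l q gm h γy y) (Tz : AuxTr p l q gm h γz z)
    (hxy : x ≤ y) :
    ∀ t, 0 ≤ t → p * (a * b) * (y - x) ^ 2 / K * (Real.exp (-K * t) - Real.exp (-(2 * K) * t))
      ≤ γz t - (a * γx t + b * γy t) := by
  have hlow := aux_lower hh hb hp hl hK Tx Ty hxy
  set C := p * (a * b) * (y - x) ^ 2 / K with hC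
  have hCK : C * K = p * (a * b) * (y - x) ^ 2 := by rw [hC]; field_simp
  have hC0 : 0 ≤ C := by rw [hC]; positivity
  apply aux_comp (fun t => γz t - (a * γx t + b * γy t))
    (fun s => (-(p + h s) * γz s ^ 2 - l * γz s + q) -
      (a * (-(p + h s) * γx s ^ 2 - l * γx s + q) + b * (-(p + h s) * γy s ^ 2 - l * γy s + q)))
    (fun t => C * (Real.exp (-K * t) - Real.exp (-(2 * K) * t)))
    (fun t => C * (Real.exp (-K * t) * (-K) - Real.exp (-(2 * K) * t) * (-(2 * K))))
    (Tz.cont.sub ((Tx.cont.const_mul a).add (Ty.cont.const_mul b)))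
    (fun t ht => (Tz.int hh hb t ht).sub
      (((Tx.int hh hb t ht).const_mul a).add ((Ty.int hh hb t ht).const_mul b)))
  · intro t ht
    rw [intervalIntegral.integral_sub (Tz.int hh hb t ht)
      (((Tx.int hh hb t ht).const_mul a).add ((Ty.int hh hb t ht).const_mul b)),
      intervalIntegral.integral_add ((Tx.int hh hb t ht).const_mul a)
        ((Ty.int hh hb t ht).const_mul b),
      intervalIntegral.integral_const_mul, intervalIntegral.integral_const_mul]
    rw [Tx.init, Ty.init, Tz.init]
    have e1 := Tx.eq t ht
    have e2 := Ty.eq t ht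
    have e3 := Tz.eq t ht
    linear_combination e3 - a * e1 - b * e2
  · intro t
    have d1 (k : ℝ) : HasDerivAt (fun t : ℝ => Real.exp (-k * t)) (Real.exp (-k * t) * (-k)) t := by
      have : HasDerivAt (fun t : ℝ => -k * t) (-k) t := by
        simpa using (hasDerivAt_id t).const_mul (-k)
      exact this.exp
    exact ((d1 K).sub (d1 (2 * K))).const_mul _
  · fun_prop
  · simp [Tx.init, Ty.init, Tz.init, hz]
  · intro r hr hlt
    have hx := Tx.mem r hr
    have hy := Ty.mem r hr
    have hm' : a * γx r + b * γy r ∈ Icc 0 gm := by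
      have := (convex_Icc (0:ℝ) gm) hx hy ha.le hb'.le hab
      simpa using this
    obtain ⟨r1, r2⟩ := aux_rate (t := r) hb hp hl hK (Tz.mem r hr) hm'
    set A := (p + h r) * (γz r + (a * γx r + b * γy r)) + l with hA
    have hg : (-(p + h r) * γz r ^ 2 - l * γz r + q) -
      (a * (-(p + h r) * γx r ^ 2 - l * γx r + q) + b * (-(p + h r) * γy r ^ 2 - l * γy r + q))
      = - A * (γz r - (a * γx r + b * γy r)) + (p + h r) * (a * b) * (γy r - γx r) ^ 2 := by
      have hb1 : b = 1 - a := by linarith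
      rw [hA, hb1]; ring
    rw [hg]
    have hE2 : Real.exp (-(2 * K) * r) = Real.exp (-K * r) ^ 2 := by
      rw [← Real.exp_nat_mul]; congr 1; push_cast; ring
    have hEpos := Real.exp_pos (-K * r)
    have hE1 : Real.exp (-K * r) ≤ 1 := by
      apply Real.exp_le_one_iff.mpr; nlinarith
    rw [hE2] at hlt ⊢
    set E := Real.exp (-K * r)
    have hD : ((y - x) * E) ^ 2 ≤ (γy r - γx r) ^ 2 :=
      pow_le_pow_left₀ (mul_nonneg (by linarith) hEpos.le) (hlow r hr) 2
    have hB : C * K * E ^ 2 ≤ (p + h r) * (a * b) * (γy r - γx r) ^ 2 := by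
      rw [hCK]
      calc p * (a * b) * (y - x) ^ 2 * E ^ 2 = (p * (a * b)) * ((y - x) * E) ^ 2 := by ring
        _ ≤ ((p + h r) * (a * b)) * (γy r - γx r) ^ 2 := by
          apply mul_le_mul _ hD (by positivity)
            (mul_nonneg (by have := (hb r).1; linarith) (by positivity))
          apply mul_le_mul_of_nonneg_right _ (by positivity)
          have := (hb r).1
          linarith
    have hψ0 : 0 ≤ C * (E - E ^ 2) := mul_nonneg hC0 (by nlinarith)
    have hW : A * (γz r - (a * γx r + b * γy r)) ≤ K * (C * (E - E ^ 2)) := by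
      calc A * (γz r - (a * γx r + b * γy r)) ≤ A * (C * (E - E ^ 2)) :=
            mul_le_mul_of_nonneg_left hlt.le r1
        _ ≤ K * (C * (E - E ^ 2)) := mul_le_mul_of_nonneg_right r2 hψ0
    linarith

end

/-- The value function v of the reduced deterministic control problem is
strictly increasing, strictly concave, and Lipschitz continuous on [0,γ_max] with
Lipschitz constant L_v = ā/δ. -/
theorem stmt_9
    (σ₁ σ₂ lam δ abar γmax hmax : ℝ)
    (hσ₁ : 0 < σ₁) (hσ₂ : 0 ≤ σ₂) (hlam : 0 ≤ lam) (hδ : 0 < δ) (habar : 0 < abar)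
    (f : ℝ → ℝ → ℝ)
    (hf : ∀ γ h : ℝ, f γ h = -(1 / σ₁ ^ 2 + h) * γ ^ 2 - 2 * lam * γ + σ₂ ^ 2)
    (γinf : ℝ)
    (hγinf : γinf = -lam * σ₁ ^ 2 + Real.sqrt (lam ^ 2 * σ₁ ^ 4 + σ₁ ^ 2 * σ₂ ^ 2))
    (hγmax : γinf < γmax)
    (c c' : ℝ → ℝ)
    (hc_nonneg : ∀ x : ℝ, 0 ≤ x → 0 ≤ c x)
    (hc_conv : StrictConvexOn ℝ (Set.Ici 0) c)
    (hc_mono : StrictMonoOn c (Set.Ici 0))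
    (hc_smooth : ContDiffOn ℝ 2 c (Set.Ici 0))
    (hc_deriv : ∀ x ∈ Set.Ici (0 : ℝ), HasDerivWithinAt c (c' x) (Set.Ici 0) x)
    (hhmax : 0 < hmax) (hc_hmax : c' hmax = γmax ^ 2 * (abar / δ))
    (Adm : (ℝ → ℝ) → Prop)
    (hAdm : ∀ h : ℝ → ℝ, Adm h ↔ Measurable h ∧ ∀ t : ℝ, h t ∈ Set.Icc 0 hmax)
    (sol : (ℝ → ℝ) → ℝ → ℝ → ℝ)
    (hsol : ∀ h : ℝ → ℝ, Adm h → ∀ γ₀ ∈ Set.Icc (0 : ℝ) γmax,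
      sol h γ₀ 0 = γ₀ ∧
      ContinuousOn (sol h γ₀) (Set.Ici 0) ∧
      (∀ t ∈ Set.Ici (0 : ℝ), sol h γ₀ t ∈ Set.Icc 0 γmax) ∧
      (∀ t ∈ Set.Ici (0 : ℝ),
        sol h γ₀ t = γ₀ + ∫ s in (0 : ℝ)..t, f (sol h γ₀ s) (h s)))
    (J : (ℝ → ℝ) → ℝ → ℝ)
    (hJ : ∀ (h : ℝ → ℝ) (γ₀ : ℝ), J h γ₀ =
      ∫ t in Set.Ioi (0 : ℝ), Real.exp (-δ * t) * (abar * sol h γ₀ t + c (h t)))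
    (v : ℝ → ℝ)
    (hv : ∀ γ₀ ∈ Set.Icc (0 : ℝ) γmax,
      v γ₀ = sInf ((fun h => J h γ₀) '' {h : ℝ → ℝ | Adm h}))
    : StrictMonoOn v (Set.Icc 0 γmax) ∧
      StrictConcaveOn ℝ (Set.Icc 0 γmax) v ∧
      (∀ x ∈ Set.Icc (0 : ℝ) γmax, ∀ y ∈ Set.Icc (0 : ℝ) γmax,
        |v x - v y| ≤ abar / δ * |x - y|) := by
  classical
  have hγinf0 : 0 ≤ γinf := by
    rw [hγinf]
    have : lam * σ₁ ^ 2 ≤ Real.sqrt (lam ^ 2 * σ₁ ^ 4 + σ₁ ^ 2 * σ₂ ^ 2) := by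
      apply Real.le_sqrt_of_sq_le
      nlinarith [sq_nonneg (σ₁ * σ₂)]
    linarith
  have hgm : 0 < γmax := by linarith
  set p : ℝ := 1 / σ₁ ^ 2 with hp_def
  have hp : 0 < p := by positivity
  have hl : 0 ≤ 2 * lam := by positivity
  obtain ⟨K, hK⟩ : ∃ K, K = 2 * (p + hmax) * γmax + 2 * lam := ⟨_, rfl⟩
  have hKpos : 0 < K := by rw [hK]; positivity
  have T : ∀ h, Adm h → ∀ x ∈ Set.Icc (0 : ℝ) γmax,
      AuxTr p (2 * lam) (σ₂ ^ 2) γmax h (sol h x) x := by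
    intro h hh x hx
    obtain ⟨_, h2, h3, h4⟩ := hsol h hh x hx
    refine ⟨h2, h3, fun t ht => ?_⟩
    have := h4 t ht
    simp only [hf] at this
    exact this
  have hint : ∀ h, Adm h → ∀ x ∈ Set.Icc (0 : ℝ) γmax, MeasureTheory.IntegrableOn
      (fun t => Real.exp (-δ * t) * (abar * sol h x t + c (h t))) (Set.Ioi 0) := by
    intro h hh x hx
    obtain ⟨hm, hb⟩ := (hAdm h).1 hh
    have Tx := T h hh x hx
    have hcm : Measurable (fun t => c (h t)) := by
      have h1 : Continuous (fun u : ℝ => c (max u 0)) :=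
        hc_smooth.continuousOn.comp_continuous (by fun_prop) (fun u => Set.mem_Ici.2 (le_max_right _ _))
      have h2 : (fun t => c (h t)) = (fun u : ℝ => c (max u 0)) ∘ h := by
        funext t
        simp [max_eq_left (hb t).1]
      rw [h2]
      exact h1.measurable.comp hm
    have hexp := integrableOn_exp_mul_Ioi (a := -δ) (by linarith) 0
    refine MeasureTheory.Integrable.mul_bdd (c := abar * γmax + c hmax) hexp ?_ ?_
    · refine MeasureTheory.AEStronglyMeasurable.add ?_ hcm.aestronglyMeasurable
      refine ((Tx.cont.const_mul abar).mono ?_).aestronglyMeasurable measurableSet_Ioi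
      exact Set.Ioi_subset_Ici_self
    · refine (MeasureTheory.ae_restrict_iff' measurableSet_Ioi).2 (Filter.Eventually.of_forall ?_)
      intro t ht
      obtain ⟨g1, g2⟩ := Tx.mem t (le_of_lt ht)
      have c1 := hc_nonneg _ (hb t).1
      have c2 : c (h t) ≤ c hmax := hc_mono.monotoneOn (hb t).1 hhmax.le (hb t).2
      rw [Real.norm_eq_abs, abs_of_nonneg (by positivity)]
      gcongr
  have hJnn : ∀ h, Adm h → ∀ x ∈ Set.Icc (0 : ℝ) γmax, 0 ≤ J h x := by
    intro h hh x hx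
    rw [hJ]
    apply MeasureTheory.setIntegral_nonneg measurableSet_Ioi
    intro t ht
    have g1 := ((T h hh x hx).mem t (le_of_lt ht)).1
    have c1 := hc_nonneg _ (((hAdm h).1 hh).2 t).1
    positivity
  have hA0 : Adm (fun _ => 0) := (hAdm _).2 ⟨measurable_const, fun _ => ⟨le_rfl, hhmax.le⟩⟩
  have hvle : ∀ h, Adm h → ∀ x ∈ Set.Icc (0 : ℝ) γmax, v x ≤ J h x := by
    intro h hh x hx
    rw [hv x hx]
    apply csInf_le
    · refine ⟨0, ?_⟩
      rintro _ ⟨g, hg, rfl⟩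
      exact hJnn g hg x hx
    · exact ⟨h, hh, rfl⟩
  have hlev : ∀ x ∈ Set.Icc (0 : ℝ) γmax, ∀ m, (∀ h, Adm h → m ≤ J h x) → m ≤ v x := by
    intro x hx m hm
    rw [hv x hx]
    apply le_csInf
    · exact ⟨_, _, hA0, rfl⟩
    · rintro _ ⟨g, hg, rfl⟩
      exact hm g hg
  have hexpI : ∀ k : ℝ, 0 < k → MeasureTheory.IntegrableOn (fun t => Real.exp (-k * t)) (Set.Ioi 0) :=
    fun k hk => integrableOn_exp_mul_Ioi (by linarith) 0
  have hexpV : ∀ k : ℝ, 0 < k → ∫ t in Set.Ioi (0:ℝ), Real.exp (-k * t) = 1 / k := by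
    intro k hk
    rw [integral_exp_mul_Ioi (by linarith)]
    simp
  -- lower increments
  have hmonoJ : ∀ h, Adm h → ∀ x ∈ Set.Icc (0 : ℝ) γmax, ∀ y ∈ Set.Icc (0 : ℝ) γmax, x ≤ y →
      J h x + abar * (y - x) * (1 / (δ + K)) ≤ J h y := by
    intro h hh x hx y hy hxy
    obtain ⟨hm, hb⟩ := (hAdm h).1 hh
    have hlow := aux_lower hm hb hp hl hK (T h hh x hx) (T h hh y hy) hxy
    rw [hJ, hJ, ← hexpV (δ + K) (by linarith), ← MeasureTheory.integral_const_mul,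
      ← MeasureTheory.integral_add (hint h hh x hx) ((hexpI _ (by linarith)).const_mul _)]
    apply MeasureTheory.setIntegral_mono_on
      ((hint h hh x hx).add ((hexpI _ (by linarith)).const_mul _)) (hint h hh y hy) measurableSet_Ioi
    intro t ht
    have h1 := hlow t (le_of_lt ht)
    have e1 : Real.exp (-(δ + K) * t) = Real.exp (-δ * t) * Real.exp (-K * t) := by
      rw [← Real.exp_add]; congr 1; ring
    have h2 := mul_le_mul_of_nonneg_left h1 (mul_pos (Real.exp_pos (-δ * t)) habar).le
    simp only [Pi.add_apply]
    rw [e1]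
    linarith
  have hlipJ : ∀ h, Adm h → ∀ x ∈ Set.Icc (0 : ℝ) γmax, ∀ y ∈ Set.Icc (0 : ℝ) γmax, x ≤ y →
      J h y ≤ J h x + abar * (y - x) * (1 / δ) := by
    intro h hh x hx y hy hxy
    obtain ⟨hm, hb⟩ := (hAdm h).1 hh
    have hup := aux_upper hm hb hp hl (T h hh x hx) (T h hh y hy) hxy
    rw [hJ, hJ, ← hexpV δ hδ, ← MeasureTheory.integral_const_mul,
      ← MeasureTheory.integral_add (hint h hh x hx) ((hexpI _ hδ).const_mul _)]
    apply MeasureTheory.setIntegral_mono_on (hint h hh y hy)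
      ((hint h hh x hx).add ((hexpI _ hδ).const_mul _)) measurableSet_Ioi
    intro t ht
    have h1 := hup t (le_of_lt ht)
    have h2 := mul_le_mul_of_nonneg_left h1 (mul_pos (Real.exp_pos (-δ * t)) habar).le
    simp only [Pi.add_apply]
    linarith
  have hmono : StrictMonoOn v (Set.Icc 0 γmax) := by
    intro x hx y hy hxy
    have hpos : 0 < abar * (y - x) * (1 / (δ + K)) := by
      have : 0 < y - x := by linarith
      positivity
    have := hlev y hy (v x + abar * (y - x) * (1 / (δ + K))) (fun h hh => by
      have h1 := hmonoJ h hh x hx y hy hxy.le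
      have h2 := hvle h hh x hx
      linarith)
    linarith
  have hlip : ∀ x ∈ Set.Icc (0 : ℝ) γmax, ∀ y ∈ Set.Icc (0 : ℝ) γmax, x ≤ y →
      v y - v x ≤ abar / δ * (y - x) := by
    intro x hx y hy hxy
    have := hlev x hx (v y - abar * (y - x) * (1 / δ)) (fun h hh => by
      have h1 := hlipJ h hh x hx y hy hxy
      have h2 := hvle h hh y hy
      linarith)
    have e : abar / δ * (y - x) = abar * (y - x) * (1 / δ) := by ring
    linarith
  have hconc : ∀ x ∈ Set.Icc (0 : ℝ) γmax, ∀ y ∈ Set.Icc (0 : ℝ) γmax, x < y →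
      ∀ a b : ℝ, 0 < a → 0 < b → a + b = 1 → a * v x + b * v y < v (a * x + b * y) := by
    intro x hx y hy hxy a b ha hb0 hab
    obtain ⟨z, hz⟩ : ∃ z, z = a * x + b * y := ⟨_, rfl⟩
    have hzm : z ∈ Set.Icc (0 : ℝ) γmax := by
      have := (convex_Icc (0:ℝ) γmax) hx hy ha.le hb0.le hab
      rw [hz]
      simpa using this
    rw [← hz]
    obtain ⟨C, hC⟩ : ∃ C, C = p * (a * b) * (y - x) ^ 2 / K := ⟨_, rfl⟩
    have hCpos : 0 < C := by
      have : 0 < y - x := by linarith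
      rw [hC]; positivity
    have hδK : 0 < δ + K := by linarith
    have hδ2K : 0 < δ + 2 * K := by linarith
    have hεpos : 0 < abar * C * (1 / (δ + K) - 1 / (δ + 2 * K)) := by
      have : 1 / (δ + 2 * K) < 1 / (δ + K) := by
        apply one_div_lt_one_div_of_lt hδK; linarith
      have : 0 < 1 / (δ + K) - 1 / (δ + 2 * K) := by linarith
      positivity
    have hcJ : ∀ h, Adm h → (a * J h x + b * J h y) +
        abar * C * (1 / (δ + K) - 1 / (δ + 2 * K)) ≤ J h z := by
      intro h hh
      obtain ⟨hm, hb⟩ := (hAdm h).1 hh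
      have hlow := aux_conc hm hb hp hl hK hKpos ha hb0 hab hz (T h hh x hx) (T h hh y hy)
        (T h hh z hzm) hxy.le
      rw [← hC] at hlow
      have I1 := (hint h hh x hx).const_mul a
      have I2 := (hint h hh y hy).const_mul b
      have I3 := ((hexpI _ hδK).sub (hexpI _ hδ2K)).const_mul (abar * C)
      rw [hJ, hJ, hJ, ← hexpV _ hδK, ← hexpV _ hδ2K,
        ← MeasureTheory.integral_sub (hexpI _ hδK) (hexpI _ hδ2K),
        ← MeasureTheory.integral_const_mul, ← MeasureTheory.integral_const_mul,
        ← MeasureTheory.integral_const_mul, ← MeasureTheory.integral_add I1 I2]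
      refine (MeasureTheory.integral_add (I1.add I2) I3).symm.trans_le ?_
      apply MeasureTheory.setIntegral_mono_on ((I1.add I2).add I3) (hint h hh z hzm)
        measurableSet_Ioi
      intro t ht
      have h1 := hlow t (le_of_lt ht)
      have e1 : Real.exp (-(δ + K) * t) = Real.exp (-δ * t) * Real.exp (-K * t) := by
        rw [← Real.exp_add]; congr 1; ring
      have e2 : Real.exp (-(δ + 2 * K) * t) = Real.exp (-δ * t) * Real.exp (-(2 * K) * t) := by
        rw [← Real.exp_add]; congr 1; ring
      have h2 := mul_le_mul_of_nonneg_left h1 (mul_pos (Real.exp_pos (-δ * t)) habar).le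
      have hb1 : b = 1 - a := by linarith
      simp only [Pi.add_apply, Pi.sub_apply]
      rw [e1, e2]
      have e3 : Real.exp (-δ * t) * c (h t) =
        a * (Real.exp (-δ * t) * c (h t)) + b * (Real.exp (-δ * t) * c (h t)) := by
        rw [hb1]; ring
      linarith
    have := hlev z hzm _ (fun h hh => by
      have h1 := hcJ h hh
      have h2 := mul_le_mul_of_nonneg_left (hvle h hh x hx) ha.le
      have h3 := mul_le_mul_of_nonneg_left (hvle h hh y hy) hb0.le
      show a * v x + b * v y + abar * C * (1 / (δ + K) - 1 / (δ + 2 * K)) ≤ J h z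
      linarith)
    linarith
  refine ⟨hmono, ⟨convex_Icc _ _, ?_⟩, ?_⟩
  · intro x hx y hy hne a b ha hb hab
    simp only [smul_eq_mul]
    rcases lt_or_gt_of_ne hne with hlt | hlt
    · exact hconc x hx y hy hlt a b ha hb hab
    · have := hconc y hy x hx hlt b a hb ha (by linarith)
      rw [add_comm (a * v x), add_comm (a * x)]
      exact this
  · intro x hx y hy
    rcases le_total x y with hxy | hxy
    · have h1 := hlip x hx y hy hxy
      have h2 := hmono.monotoneOn hx hy hxy
      rw [abs_sub_comm, abs_of_nonneg (by linarith), abs_sub_comm, abs_of_nonneg (by linarith)]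
      exact h1
    · have h1 := hlip y hy x hx hxy
      have h2 := hmono.monotoneOn hy hx hxy
      rw [abs_of_nonneg (by linarith), abs_of_nonneg (by linarith)]
      exact h1
end

section
/- Let γ̌_min := 1/γ_max and define the reparametrized value function v̌ : [γ̌_min, ∞) → [0,∞) by v̌(γ̌) := v(1/γ̌). Then v̌ is strictly convex, and v̌ is semiconcave with linear modulus, i.e. there exists C > 0 such that v̌(x + h) + v̌(x − h) − 2v̌(x) ≤ C·h² for all x and h ≥ 0 with x − h ≥ γ̌_min; consequently v̌ is continuously differentiable on (γ̌_min, ∞) with Lipschitz continuous derivative. -/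
open MeasureTheory Set

lemma mono_of_ac {g : ℝ → ℝ} {s t : ℝ} (hst : s ≤ t)
    (hac : AbsolutelyContinuousOnInterval g s t)
    (hd : ∀ᵐ u, u ∈ Ioo s t → ∃ g', HasDerivAt g g' u ∧ 0 ≤ g') : g s ≤ g t := by
  have h1 := hac.integral_deriv_eq_sub
  have h2 : 0 ≤ ∫ x in s..t, deriv g x := by
    apply intervalIntegral.integral_nonneg_of_ae_restrict hst
    have : (volume.restrict (Icc s t)) = volume.restrict (Ioo s t) :=
      Measure.restrict_congr_set Ioo_ae_eq_Icc.symm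
    rw [this]
    filter_upwards [(ae_restrict_iff' measurableSet_Ioo).2 hd] with u hu
    obtain ⟨g', h, h'⟩ := hu
    simpa [h.deriv] using h'
  linarith

lemma barrier0 {g : ℝ → ℝ} {T : ℝ} (hT : 0 ≤ T)
    (hac : AbsolutelyContinuousOnInterval g 0 T) (h0 : 0 ≤ g 0)
    (hd : ∀ᵐ u, u ∈ Ioo 0 T → ∃ g', HasDerivAt g g' u ∧ (g u ≤ 0 → 0 ≤ g')) : 0 ≤ g T := by
  by_contra hneg
  push Not at hneg
  have hcont : ContinuousOn g (Icc 0 T) := by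
    have := hac.continuousOn
    rwa [uIcc_of_le hT] at this
  let Z := Icc 0 T ∩ g ⁻¹' (Ici 0)
  have hZc : IsCompact Z :=
    isCompact_Icc.of_isClosed_subset (hcont.preimage_isClosed_of_isClosed isClosed_Icc isClosed_Ici)
      inter_subset_left
  have hZn : Z.Nonempty := ⟨0, ⟨le_rfl, hT⟩, h0⟩
  obtain ⟨s, hsZ, hs⟩ := hZc.exists_isGreatest hZn
  have hneg' : ∀ u ∈ Ioo s T, g u ≤ 0 := by
    intro u hu
    by_contra h
    push Not at h
    have : u ≤ s := hs ⟨⟨hsZ.1.1.trans hu.1.le, hu.2.le⟩, h.le⟩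
    linarith [hu.1]
  have := mono_of_ac (g := g) hsZ.1.2
    (hac.mono (by rw [uIcc_of_le hT, uIcc_of_le hsZ.1.2]; exact Icc_subset_Icc hsZ.1.1 le_rfl)) (by
      filter_upwards [hd] with u hu hu'
      obtain ⟨g', h, h'⟩ := hu ⟨hsZ.1.1.trans_lt hu'.1, hu'.2⟩
      exact ⟨g', h, h' (hneg' u hu')⟩)
  have h2 : 0 ≤ g s := hsZ.2
  linarith

lemma barrier {g : ℝ → ℝ} {T : ℝ} (K : ℝ) (hT : 0 ≤ T)
    (hac : AbsolutelyContinuousOnInterval g 0 T) (h0 : 0 ≤ g 0)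
    (hd : ∀ᵐ u, u ∈ Ioo 0 T → ∃ g', HasDerivAt g g' u ∧ (g u ≤ 0 → K * g u ≤ g')) : 0 ≤ g T := by
  have hexp : AbsolutelyContinuousOnInterval (fun t => Real.exp (-K * t)) 0 T := by
    apply ContDiffOn.absolutelyContinuousOnInterval
    exact ContDiff.contDiffOn (by fun_prop)
  have := barrier0 (g := (fun t => Real.exp (-K * t)) * g) hT (hexp.mul hac) (by simpa using h0) (by
    filter_upwards [hd] with u hu hu'
    obtain ⟨g', h, h'⟩ := hu hu'
    have he : HasDerivAt (fun t => Real.exp (-K * t)) (Real.exp (-K * u) * (-K * 1)) u :=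
      ((hasDerivAt_id u).const_mul (-K)).exp
    refine ⟨_, he.mul h, fun hg => ?_⟩
    have hp := Real.exp_pos (-K * u)
    have hg2 : g u ≤ 0 := by
      simp only [Pi.mul_apply] at hg
      by_contra hc
      push Not at hc
      have := mul_pos hp hc
      linarith
    have := h' hg2
    have := mul_nonneg hp.le (sub_nonneg.2 this)
    linarith)
  simp only [Pi.mul_apply] at this
  exact nonneg_of_mul_nonneg_right this (Real.exp_pos _)

/-- trajectories of the Riccati equation -/
structure IsTraj (A lam S M H : ℝ) (h γ : ℝ → ℝ) : Prop where
  meas : Measurable h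
  hmem : ∀ t, h t ∈ Icc 0 H
  cont : ContinuousOn γ (Ici 0)
  mem : ∀ t, 0 ≤ t → γ t ∈ Icc 0 M
  eqn : ∀ t, 0 ≤ t → γ t = γ 0 + ∫ s in (0:ℝ)..t, (-(A + h s) * γ s ^ 2 - 2 * lam * γ s + S)

namespace IsTraj
variable {A lam S M H : ℝ} {h γ : ℝ → ℝ}

lemma bound (hA : 0 ≤ A) (hl : 0 ≤ lam) (hS : 0 ≤ S) (T : IsTraj A lam S M H h γ) {s : ℝ}
    (hs : 0 ≤ s) : |-(A + h s) * γ s ^ 2 - 2 * lam * γ s + S|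
      ≤ (A + H) * M ^ 2 + 2 * lam * M + S := by
  obtain ⟨h1, h2⟩ := T.hmem s
  obtain ⟨h3, h4⟩ := T.mem s hs
  have e1 : γ s ^ 2 ≤ M ^ 2 := by gcongr
  have e2 : (A + h s) * γ s ^ 2 ≤ (A + H) * M ^ 2 := by gcongr; linarith
  have e3 : lam * γ s ≤ lam * M := by gcongr
  have e4 : 0 ≤ (A + h s) * γ s ^ 2 := by positivity
  have e5 : 0 ≤ lam * γ s := by positivity
  rw [abs_le]
  constructor <;> linarith

lemma intg (hA : 0 ≤ A) (hl : 0 ≤ lam) (hS : 0 ≤ S) (T : IsTraj A lam S M H h γ) {s t : ℝ}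
    (hs : 0 ≤ s) (ht : 0 ≤ t) :
    IntervalIntegrable (fun s => -(A + h s) * γ s ^ 2 - 2 * lam * γ s + S) volume s t := by
  have hsub : uIoc s t ⊆ Ici 0 := fun u hu => by
    have := uIoc_subset_uIcc hu
    rw [mem_uIcc] at this
    rcases this with h | h <;> simp <;> linarith
  have hγm : AEStronglyMeasurable γ (volume.restrict (uIoc s t)) :=
    (T.cont.mono hsub).aestronglyMeasurable measurableSet_uIoc
  have hhm : AEStronglyMeasurable h (volume.restrict (uIoc s t)) :=
    T.meas.aestronglyMeasurable
  have : IntervalIntegrable (fun _ : ℝ => (A + H) * M ^ 2 + 2 * lam * M + S) volume s t :=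
    intervalIntegrable_const
  refine this.mono_fun ?_ ?_
  · exact ((((aestronglyMeasurable_const.add hhm).neg).mul (hγm.pow 2)).sub
      (hγm.const_mul (2 * lam))).add aestronglyMeasurable_const
  · filter_upwards [ae_restrict_mem measurableSet_uIoc] with u hu
    rw [Real.norm_eq_abs, Real.norm_eq_abs]
    exact (T.bound hA hl hS (hsub hu)).trans (le_abs_self _)

lemma lip (hA : 0 ≤ A) (hl : 0 ≤ lam) (hS : 0 ≤ S) (T : IsTraj A lam S M H h γ) {s t : ℝ}
    (hs : 0 ≤ s) (ht : 0 ≤ t) :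
    |γ t - γ s| ≤ ((A + H) * M ^ 2 + 2 * lam * M + S) * |t - s| := by
  have e : γ t - γ s = ∫ s in s..t, (-(A + h s) * γ s ^ 2 - 2 * lam * γ s + S) := by
    rw [T.eqn t ht, T.eqn s hs, ← intervalIntegral.integral_interval_sub_left
      (T.intg hA hl hS le_rfl ht) (T.intg hA hl hS le_rfl hs)]
    ring
  rw [e, ← Real.norm_eq_abs]
  apply intervalIntegral.norm_integral_le_of_norm_le_const
  intro u hu
  refine T.bound hA hl hS ?_
  have := uIoc_subset_uIcc hu
  rw [mem_uIcc] at this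
  rcases this with h | h <;> linarith

lemma ac (hA : 0 ≤ A) (hl : 0 ≤ lam) (hS : 0 ≤ S) (T : IsTraj A lam S M H h γ) {t : ℝ}
    (ht : 0 ≤ t) : AbsolutelyContinuousOnInterval γ 0 t := by
  have hK : 0 ≤ (A + H) * M ^ 2 + 2 * lam * M + S :=
    (abs_nonneg _).trans (T.bound hA hl hS le_rfl)
  apply LipschitzOnWith.absolutelyContinuousOnInterval (K := ⟨_, hK⟩)
  rw [uIcc_of_le ht]
  apply LipschitzOnWith.of_dist_le_mul
  intro x hx y hy
  rw [Real.dist_eq, Real.dist_eq]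
  exact T.lip hA hl hS hy.1 hx.1

lemma ae_deriv (hA : 0 ≤ A) (hl : 0 ≤ lam) (hS : 0 ≤ S) (T : IsTraj A lam S M H h γ) {t : ℝ}
    (ht : 0 ≤ t) : ∀ᵐ u, u ∈ Ioo 0 t →
      HasDerivAt γ (-(A + h u) * γ u ^ 2 - 2 * lam * γ u + S) u := by
  filter_upwards [(T.intg hA hl hS le_rfl ht).ae_hasDerivAt_integral] with u hu hu'
  have h1 := hu (by rw [uIcc_of_le ht]; exact Ioo_subset_Icc_self hu') 0
    (by rw [uIcc_of_le ht]; exact ⟨le_rfl, ht⟩)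
  have h2 := h1.const_add (γ 0)
  refine h2.congr_of_eventuallyEq ?_
  filter_upwards [Ioo_mem_nhds hu'.1 hu'.2] with w hw
  exact T.eqn w hw.1.le

lemma lower (hA : 0 ≤ A) (hl : 0 ≤ lam) (hS : 0 ≤ S) (T : IsTraj A lam S M H h γ) {t : ℝ}
    (ht : 0 ≤ t) : γ 0 * Real.exp (-((A + H) * M + 2 * lam) * t) ≤ γ t := by
  set K := (A + H) * M + 2 * lam with hK
  have hexp : AbsolutelyContinuousOnInterval (fun t => γ 0 * Real.exp (-K * t)) 0 t := by
    apply ContDiffOn.absolutelyContinuousOnInterval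
    exact ContDiff.contDiffOn (by fun_prop)
  have := barrier (g := γ - (fun t => γ 0 * Real.exp (-K * t))) (-K) ht
    ((T.ac hA hl hS ht).sub hexp) (by simp) (by
      filter_upwards [T.ae_deriv hA hl hS ht] with u hu hu'
      have he : HasDerivAt (fun t => γ 0 * Real.exp (-K * t))
          (γ 0 * (Real.exp (-K * u) * (-K * 1))) u :=
        (((hasDerivAt_id u).const_mul (-K)).exp).const_mul _
      refine ⟨_, (hu hu').sub he, fun _ => ?_⟩
      simp only [Pi.sub_apply]
      obtain ⟨h1, h2⟩ := T.hmem u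
      obtain ⟨h3, h4⟩ := T.mem u hu'.1.le
      have : (A + h u) * γ u ^ 2 ≤ (A + H) * M * γ u := by
        rw [pow_two, ← mul_assoc]
        gcongr <;> linarith
      have e : K * γ u = (A + H) * M * γ u + 2 * lam * γ u := by rw [hK]; ring
      linarith)
  simp only [Pi.sub_apply] at this
  linarith

lemma pos (hA : 0 ≤ A) (hl : 0 ≤ lam) (hS : 0 ≤ S) (T : IsTraj A lam S M H h γ) {t : ℝ}
    (h0 : 0 < γ 0) (ht : 0 ≤ t) : 0 < γ t :=
  lt_of_lt_of_le (by positivity) (T.lower hA hl hS ht)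

lemma inv_ac (hA : 0 ≤ A) (hl : 0 ≤ lam) (hS : 0 ≤ S) (T : IsTraj A lam S M H h γ) {t : ℝ}
    (h0 : 0 < γ 0) (ht : 0 ≤ t) : AbsolutelyContinuousOnInterval (fun u => (γ u)⁻¹) 0 t := by
  have hK : 0 ≤ (A + H) * M ^ 2 + 2 * lam * M + S :=
    (abs_nonneg _).trans (T.bound hA hl hS le_rfl)
  obtain ⟨w, hw, hmin⟩ := (isCompact_Icc (a := (0:ℝ)) (b := t)).exists_isMinOn
    (nonempty_Icc.2 ht) (T.cont.mono Icc_subset_Ici_self)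
  have hm : 0 < γ w := T.pos hA hl hS h0 hw.1
  set m := γ w
  have hmin' : ∀ u ∈ Icc 0 t, m ≤ γ u := fun u hu => hmin hu
  apply LipschitzOnWith.absolutelyContinuousOnInterval
    (K := ⟨((A + H) * M ^ 2 + 2 * lam * M + S) / (m * m), by positivity⟩)
  rw [uIcc_of_le ht]
  apply LipschitzOnWith.of_dist_le_mul
  intro x hx y hy
  rw [Real.dist_eq, Real.dist_eq]
  have hl := T.lip hA hl hS hx.1 hy.1
  have px := hmin' x hx
  have py := hmin' y hy
  have px' : 0 < γ x := by linarith
  have py' : 0 < γ y := by linarith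
  have : (γ x)⁻¹ - (γ y)⁻¹ = (γ y - γ x) / (γ x * γ y) := by field_simp
  rw [this, abs_div, abs_of_pos (mul_pos px' py')]
  change _ ≤ ((A + H) * M ^ 2 + 2 * lam * M + S) / (m * m) * |x - y|
  rw [div_mul_eq_mul_div, abs_sub_comm x y]
  gcongr

lemma semi {γ₁ γ₂ : ℝ → ℝ} {a b : ℝ} (hA : 0 ≤ A) (hl : 0 ≤ lam) (hS : 0 ≤ S)
    (T : IsTraj A lam S M H h γ)
    (T₁ : IsTraj A lam S M H h γ₁) (T₂ : IsTraj A lam S M H h γ₂)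
    (ha : 0 ≤ a) (hb : 0 ≤ b) (hab : a + b = 1)
    (h0 : 0 ≤ a * γ₁ 0 + b * γ₂ 0 - γ 0) {t : ℝ} (ht : 0 ≤ t) :
    a * γ₁ t + b * γ₂ t - γ t ≤ a * γ₁ 0 + b * γ₂ 0 - γ 0 := by
  set s₀ := a * γ₁ 0 + b * γ₂ 0 - γ 0 with hs₀
  have hac0 : AbsolutelyContinuousOnInterval (fun _ : ℝ => s₀) 0 t := by
    apply ContDiffOn.absolutelyContinuousOnInterval
    exact ContDiff.contDiffOn (by fun_prop)
  have := barrier0 (g := fun u => s₀ - (a * γ₁ u + b * γ₂ u - γ u)) ht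
    (hac0.sub ((((T₁.ac hA hl hS ht).const_mul a).add ((T₂.ac hA hl hS ht).const_mul b)).sub
      (T.ac hA hl hS ht))) (by simp [hs₀]) (by
      filter_upwards [T.ae_deriv hA hl hS ht, T₁.ae_deriv hA hl hS ht, T₂.ae_deriv hA hl hS ht]
        with u hu hu1 hu2 hu'
      refine ⟨_, ((((hu1 hu').const_mul a).add ((hu2 hu').const_mul b)).sub (hu hu')).const_sub s₀,
        fun hg => ?_⟩
      obtain ⟨h1, h2⟩ := T.hmem u
      obtain ⟨h3, h4⟩ := T.mem u hu'.1.le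
      have hs : 0 ≤ a * γ₁ u + b * γ₂ u - γ u := by linarith
      have e1 : a * γ₁ u ^ 2 + b * γ₂ u ^ 2 - (a * γ₁ u + b * γ₂ u) ^ 2
          = a * b * (γ₁ u - γ₂ u) ^ 2 := by
        obtain rfl : b = 1 - a := by linarith
        ring
      have e2 : 0 ≤ a * b * (γ₁ u - γ₂ u) ^ 2 := by positivity
      have e3 : γ u ^ 2 ≤ (a * γ₁ u + b * γ₂ u) ^ 2 := by gcongr; linarith
      have e4 : 0 ≤ (A + h u) * (a * γ₁ u ^ 2 + b * γ₂ u ^ 2 - γ u ^ 2) :=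
        mul_nonneg (by linarith) (by linarith)
      have e5 : 0 ≤ lam * (a * γ₁ u + b * γ₂ u - γ u) := mul_nonneg hl hs
      have e6 : (a + b - 1) * S = 0 := by rw [hab]; ring
      nlinarith [e4, e5, e6])
  linarith

lemma harm {h₁ h₂ γ₁ γ₂ : ℝ → ℝ} {a b : ℝ} (hA : 0 ≤ A) (hl : 0 ≤ lam) (hS : 0 ≤ S)
    (T : IsTraj A lam S M H (fun t => a * h₁ t + b * h₂ t) γ)
    (T₁ : IsTraj A lam S M H h₁ γ₁) (T₂ : IsTraj A lam S M H h₂ γ₂)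
    (ha : 0 ≤ a) (hb : 0 ≤ b) (hab : a + b = 1)
    (p : 0 < γ 0) (p₁ : 0 < γ₁ 0) (p₂ : 0 < γ₂ 0)
    (h0 : (γ 0)⁻¹ = a * (γ₁ 0)⁻¹ + b * (γ₂ 0)⁻¹) {t : ℝ} (ht : 0 ≤ t) :
    a * (γ₁ t)⁻¹ + b * (γ₂ t)⁻¹ ≤ (γ t)⁻¹ := by
  have := barrier (g := fun u => (γ u)⁻¹ - (a * (γ₁ u)⁻¹ + b * (γ₂ u)⁻¹)) (2 * lam) ht
    ((T.inv_ac hA hl hS p ht).sub (((T₁.inv_ac hA hl hS p₁ ht).const_mul a).add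
      ((T₂.inv_ac hA hl hS p₂ ht).const_mul b))) (by simp [h0]) (by
      filter_upwards [T.ae_deriv hA hl hS ht, T₁.ae_deriv hA hl hS ht, T₂.ae_deriv hA hl hS ht]
        with u hu hu1 hu2 hu'
      have q := T.pos hA hl hS p hu'.1.le
      have q₁ := T₁.pos hA hl hS p₁ hu'.1.le
      have q₂ := T₂.pos hA hl hS p₂ hu'.1.le
      refine ⟨_, ((hu hu').fun_inv q.ne').sub ((((hu1 hu').fun_inv q₁.ne').const_mul a).add
        (((hu2 hu').fun_inv q₂.ne').const_mul b)), fun hg => ?_⟩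
      have key : ∀ (k x : ℝ), 0 < x → -(-(A + k) * x ^ 2 - 2 * lam * x + S) / x ^ 2
          = A + k + 2 * lam * x⁻¹ - S * (x⁻¹) ^ 2 := by
        intro k x hx
        field_simp
        ring
      rw [key _ _ q, key _ _ q₁, key _ _ q₂]
      have r := inv_pos.2 q
      have r₁ := inv_pos.2 q₁
      have r₂ := inv_pos.2 q₂
      generalize (γ u)⁻¹ = y at *
      generalize (γ₁ u)⁻¹ = y₁ at *
      generalize (γ₂ u)⁻¹ = y₂ at *
      have e1 : a * y₁ ^ 2 + b * y₂ ^ 2 - (a * y₁ + b * y₂) ^ 2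
          = a * b * (y₁ - y₂) ^ 2 := by
        obtain rfl : b = 1 - a := by linarith
        ring
      have e2 : 0 ≤ a * b * (y₁ - y₂) ^ 2 := by positivity
      have e3 : y ^ 2 ≤ (a * y₁ + b * y₂) ^ 2 := by gcongr; linarith
      have e4 : 0 ≤ S * (a * y₁ ^ 2 + b * y₂ ^ 2 - y ^ 2) :=
        mul_nonneg hS (by linarith)
      have e6 : (a + b - 1) * A = 0 := by rw [hab]; ring
      linarith)
  linarith

end IsTraj

lemma c11_of_convex {φ : ℝ → ℝ} {m K : ℝ} (hK : 0 ≤ K) (h1 : ConvexOn ℝ (Ici m) φ)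
    (h2 : ConvexOn ℝ (Ici m) (fun x => K * x ^ 2 - φ x)) :
    ∃ d : ℝ → ℝ,
      (∀ x ∈ Ioi m, HasDerivAt φ (d x) x) ∧
      ContinuousOn d (Ioi m) ∧
      (∃ K : ℝ, 0 ≤ K ∧ ∀ x ∈ Ioi m, ∀ y ∈ Ioi m, |d x - d y| ≤ K * |x - y|) := by
  have hq : ∀ x, HasDerivAt (fun x : ℝ => K * x ^ 2) (K * (2 * x)) x := fun x => by
    simpa using ((hasDerivAt_pow 2 x).const_mul K)
  have hd : ∀ x ∈ Ioi m, HasDerivAt φ (deriv φ x) x := by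
    intro x hx
    have hi : x ∈ interior (Ici m) := by rwa [interior_Ici]
    have l1 := h1.hasDerivWithinAt_leftDeriv_of_mem_interior hi
    have r1 := h1.hasDerivWithinAt_rightDeriv_of_mem_interior hi
    have e1 := h1.leftDeriv_le_rightDeriv_of_mem_interior hi
    have e2 := h2.leftDeriv_le_rightDeriv_of_mem_interior hi
    have l2 := ((hq x).hasDerivWithinAt (s := Iio x)).sub l1
    have r2 := ((hq x).hasDerivWithinAt (s := Ioi x)).sub r1
    have l3 := l2.derivWithin (uniqueDiffWithinAt_Iio x)
    have r3 := r2.derivWithin (uniqueDiffWithinAt_Ioi x)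
    have e3 : derivWithin φ (Iio x) x = derivWithin φ (Ioi x) x := by
      apply le_antisymm e1
      change derivWithin ((fun x => K * x ^ 2) - φ) _ _ ≤ derivWithin ((fun x => K * x ^ 2) - φ) _ _ at e2
      rw [l3, r3] at e2
      linarith
    rw [← e3] at r1
    have u := l1.union r1
    rw [Iio_union_Ioi] at u
    have : HasDerivAt φ (derivWithin φ (Iio x) x) x := by
      rw [← hasDerivWithinAt_univ, ← hasDerivWithinAt_sdiff_singleton, ← compl_eq_univ_sdiff]
      exact u
    exact this.differentiableAt.hasDerivAt
  have m1 : MonotoneOn (deriv φ) (Ioi m) :=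
    (h1.subset Ioi_subset_Ici_self (convex_Ioi m)).monotoneOn_deriv
      (fun x hx => (hd x hx).differentiableAt)
  have m2 : MonotoneOn (deriv (fun x => K * x ^ 2 - φ x)) (Ioi m) :=
    (h2.subset Ioi_subset_Ici_self (convex_Ioi m)).monotoneOn_deriv
      (fun x hx => ((hq x).sub (hd x hx)).differentiableAt)
  have hd2 : ∀ x ∈ Ioi m, deriv (fun x => K * x ^ 2 - φ x) x = K * (2 * x) - deriv φ x :=
    fun x hx => ((hq x).sub (hd x hx)).deriv
  have key : ∀ x ∈ Ioi m, ∀ y ∈ Ioi m, x ≤ y → |deriv φ x - deriv φ y| ≤ 2 * K * |x - y| := by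
    intro x hx y hy hxy
    have a1 := m1 hx hy hxy
    have a2 := m2 hx hy hxy
    rw [hd2 x hx, hd2 y hy] at a2
    rw [abs_of_nonpos (by linarith), abs_of_nonpos (by linarith)]
    linarith
  have key2 : ∀ x ∈ Ioi m, ∀ y ∈ Ioi m, |deriv φ x - deriv φ y| ≤ 2 * K * |x - y| := by
    intro x hx y hy
    rcases le_total x y with h | h
    · exact key x hx y hy h
    · rw [abs_sub_comm, abs_sub_comm x y]
      exact key y hy x hx h
  refine ⟨deriv φ, hd, ?_, 2 * K, by positivity, key2⟩
  have : LipschitzOnWith (⟨2 * K, by positivity⟩ : NNReal) (deriv φ) (Ioi m) := by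
    apply LipschitzOnWith.of_dist_le_mul
    intro x hx y hy
    rw [Real.dist_eq, Real.dist_eq]
    exact key2 x hx y hy
  exact this.continuousOn

lemma integrable_cost {A lam S M H δ abar : ℝ} {c h γ : ℝ → ℝ} (hδ : 0 < δ) (habar : 0 < abar)
    (hc0 : ∀ x, 0 ≤ x → 0 ≤ c x)
    (hcc : ContinuousOn c (Ici 0)) (hcm : StrictMonoOn c (Ici 0))
    (T : IsTraj A lam S M H h γ) :
    IntegrableOn (fun t => Real.exp (-δ * t) * (abar * γ t + c (h t))) (Ioi 0) := by
  have he : IntegrableOn (fun t => Real.exp (-δ * t)) (Ioi 0) := by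
    simpa using exp_neg_integrableOn_Ioi 0 hδ
  have hch : Measurable (fun t => c (h t)) := by
    have h1 : Continuous (fun x => c (max x 0)) :=
      hcc.comp_continuous (by fun_prop) (fun x => mem_Ici.2 (le_max_right _ _))
    have h2 : (fun t => c (h t)) = (fun x => c (max x 0)) ∘ h := by
      ext t
      simp [max_eq_left (T.hmem t).1]
    rw [h2]
    exact h1.measurable.comp T.meas
  have hγm : AEStronglyMeasurable γ (volume.restrict (Ioi 0)) :=
    (T.cont.mono Ioi_subset_Ici_self).aestronglyMeasurable measurableSet_Ioi
  refine Integrable.mul_bdd (c := abar * M + c H) he ((hγm.const_mul abar).add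
    hch.aestronglyMeasurable) ?_
  filter_upwards [ae_restrict_mem measurableSet_Ioi] with t ht
  obtain ⟨h1, h2⟩ := T.hmem t
  obtain ⟨h3, h4⟩ := T.mem t (le_of_lt ht)
  have e1 := hc0 _ h1
  have e2 : c (h t) ≤ c H := hcm.monotoneOn h1 (h1.trans h2) h2
  have e3 : abar * γ t ≤ abar * M := by gcongr
  have e4 : 0 ≤ abar * γ t := by positivity
  rw [Real.norm_eq_abs, abs_of_nonneg (by linarith)]
  linarith

lemma semi_cost {A lam S M H δ abar : ℝ} {c h γ γ₁ γ₂ : ℝ → ℝ} {a b : ℝ}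
    (hδ : 0 < δ) (habar : 0 < abar)
    (hA : 0 ≤ A) (hl : 0 ≤ lam) (hS : 0 ≤ S)
    (hc0 : ∀ x, 0 ≤ x → 0 ≤ c x)
    (hcc : ContinuousOn c (Ici 0)) (hcm : StrictMonoOn c (Ici 0))
    (T : IsTraj A lam S M H h γ)
    (T₁ : IsTraj A lam S M H h γ₁) (T₂ : IsTraj A lam S M H h γ₂)
    (ha : 0 ≤ a) (hb : 0 ≤ b) (hab : a + b = 1)
    (h0 : 0 ≤ a * γ₁ 0 + b * γ₂ 0 - γ 0) :
    a * (∫ t in Ioi (0:ℝ), Real.exp (-δ * t) * (abar * γ₁ t + c (h t)))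
      + b * (∫ t in Ioi (0:ℝ), Real.exp (-δ * t) * (abar * γ₂ t + c (h t)))
    ≤ (∫ t in Ioi (0:ℝ), Real.exp (-δ * t) * (abar * γ t + c (h t)))
      + abar / δ * (a * γ₁ 0 + b * γ₂ 0 - γ 0) := by
  have he : IntegrableOn (fun t => Real.exp (-δ * t)) (Ioi 0) := by
    simpa using exp_neg_integrableOn_Ioi 0 hδ
  have hei : ∫ t in Ioi (0:ℝ), Real.exp (-δ * t) = 1 / δ := by
    rw [integral_exp_mul_Ioi (by linarith)]
    simp
  have I := integrable_cost hδ habar hc0 hcc hcm T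
  have I₁ := integrable_cost hδ habar hc0 hcc hcm T₁
  have I₂ := integrable_cost hδ habar hc0 hcc hcm T₂
  set s₀ := a * γ₁ 0 + b * γ₂ 0 - γ 0 with hs₀
  have e : abar / δ * s₀ = ∫ t in Ioi (0:ℝ), Real.exp (-δ * t) * (abar * s₀) := by
    rw [integral_mul_const, hei]; ring
  rw [e, ← integral_const_mul, ← integral_const_mul,
    ← integral_add (I₁.const_mul a) (I₂.const_mul b), ← integral_add I (he.mul_const _)]
  apply setIntegral_mono_on ((I₁.const_mul a).add (I₂.const_mul b)) (I.add (he.mul_const _))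
    measurableSet_Ioi
  intro t ht
  have hs := T.semi hA hl hS T₁ T₂ ha hb hab h0 (le_of_lt ht)
  have hp := Real.exp_pos (-δ * t)
  have h3 : a * (abar * γ₁ t + c (h t)) + b * (abar * γ₂ t + c (h t))
      ≤ abar * γ t + c (h t) + abar * s₀ := by
    have := mul_le_mul_of_nonneg_left hs habar.le
    have e6 : (a + b - 1) * c (h t) = 0 := by rw [hab]; ring
    rw [← hs₀] at this
    linarith
  have := mul_le_mul_of_nonneg_left h3 hp.le
  simp only [Pi.add_apply]
  linarith

lemma convex_cost {A lam S M H δ abar : ℝ} {c : ℝ → ℝ} {a b x₁ x₂ x : ℝ}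
    (hδ : 0 < δ) (habar : 0 < abar)
    (hA : 0 ≤ A) (hl : 0 ≤ lam) (hS : 0 ≤ S) (hM : 0 < M) (hH : 0 ≤ H)
    (hc0 : ∀ x, 0 ≤ x → 0 ≤ c x) (hconv : ConvexOn ℝ (Ici 0) c)
    (hcc : ContinuousOn c (Ici 0)) (hcm : StrictMonoOn c (Ici 0))
    (ha : 0 < a) (hb : 0 < b) (hab : a + b = 1)
    (p : 0 < x) (p₁ : 0 < x₁) (p₂ : 0 < x₂) (hne : x₁ ≠ x₂)
    (h0 : x⁻¹ = a * x₁⁻¹ + b * x₂⁻¹) :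
    ∃ ε > 0, ∀ h₁ h₂ γ γ₁ γ₂ : ℝ → ℝ,
      IsTraj A lam S M H (fun t => a * h₁ t + b * h₂ t) γ →
      IsTraj A lam S M H h₁ γ₁ → IsTraj A lam S M H h₂ γ₂ →
      γ 0 = x → γ₁ 0 = x₁ → γ₂ 0 = x₂ →
    (∫ t in Ioi (0:ℝ), Real.exp (-δ * t) * (abar * γ t + c (a * h₁ t + b * h₂ t))) + ε
    ≤ a * (∫ t in Ioi (0:ℝ), Real.exp (-δ * t) * (abar * γ₁ t + c (h₁ t)))
      + b * (∫ t in Ioi (0:ℝ), Real.exp (-δ * t) * (abar * γ₂ t + c (h₂ t))) := by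
  set K := (A + H) * M ^ 2 + 2 * lam * M + S with hK
  have hK0 : 0 ≤ K := by positivity
  set d := |x₁ - x₂| with hd
  have hd0 : 0 < d := abs_pos.2 (sub_ne_zero.2 hne)
  set τ := d / (4 * (K + 1)) with hτ
  have hτ0 : 0 < τ := by positivity
  have hKτ : K * τ ≤ d / 4 := by
    rw [hτ, mul_div_assoc', div_le_div_iff₀ (by positivity) (by norm_num)]
    nlinarith
  set q := Real.exp (-δ * τ) * (abar * (a * b * (d / 2) ^ 2 / M)) with hq
  have hq0 : 0 < q := by positivity
  refine ⟨τ * q, by positivity, ?_⟩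
  intro h₁ h₂ γ γ₁ γ₂ T T₁ T₂ i i₁ i₂
  have I := integrable_cost hδ habar hc0 hcc hcm T
  have I₁ := integrable_cost hδ habar hc0 hcc hcm T₁
  have I₂ := integrable_cost hδ habar hc0 hcc hcm T₂
  have Iq : IntegrableOn ((Ioc 0 τ).indicator (fun _ => q)) (Ioi 0) := by
    apply Integrable.integrableOn
    rw [integrable_indicator_iff measurableSet_Ioc]
    exact integrableOn_const (by simp)
  have e : τ * q = ∫ t in Ioi (0:ℝ), (Ioc 0 τ).indicator (fun _ => q) t := by
    rw [setIntegral_indicator measurableSet_Ioc, inter_eq_self_of_subset_right Ioc_subset_Ioi_self]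
    simp [hτ0.le]
  rw [e, ← integral_const_mul, ← integral_const_mul,
    ← integral_add (I₁.const_mul a) (I₂.const_mul b), ← integral_add I Iq]
  apply setIntegral_mono_on (I.add Iq) ((I₁.const_mul a).add (I₂.const_mul b)) 
    measurableSet_Ioi
  intro t ht
  have ht0 : 0 ≤ t := le_of_lt ht
  have hh := T.harm hA hl hS T₁ T₂ ha.le hb.le hab (i ▸ p) (i₁ ▸ p₁) (i₂ ▸ p₂)
    (by rw [i, i₁, i₂, h0]) ht0
  have g := T.pos hA hl hS (i ▸ p) ht0
  have g₁ := T₁.pos hA hl hS (i₁ ▸ p₁) ht0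
  have g₂ := T₂.pos hA hl hS (i₂ ▸ p₂) ht0
  have m₁ := (T₁.mem t ht0).2
  have m₂ := (T₂.mem t ht0).2
  have hp := Real.exp_pos (-δ * t)
  have hcv : c (a * h₁ t + b * h₂ t) ≤ a * c (h₁ t) + b * c (h₂ t) :=
    hconv.2 (T₁.hmem t).1 (T₂.hmem t).1 ha.le hb.le hab
  have gap : γ t + a * b * (γ₁ t - γ₂ t) ^ 2 / M ≤ a * γ₁ t + b * γ₂ t := by
    have D : 0 < a * γ₂ t + b * γ₁ t := by positivity
    have DM : a * γ₂ t + b * γ₁ t ≤ M := by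
      calc _ ≤ a * M + b * M := by gcongr
        _ = M := by rw [← add_mul, hab, one_mul]
    have e1 : γ t ≤ γ₁ t * γ₂ t / (a * γ₂ t + b * γ₁ t) := by
      have : a * (γ₁ t)⁻¹ + b * (γ₂ t)⁻¹ = (γ₁ t * γ₂ t / (a * γ₂ t + b * γ₁ t))⁻¹ := by
        field_simp
      rw [this] at hh
      exact (inv_le_inv₀ (by positivity) g).1 hh
    have e2 : a * b * (γ₁ t - γ₂ t) ^ 2 / M
        ≤ a * b * (γ₁ t - γ₂ t) ^ 2 / (a * γ₂ t + b * γ₁ t) := by gcongr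
    have e3 : γ₁ t * γ₂ t / (a * γ₂ t + b * γ₁ t)
        + a * b * (γ₁ t - γ₂ t) ^ 2 / (a * γ₂ t + b * γ₁ t) = a * γ₁ t + b * γ₂ t := by
      rw [← add_div, div_eq_iff D.ne']
      obtain rfl : b = 1 - a := by linarith
      ring
    linarith
  simp only [Pi.add_apply]
  by_cases htτ : t ≤ τ
  · rw [indicator_of_mem (show t ∈ Ioc 0 τ from ⟨ht, htτ⟩)]
    have l₁ := T₁.lip hA hl hS le_rfl ht0
    have l₂ := T₂.lip hA hl hS le_rfl ht0
    rw [sub_zero, abs_of_nonneg ht0, ← hK] at l₁ l₂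
    have hKt : K * t ≤ d / 4 := (by gcongr : K * t ≤ K * τ).trans hKτ
    rw [i₁] at l₁
    rw [i₂] at l₂
    have hdt : d / 2 ≤ |γ₁ t - γ₂ t| := by
      have : d ≤ |γ₁ t - x₁| + |γ₁ t - γ₂ t| + |γ₂ t - x₂| := by
        rw [hd, show x₁ - x₂ = -(γ₁ t - x₁) + (γ₁ t - γ₂ t) + (γ₂ t - x₂) by ring]
        refine (abs_add_three _ _ _).trans ?_
        rw [abs_neg]
      linarith
    have hsq : (d / 2) ^ 2 ≤ (γ₁ t - γ₂ t) ^ 2 := by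
      rw [← sq_abs (γ₁ t - γ₂ t)]
      gcongr
    have hqt : q ≤ Real.exp (-δ * t) * (abar * (a * b * (γ₁ t - γ₂ t) ^ 2 / M)) := by
      rw [hq]
      have : Real.exp (-δ * τ) ≤ Real.exp (-δ * t) := by
        apply Real.exp_le_exp.2
        have := mul_le_mul_of_nonneg_left htτ hδ.le
        linarith
      gcongr
    have g2 := mul_le_mul_of_nonneg_left gap habar.le
    have : abar * γ t + c (a * h₁ t + b * h₂ t) + abar * (a * b * (γ₁ t - γ₂ t) ^ 2 / M)
        ≤ a * (abar * γ₁ t + c (h₁ t)) + b * (abar * γ₂ t + c (h₂ t)) := by linarith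
    have := mul_le_mul_of_nonneg_left this hp.le
    linarith
  · rw [indicator_of_notMem (fun h => htτ h.2)]
    have : 0 ≤ a * b * (γ₁ t - γ₂ t) ^ 2 / M := by positivity
    have g2 := mul_le_mul_of_nonneg_left gap habar.le
    have g3 := mul_nonneg habar.le this
    have : abar * γ t + c (a * h₁ t + b * h₂ t)
        ≤ a * (abar * γ₁ t + c (h₁ t)) + b * (abar * γ₂ t + c (h₂ t)) := by linarith
    have := mul_le_mul_of_nonneg_left this hp.le
    linarith

/-- The reparametrized value function v̌(γ̌) = v(1/γ̌) on
[γ̌_min, ∞) = [1/γ_max, ∞) is strictly convex and semiconcave with linear modulus;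
consequently it is continuously differentiable on (γ̌_min, ∞) with Lipschitz
continuous derivative. -/
theorem stmt_10
    (σ₁ σ₂ lam δ abar γmax hmax : ℝ)
    (hσ₁ : 0 < σ₁) (hσ₂ : 0 ≤ σ₂) (hlam : 0 ≤ lam) (hδ : 0 < δ) (habar : 0 < abar)
    (f : ℝ → ℝ → ℝ)
    (hf : ∀ γ h : ℝ, f γ h = -(1 / σ₁ ^ 2 + h) * γ ^ 2 - 2 * lam * γ + σ₂ ^ 2)
    (γinf : ℝ)
    (hγinf : γinf = -lam * σ₁ ^ 2 + Real.sqrt (lam ^ 2 * σ₁ ^ 4 + σ₁ ^ 2 * σ₂ ^ 2))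
    (hγmax : γinf < γmax)
    (c c' : ℝ → ℝ)
    (hc_nonneg : ∀ x : ℝ, 0 ≤ x → 0 ≤ c x)
    (hc_conv : StrictConvexOn ℝ (Set.Ici 0) c)
    (hc_mono : StrictMonoOn c (Set.Ici 0))
    (hc_smooth : ContDiffOn ℝ 2 c (Set.Ici 0))
    (hc_deriv : ∀ x ∈ Set.Ici (0 : ℝ), HasDerivWithinAt c (c' x) (Set.Ici 0) x)
    (hhmax : 0 < hmax) (hc_hmax : c' hmax = γmax ^ 2 * (abar / δ))
    (Adm : (ℝ → ℝ) → Prop)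
    (hAdm : ∀ h : ℝ → ℝ, Adm h ↔ Measurable h ∧ ∀ t : ℝ, h t ∈ Set.Icc 0 hmax)
    (sol : (ℝ → ℝ) → ℝ → ℝ → ℝ)
    (hsol : ∀ h : ℝ → ℝ, Adm h → ∀ γ₀ ∈ Set.Icc (0 : ℝ) γmax,
      sol h γ₀ 0 = γ₀ ∧
      ContinuousOn (sol h γ₀) (Set.Ici 0) ∧
      (∀ t ∈ Set.Ici (0 : ℝ), sol h γ₀ t ∈ Set.Icc 0 γmax) ∧
      (∀ t ∈ Set.Ici (0 : ℝ),
        sol h γ₀ t = γ₀ + ∫ s in (0 : ℝ)..t, f (sol h γ₀ s) (h s)))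
    (J : (ℝ → ℝ) → ℝ → ℝ)
    (hJ : ∀ (h : ℝ → ℝ) (γ₀ : ℝ), J h γ₀ =
      ∫ t in Set.Ioi (0 : ℝ), Real.exp (-δ * t) * (abar * sol h γ₀ t + c (h t)))
    (v : ℝ → ℝ)
    (hv : ∀ γ₀ ∈ Set.Icc (0 : ℝ) γmax,
      v γ₀ = sInf ((fun h => J h γ₀) '' {h : ℝ → ℝ | Adm h}))
    (vcheck : ℝ → ℝ)
    (hvcheck : ∀ x : ℝ, 1 / γmax ≤ x → vcheck x = v (1 / x)) :
    StrictConvexOn ℝ (Set.Ici (1 / γmax)) vcheck ∧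
    (∃ C : ℝ, 0 < C ∧ ∀ x h : ℝ, 0 ≤ h → 1 / γmax ≤ x - h →
      vcheck (x + h) + vcheck (x - h) - 2 * vcheck x ≤ C * h ^ 2) ∧
    (∃ d : ℝ → ℝ,
      (∀ x ∈ Set.Ioi (1 / γmax), HasDerivAt vcheck (d x) x) ∧
      ContinuousOn d (Set.Ioi (1 / γmax)) ∧
      (∃ K : ℝ, 0 ≤ K ∧ ∀ x ∈ Set.Ioi (1 / γmax), ∀ y ∈ Set.Ioi (1 / γmax),
        |d x - d y| ≤ K * |x - y|)) := by
  have hγinf0 : 0 ≤ γinf := by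
    have : lam * σ₁ ^ 2 ≤ Real.sqrt (lam ^ 2 * σ₁ ^ 4 + σ₁ ^ 2 * σ₂ ^ 2) := by
      apply Real.le_sqrt_of_sq_le
      nlinarith [mul_nonneg (sq_nonneg σ₁) (sq_nonneg σ₂)]
    rw [hγinf]; linarith
  have hM : 0 < γmax := by linarith
  have hA : 0 ≤ 1 / σ₁ ^ 2 := by positivity
  have hS : 0 ≤ σ₂ ^ 2 := by positivity
  have hcc : ContinuousOn c (Set.Ici 0) := hc_smooth.continuousOn
  have traj : ∀ h, Adm h → ∀ γ₀ ∈ Set.Icc (0:ℝ) γmax,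
      IsTraj (1 / σ₁ ^ 2) lam (σ₂ ^ 2) γmax hmax h (sol h γ₀) := by
    intro h hh γ₀ hγ₀
    obtain ⟨a1, a2, a3, a4⟩ := hsol h hh γ₀ hγ₀
    obtain ⟨b1, b2⟩ := (hAdm h).1 hh
    refine ⟨b1, b2, a2, a3, fun t ht => ?_⟩
    rw [a1]
    simpa only [hf] using a4 t ht
  have init : ∀ h, Adm h → ∀ γ₀ ∈ Set.Icc (0:ℝ) γmax, sol h γ₀ 0 = γ₀ :=
    fun h hh γ₀ hγ₀ => (hsol h hh γ₀ hγ₀).1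
  have J0 : ∀ h, Adm h → ∀ γ₀ ∈ Set.Icc (0:ℝ) γmax, 0 ≤ J h γ₀ := by
    intro h hh γ₀ hγ₀
    have T := traj h hh γ₀ hγ₀
    rw [hJ]
    apply setIntegral_nonneg measurableSet_Ioi
    intro t ht
    have e1 := (T.mem t (le_of_lt ht)).1
    have e2 := hc_nonneg _ (T.hmem t).1
    positivity
  have vle : ∀ h, Adm h → ∀ γ₀ ∈ Set.Icc (0:ℝ) γmax, v γ₀ ≤ J h γ₀ := by
    intro h hh γ₀ hγ₀
    rw [hv γ₀ hγ₀]
    apply csInf_le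
    · refine ⟨0, ?_⟩
      rintro _ ⟨k, hk, rfl⟩
      exact J0 k hk γ₀ hγ₀
    · exact ⟨h, hh, rfl⟩
  have lev : ∀ γ₀ ∈ Set.Icc (0:ℝ) γmax, ∀ B, (∀ h, Adm h → B ≤ J h γ₀) → B ≤ v γ₀ := by
    intro γ₀ hγ₀ B hB
    rw [hv γ₀ hγ₀]
    apply le_csInf
    · exact ⟨_, ⟨fun _ => 0, (hAdm _).2 ⟨measurable_const, fun t => ⟨le_rfl, hhmax.le⟩⟩, rfl⟩⟩
    · rintro _ ⟨k, hk, rfl⟩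
      exact hB k hk
  have mpos : 0 < 1 / γmax := by positivity
  have mem : ∀ x, 1 / γmax ≤ x → 0 < 1 / x ∧ 1 / x ∈ Set.Icc (0:ℝ) γmax := by
    intro x hx
    have hx0 : 0 < x := by linarith
    have : 1 / x ≤ γmax := by
      rw [div_le_iff₀ hx0]
      rw [div_le_iff₀ hM] at hx
      linarith
    exact ⟨by positivity, by positivity, this⟩
  have scx : StrictConvexOn ℝ (Set.Ici (1 / γmax)) vcheck := by
    refine ⟨convex_Ici _, ?_⟩
    intro x hx y hy hxy a b ha hb hab
    have hz : 1 / γmax ≤ a * x + b * y := (convex_Ici (1 / γmax)) hx hy ha.le hb.le hab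
    simp only [smul_eq_mul]
    have hx' : 1 / γmax ≤ x := hx
    have hy' : 1 / γmax ≤ y := hy
    rw [hvcheck _ hz, hvcheck _ hx', hvcheck _ hy']
    obtain ⟨px, mx⟩ := mem x hx
    obtain ⟨py, my⟩ := mem y hy
    obtain ⟨pz, mz⟩ := mem _ hz
    have hne : 1 / x ≠ 1 / y := by simpa using hxy
    obtain ⟨ε, hε, H⟩ := convex_cost (A := 1 / σ₁ ^ 2) (S := σ₂ ^ 2) (M := γmax) (H := hmax)
      (x := 1 / (a * x + b * y)) (x₁ := 1 / x) (x₂ := 1 / y)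
      hδ habar hA hlam hS hM hhmax.le hc_nonneg hc_conv.convexOn hcc hc_mono ha hb hab pz px py
      hne (by simp)
    have H2 : ∀ h₁, Adm h₁ → ∀ h₂, Adm h₂ →
        v (1 / (a * x + b * y)) + ε ≤ a * J h₁ (1 / x) + b * J h₂ (1 / y) := by
      intro h₁ a₁ h₂ a₂
      have a₃ : Adm (fun t => a * h₁ t + b * h₂ t) := by
        obtain ⟨b1, b2⟩ := (hAdm h₁).1 a₁
        obtain ⟨c1, c2⟩ := (hAdm h₂).1 a₂
        exact (hAdm _).2 ⟨(b1.const_mul a).add (c1.const_mul b),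
          fun t => (convex_Icc 0 hmax) (b2 t) (c2 t) ha.le hb.le hab⟩
      have := H h₁ h₂ _ _ _ (traj _ a₃ _ mz) (traj _ a₁ _ mx) (traj _ a₂ _ my)
        (init _ a₃ _ mz) (init _ a₁ _ mx) (init _ a₂ _ my)
      have h3 := vle _ a₃ _ mz
      rw [hJ] at h3
      rw [hJ, hJ]
      linarith
    have H3 : ∀ h₂, Adm h₂ →
        v (1 / (a * x + b * y)) + ε ≤ a * v (1 / x) + b * J h₂ (1 / y) := by
      intro h₂ a₂
      have := lev _ mx ((v (1 / (a * x + b * y)) + ε - b * J h₂ (1 / y)) / a) (fun h₁ a₁ => by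
        rw [div_le_iff₀ ha]
        linarith [H2 h₁ a₁ h₂ a₂])
      rw [div_le_iff₀ ha] at this
      linarith
    have := lev _ my ((v (1 / (a * x + b * y)) + ε - a * v (1 / x)) / b) (fun h₂ a₂ => by
      rw [div_le_iff₀ hb]
      linarith [H3 h₂ a₂])
    rw [div_le_iff₀ hb] at this
    linarith
  set K := abar / δ * γmax ^ 3 with hK
  have hK0 : 0 < K := by positivity
  have semi : ∀ x y a b : ℝ, 1 / γmax ≤ x → 1 / γmax ≤ y → 0 ≤ a → 0 ≤ b → a + b = 1 →
      a * vcheck x + b * vcheck y ≤ vcheck (a * x + b * y) + K * (a * b * (x - y) ^ 2) := by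
    intro x y a b hx hy ha hb hab
    have hz : 1 / γmax ≤ a * x + b * y :=
      (convex_Ici (1 / γmax)) (show x ∈ Set.Ici _ from hx) hy ha hb hab
    rw [hvcheck _ hz, hvcheck _ hx, hvcheck _ hy]
    obtain ⟨px, mx⟩ := mem x hx
    obtain ⟨py, my⟩ := mem y hy
    obtain ⟨pz, mz⟩ := mem _ hz
    have x0 : 0 < x := by linarith
    have y0 : 0 < y := by linarith
    have z0 : 0 < a * x + b * y := by linarith
    have es : a * (1 / x) + b * (1 / y) - 1 / (a * x + b * y)
        = a * b * (x - y) ^ 2 * ((1 / x) * (1 / y) * (1 / (a * x + b * y))) := by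
      field_simp
      obtain rfl : b = 1 - a := by linarith
      ring
    have es0 : 0 ≤ a * (1 / x) + b * (1 / y) - 1 / (a * x + b * y) := by
      rw [es]; positivity
    have es1 : a * (1 / x) + b * (1 / y) - 1 / (a * x + b * y)
        ≤ a * b * (x - y) ^ 2 * γmax ^ 3 := by
      rw [es]
      have : (1 / x) * (1 / y) * (1 / (a * x + b * y)) ≤ γmax ^ 3 := by
        calc _ ≤ γmax * γmax * γmax := by
              gcongr
              exacts [mx.2, my.2, mz.2]
          _ = _ := by ring
      gcongr
    suffices h : a * v (1 / x) + b * v (1 / y) - K * (a * b * (x - y) ^ 2)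
        ≤ v (1 / (a * x + b * y)) by linarith
    apply lev _ mz
    intro h hh
    have := semi_cost hδ habar hA hlam hS hc_nonneg hcc hc_mono (traj _ hh _ mz) (traj _ hh _ mx)
      (traj _ hh _ my) ha hb hab
      (by rw [init _ hh _ mz, init _ hh _ mx, init _ hh _ my]; exact es0)
    rw [init _ hh _ mz, init _ hh _ mx, init _ hh _ my, ← hJ, ← hJ, ← hJ] at this
    have v1 := mul_le_mul_of_nonneg_left (vle _ hh _ mx) ha
    have v2 := mul_le_mul_of_nonneg_left (vle _ hh _ my) hb
    have k1 : abar / δ * (a * (1 / x) + b * (1 / y) - 1 / (a * x + b * y))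
        ≤ K * (a * b * (x - y) ^ 2) := by
      calc _ ≤ abar / δ * (a * b * (x - y) ^ 2 * γmax ^ 3) := by gcongr
        _ = _ := by rw [hK]; ring
    linarith
  refine ⟨scx, ⟨2 * K, by positivity, ?_⟩, ?_⟩
  · intro x h hh hx
    have := semi (x + h) (x - h) (1 / 2) (1 / 2) (by linarith) hx (by norm_num) (by norm_num)
      (by norm_num)
    rw [show 1 / 2 * (x + h) + 1 / 2 * (x - h) = x by ring] at this
    nlinarith
  · apply c11_of_convex hK0.le scx.convexOn
    refine ⟨convex_Ici _, ?_⟩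
    intro x hx y hy a b ha hb hab
    simp only [smul_eq_mul]
    have := semi x y a b hx hy ha hb hab
    have e : K * (a * x + b * y) ^ 2 = a * (K * x ^ 2) + b * (K * y ^ 2)
        - K * (a * b * (x - y) ^ 2) := by
      obtain rfl : b = 1 - a := by linarith
      ring
    rw [e]
    linarith
end

section
/- The value function v of the reduced deterministic control problem is continuously differentiable on the open interval (0, γ_max). -/
open Set Filter Topology MeasureTheory

lemma aux_contDeriv {u m : ℝ → ℝ} {a b : ℝ} (hc : ConvexOn ℝ (Ioo a b) u)
    (hd : ∀ x ∈ Ioo a b, HasDerivAt u (m x) x) : ContinuousOn m (Ioo a b) := by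
  intro x hx
  apply ContinuousAt.continuousWithinAt
  have hcont : ContinuousAt u x := (hd x hx).continuousAt
  have hsl := hasDerivAt_iff_tendsto_slope.1 (hd x hx)
  have hslc : ∀ z, z ≠ x → ContinuousAt (fun y => slope u y z) x := by
    intro z hz
    have : (fun y => slope u y z) = fun y => (u z - u y) / (z - y) := by
      funext y; rw [slope_def_field]
    rw [this]
    exact ContinuousAt.div (by fun_prop) (by fun_prop) (sub_ne_zero.2 hz)
  have hI : ∀ᶠ y in 𝓝 x, y ∈ Ioo a b := Ioo_mem_nhds hx.1 hx.2
  rw [ContinuousAt, tendsto_order]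
  constructor
  · intro q hq
    have h1 : ∀ᶠ z in 𝓝[<] x, q < slope u x z :=
      (hsl.mono_left (nhdsWithin_mono _ (fun z hz => ne_of_lt hz))).eventually (lt_mem_nhds hq)
    have h2 : ∀ᶠ z in 𝓝[<] x, z ∈ Ioo a b := hI.filter_mono nhdsWithin_le_nhds
    obtain ⟨z, ⟨hz1, hz2⟩, hz3⟩ := ((h1.and h2).and self_mem_nhdsWithin).exists
    have hz3 : z < x := hz3
    have h4 : ∀ᶠ y in 𝓝 x, q < slope u y z := (hslc z hz3.ne).eventually (lt_mem_nhds hz1)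
    filter_upwards [h4, hI, lt_mem_nhds hz3] with y hy1 hy2 hy3
    have := hc.slope_le_of_hasDerivAt hz2 hy2 hy3 (hd y hy2)
    rw [slope_comm] at this
    linarith
  · intro q hq
    have h1 : ∀ᶠ z in 𝓝[>] x, slope u x z < q :=
      (hsl.mono_left (nhdsWithin_mono _ (fun z hz => ne_of_gt hz))).eventually (gt_mem_nhds hq)
    have h2 : ∀ᶠ z in 𝓝[>] x, z ∈ Ioo a b := hI.filter_mono nhdsWithin_le_nhds
    obtain ⟨z, ⟨hz1, hz2⟩, hz3⟩ := ((h1.and h2).and self_mem_nhdsWithin).exists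
    have hz3 : x < z := hz3
    have h4 : ∀ᶠ y in 𝓝 x, slope u y z < q := (hslc z hz3.ne').eventually (gt_mem_nhds hz1)
    filter_upwards [h4, hI, gt_mem_nhds hz3] with y hy1 hy2 hy3
    have := hc.le_slope_of_hasDerivAt hy2 hz2 hy3 (hd y hy2)
    linarith

lemma aux_diff_s11 {v : ℝ → ℝ} {R : ℝ} (hR : 0 < R) (hcc : ConcaveOn ℝ (Ioo 0 R) v)
    (hharm : ConvexOn ℝ (Ioi R⁻¹) (fun y => v y⁻¹)) :
    ∀ x ∈ Ioo 0 R, HasDerivAt v (deriv v x) x := by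
  intro x hx
  suffices h : ∃ d, HasDerivAt v d x by
    obtain ⟨d, hd⟩ := h
    exact hd.differentiableAt.hasDerivAt
  have hx0 := hx.1
  have hxi : x ∈ interior (Ioo 0 R) := by rwa [interior_Ioo]
  have hyi : x⁻¹ ∈ interior (Ioi R⁻¹) := by
    rw [interior_Ioi]; exact (inv_lt_inv₀ hR hx0).2 hx.2
  have hcv := hcc.neg
  have hle := hcv.leftDeriv_le_rightDeriv_of_mem_interior hxi
  have hl := (hcv.hasDerivWithinAt_leftDeriv_of_mem_interior hxi).neg
  have hr := (hcv.hasDerivWithinAt_rightDeriv_of_mem_interior hxi).neg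
  have hle2 := hharm.leftDeriv_le_rightDeriv_of_mem_interior hyi
  have gl := hharm.hasDerivWithinAt_leftDeriv_of_mem_interior hyi
  have gr := hharm.hasDerivWithinAt_rightDeriv_of_mem_interior hyi
  rw [neg_neg] at hl hr
  generalize derivWithin (-v) (Iio x) x = l at *
  generalize derivWithin (-v) (Ioi x) x = r at *
  generalize derivWithin (fun y => v y⁻¹) (Iio x⁻¹) x⁻¹ = p at *
  generalize derivWithin (fun y => v y⁻¹) (Ioi x⁻¹) x⁻¹ = q at *
  have hinv := hasDerivAt_inv hx0.ne'
  have e : (fun y => v y⁻¹) ∘ (fun y => y⁻¹) = v := by funext y; simp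
  have gl' : HasDerivWithinAt v (p * -(x ^ 2)⁻¹) (Ioi x) x := by
    have := gl.scomp x (hinv.hasDerivWithinAt (s := Ioi x))
      (fun z hz => (inv_lt_inv₀ (hx0.trans hz) hx0).2 hz)
    rw [e] at this
    simpa [mul_comm] using this
  have gr' : HasDerivWithinAt v (q * -(x ^ 2)⁻¹) (Iio x) x := by
    have := gr.scomp x (hinv.hasDerivWithinAt (s := Ioo 0 x))
      (fun z hz => (inv_lt_inv₀ hx0 hz.1).2 hz.2)
    rw [e] at this
    have h2 : HasDerivWithinAt v (q * -(x ^ 2)⁻¹) (Ioo 0 x) x := by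
      simpa [mul_comm] using this
    exact h2.mono_of_mem_nhdsWithin (Ioo_mem_nhdsLT hx0)
  have e1 : -l = q * -(x ^ 2)⁻¹ := (uniqueDiffWithinAt_Iio x).eq_deriv _ hl gr'
  have e2 : -r = p * -(x ^ 2)⁻¹ := (uniqueDiffWithinAt_Ioi x).eq_deriv _ hr gl'
  have hpos : 0 < (x ^ 2)⁻¹ := by positivity
  have : l = r := by nlinarith
  subst this
  refine ⟨-l, ?_⟩
  have := hl.union hr
  rw [Iio_union_Ioi] at this
  rw [hasDerivAt_iff_tendsto_slope]
  rw [hasDerivWithinAt_iff_tendsto_slope] at this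
  simpa using this

lemma aux_nonneg_s11 {D D' : ℝ → ℝ} {T : ℝ} (hT : 0 ≤ T) (hAC : AbsolutelyContinuousOnInterval D 0 T)
    (h0 : 0 ≤ D 0) (hd : ∀ᵐ t, t ∈ Icc 0 T → HasDerivAt D (D' t) t)
    (hpos : ∀ t ∈ Icc 0 T, D t < 0 → 0 ≤ D' t) : 0 ≤ D T := by
  by_contra hneg
  push Not at hneg
  have hc : ContinuousOn D (Icc 0 T) := by
    have := hAC.continuousOn; rwa [uIcc_of_le hT] at this
  have hS : IsCompact (Icc 0 T ∩ D ⁻¹' Ici 0) :=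
    isCompact_Icc.of_isClosed_subset
      (hc.preimage_isClosed_of_isClosed isClosed_Icc isClosed_Ici) inter_subset_left
  have hne : (Icc 0 T ∩ D ⁻¹' Ici 0).Nonempty := ⟨0, ⟨le_rfl, hT⟩, h0⟩
  obtain ⟨s, ⟨hs1, hs2⟩, hsmax⟩ := hS.exists_isGreatest hne
  have hs2 : 0 ≤ D s := hs2
  have hsT : s < T := by
    rcases hs1.2.lt_or_eq with h | h
    · exact h
    · subst h; linarith
  have hAC' : AbsolutelyContinuousOnInterval D s T := hAC.mono (by
    rw [uIcc_of_le hT, uIcc_of_le hsT.le]; exact Icc_subset_Icc_left hs1.1)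
  have hint := hAC'.integral_deriv_eq_sub
  have : 0 ≤ ∫ x in s..T, deriv D x := by
    rw [intervalIntegral.integral_of_le hsT.le]
    apply setIntegral_nonneg_of_ae_restrict
    rw [Filter.EventuallyLE, ae_restrict_iff' measurableSet_Ioc]
    filter_upwards [hd] with t ht htm
    have htI : t ∈ Icc 0 T := ⟨hs1.1.trans htm.1.le, htm.2⟩
    rw [(ht htI).deriv]
    apply hpos t htI
    by_contra hcon
    push Not at hcon
    have : t ≤ s := hsmax ⟨htI, hcon⟩
    linarith [htm.1]
  linarith

structure Traj (k lam s R H : ℝ) (h γ : ℝ → ℝ) : Prop where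
  meas : Measurable h
  hb : ∀ t, h t ∈ Icc 0 H
  cont : ContinuousOn γ (Ici 0)
  mem : ∀ t, 0 ≤ t → γ t ∈ Icc 0 R
  eq : ∀ t, 0 ≤ t → γ t = γ 0 + ∫ u in (0:ℝ)..t, (-(k + h u) * γ u ^ 2 - 2 * lam * γ u + s)

lemma Traj.bound {k lam s R H : ℝ} (hk : 0 ≤ k) (hl : 0 ≤ lam) (hs : 0 ≤ s) {h γ : ℝ → ℝ}
    (tr : Traj k lam s R H h γ) (t : ℝ) (ht : 0 ≤ t) :
    ‖-(k + h t) * γ t ^ 2 - 2 * lam * γ t + s‖ ≤ (k + H) * R ^ 2 + 2 * lam * R + s := by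
  obtain ⟨h1, h2⟩ := tr.hb t
  obtain ⟨g1, g2⟩ := tr.mem t ht
  have hkH : 0 ≤ k + H := by linarith
  have e1 : (k + h t) * γ t ^ 2 ≤ (k + H) * R ^ 2 := by gcongr
  have e2 : 0 ≤ (k + h t) * γ t ^ 2 := by positivity
  have e3 : 2 * lam * γ t ≤ 2 * lam * R := by gcongr
  have e4 : 0 ≤ 2 * lam * γ t := by positivity
  rw [Real.norm_eq_abs, abs_le]
  constructor <;> linarith

lemma Traj.intble {k lam s R H : ℝ} (hk : 0 ≤ k) (hl : 0 ≤ lam) (hs : 0 ≤ s) {h γ : ℝ → ℝ}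
    (tr : Traj k lam s R H h γ) (a b : ℝ) (ha : 0 ≤ a) (hb : 0 ≤ b) :
    IntervalIntegrable (fun t => -(k + h t) * γ t ^ 2 - 2 * lam * γ t + s) volume a b := by
  have hsub : uIoc a b ⊆ Ici 0 := fun t ht => by
    have := ht.1
    simp only [mem_Ici]
    exact (le_min ha hb).trans this.le
  have hg : AEStronglyMeasurable γ (volume.restrict (uIoc a b)) :=
    (tr.cont.mono hsub).aestronglyMeasurable measurableSet_uIoc
  have hh : AEStronglyMeasurable h (volume.restrict (uIoc a b)) :=
    tr.meas.aestronglyMeasurable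
  rw [intervalIntegrable_iff]
  have : IsFiniteMeasure (volume.restrict (uIoc a b)) := ⟨by
    rw [Measure.restrict_apply_univ, uIoc]; exact measure_Ioc_lt_top⟩
  refine Integrable.of_bound (C := (k + H) * R ^ 2 + 2 * lam * R + s) ?_ ?_
  · exact ((((aestronglyMeasurable_const.add hh).neg.mul (hg.pow 2)).sub
      (hg.const_mul (2 * lam))).add aestronglyMeasurable_const)
  · rw [ae_restrict_iff' measurableSet_uIoc]
    exact Eventually.of_forall fun t ht => tr.bound hk hl hs t (hsub ht)

lemma Traj.lip {k lam s R H : ℝ} (hk : 0 ≤ k) (hl : 0 ≤ lam) (hs : 0 ≤ s) {h γ : ℝ → ℝ}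
    (tr : Traj k lam s R H h γ) (a b : ℝ) (ha : 0 ≤ a) (hb : 0 ≤ b) :
    |γ a - γ b| ≤ ((k + H) * R ^ 2 + 2 * lam * R + s) * |a - b| := by
  rw [tr.eq a ha, tr.eq b hb, add_sub_add_left_eq_sub,
    intervalIntegral.integral_interval_sub_left (tr.intble hk hl hs _ _ le_rfl ha)
      (tr.intble hk hl hs _ _ le_rfl hb)]
  rw [← Real.norm_eq_abs]
  apply intervalIntegral.norm_integral_le_of_norm_le_const
  intro t ht
  exact tr.bound hk hl hs t ((le_min hb ha).trans ht.1.le)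

lemma aux_ac {u : ℝ → ℝ} {C T : ℝ} (hT : 0 ≤ T)
    (h : ∀ a b, a ∈ Icc 0 T → b ∈ Icc 0 T → |u a - u b| ≤ C * |a - b|) :
    AbsolutelyContinuousOnInterval u 0 T := by
  apply LipschitzOnWith.absolutelyContinuousOnInterval (K := C.toNNReal)
  apply LipschitzOnWith.of_dist_le_mul
  intro a ha b hb
  rw [uIcc_of_le hT] at ha hb
  rw [Real.dist_eq, Real.dist_eq]
  refine (h a b ha hb).trans ?_
  gcongr
  exact Real.le_coe_toNNReal C

lemma Traj.ac {k lam s R H : ℝ} (hk : 0 ≤ k) (hl : 0 ≤ lam) (hs : 0 ≤ s) {h γ : ℝ → ℝ}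
    (tr : Traj k lam s R H h γ) {T : ℝ} (hT : 0 ≤ T) : AbsolutelyContinuousOnInterval γ 0 T :=
  aux_ac hT fun a b ha hb => tr.lip hk hl hs a b ha.1 hb.1

lemma Traj.deriv {k lam s R H : ℝ} (hk : 0 ≤ k) (hl : 0 ≤ lam) (hs : 0 ≤ s) {h γ : ℝ → ℝ}
    (tr : Traj k lam s R H h γ) {T : ℝ} (hT : 0 ≤ T) :
    ∀ᵐ t, t ∈ Icc 0 T → HasDerivAt γ (-(k + h t) * γ t ^ 2 - 2 * lam * γ t + s) t := by
  have h1 := (tr.intble hk hl hs 0 T le_rfl hT).ae_hasDerivAt_integral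
  have h2 : ∀ᵐ t : ℝ, t ≠ 0 := by simp [ae_iff, measure_singleton]
  filter_upwards [h1, h2] with t ht ht0 htI
  have h3 := ht (by rwa [uIcc_of_le hT]) 0 (by simp)
  have htpos : 0 < t := lt_of_le_of_ne htI.1 ht0.symm
  refine (h3.const_add (γ 0)).congr_of_eventuallyEq ?_
  filter_upwards [lt_mem_nhds htpos] with u hu
  exact tr.eq u hu.le

lemma Traj.concave {k lam s R H : ℝ} (hk : 0 ≤ k) (hl : 0 ≤ lam) (hs : 0 ≤ s) {h γ γ₁ γ₂ : ℝ → ℝ}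
    (tr : Traj k lam s R H h γ) (tr1 : Traj k lam s R H h γ₁) (tr2 : Traj k lam s R H h γ₂)
    {p q : ℝ} (hp : 0 ≤ p) (hq : 0 ≤ q) (hpq : p + q = 1) (h0 : γ 0 = p * γ₁ 0 + q * γ₂ 0)
    (T : ℝ) (hT : 0 ≤ T) : p * γ₁ T + q * γ₂ T ≤ γ T := by
  have hac : AbsolutelyContinuousOnInterval (fun t => γ t - (p * γ₁ t + q * γ₂ t)) 0 T :=
    (tr.ac hk hl hs hT).fun_sub
      (((tr1.ac hk hl hs hT).const_mul p).fun_add ((tr2.ac hk hl hs hT).const_mul q))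
  have key := aux_nonneg_s11 (D := fun t => γ t - (p * γ₁ t + q * γ₂ t))
    (D' := fun t => (-(k + h t) * γ t ^ 2 - 2 * lam * γ t + s)
      - (p * (-(k + h t) * γ₁ t ^ 2 - 2 * lam * γ₁ t + s)
        + q * (-(k + h t) * γ₂ t ^ 2 - 2 * lam * γ₂ t + s))) hT hac (by simp [h0]) ?_ ?_
  · linarith
  · filter_upwards [tr.deriv hk hl hs hT, tr1.deriv hk hl hs hT, tr2.deriv hk hl hs hT]
      with t h1 h2 h3 ht
    exact (h1 ht).sub (((h2 ht).const_mul p).add ((h3 ht).const_mul q))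
  · intro t ht hneg
    have hq' : q = 1 - p := by linarith
    subst hq'
    have g0 := (tr.mem t ht.1).1
    have g1 := (tr1.mem t ht.1).1
    have g2 := (tr2.mem t ht.1).1
    have hh := (tr.hb t).1
    have hm : 0 ≤ p * γ₁ t + (1 - p) * γ₂ t := by positivity
    have hD : 0 ≤ -(γ t - (p * γ₁ t + (1 - p) * γ₂ t)) := by linarith
    have e1 : 0 ≤ ((k + h t) * (γ t + (p * γ₁ t + (1 - p) * γ₂ t)) + 2 * lam)
        * (-(γ t - (p * γ₁ t + (1 - p) * γ₂ t))) := by positivity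
    have e2 : 0 ≤ (k + h t) * (p * (1 - p) * (γ₁ t - γ₂ t) ^ 2) := by positivity
    linear_combination e1 + e2

lemma Traj.lower {k lam s R H : ℝ} (hk : 0 ≤ k) (hl : 0 ≤ lam) (hs : 0 ≤ s) {h γ : ℝ → ℝ}
    (tr : Traj k lam s R H h γ) (T : ℝ) (hT : 0 ≤ T) :
    γ 0 ≤ Real.exp (((k + H) * R + 2 * lam) * T) * γ T := by
  set M := (k + H) * R + 2 * lam with hM
  have hexp : ∀ t, HasDerivAt (fun t => Real.exp (M * t)) (Real.exp (M * t) * M) t := by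
    intro t
    simpa using ((hasDerivAt_id t).const_mul M).exp
  have hE : AbsolutelyContinuousOnInterval (fun t => Real.exp (M * t)) 0 T :=
    ContDiffOn.absolutelyContinuousOnInterval (by fun_prop)
  have hC : AbsolutelyContinuousOnInterval (fun _ : ℝ => γ 0) 0 T :=
    ContDiffOn.absolutelyContinuousOnInterval (by fun_prop)
  have key := aux_nonneg_s11 (D := fun t => Real.exp (M * t) * γ t - γ 0)
    (D' := fun t => (Real.exp (M * t) * M) * γ t + Real.exp (M * t) *
      (-(k + h t) * γ t ^ 2 - 2 * lam * γ t + s)) hT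
      ((hE.fun_mul (tr.ac hk hl hs hT)).fun_sub hC) (by simp) ?_ ?_
  · linarith
  · filter_upwards [tr.deriv hk hl hs hT] with t h1 ht
    exact ((hexp t).mul (h1 ht)).sub_const _
  · intro t ht _
    obtain ⟨g0, g1⟩ := tr.mem t ht.1
    obtain ⟨hh, hh2⟩ := tr.hb t
    have hkH : 0 ≤ k + H := by linarith
    have e1 : (k + h t) * γ t ≤ (k + H) * R := by gcongr
    have e2 : 0 ≤ Real.exp (M * t) * (((k + H) * R - (k + h t) * γ t) * γ t + s) := by
      have := sub_nonneg.2 e1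
      positivity
    rw [hM] at *
    linear_combination e2

lemma Traj.pos {k lam s R H : ℝ} (hk : 0 ≤ k) (hl : 0 ≤ lam) (hs : 0 ≤ s) {h γ : ℝ → ℝ}
    (tr : Traj k lam s R H h γ) (h0 : 0 < γ 0) (T : ℝ) (hT : 0 ≤ T) : 0 < γ T := by
  have := tr.lower hk hl hs T hT
  exact pos_of_mul_pos_right (h0.trans_le this) (Real.exp_pos _).le

lemma Traj.inv_ac {k lam s R H : ℝ} (hk : 0 ≤ k) (hl : 0 ≤ lam) (hs : 0 ≤ s) {h γ : ℝ → ℝ}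
    (tr : Traj k lam s R H h γ) (h0 : 0 < γ 0) {T : ℝ} (hT : 0 ≤ T) :
    AbsolutelyContinuousOnInterval (fun t => (γ t)⁻¹) 0 T := by
  obtain ⟨t₀, ht₀, hmin⟩ := isCompact_Icc.exists_isMinOn (nonempty_Icc.2 hT)
    (tr.cont.mono (Icc_subset_Ici_self : Icc 0 T ⊆ Ici 0))
  have hm := tr.pos hk hl hs h0 t₀ ht₀.1
  set m := γ t₀
  apply aux_ac (C := ((k + H) * R ^ 2 + 2 * lam * R + s) * (m ^ 2)⁻¹) hT
  intro a b ha hb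
  have hma : m ≤ γ a := hmin ha
  have hmb : m ≤ γ b := hmin hb
  have hpa := hm.trans_le hma
  have hpb := hm.trans_le hmb
  have e : (γ a)⁻¹ - (γ b)⁻¹ = -(γ a - γ b) * (γ a * γ b)⁻¹ := by
    field_simp; ring
  rw [e, abs_mul, abs_neg, abs_of_pos (inv_pos.2 (mul_pos hpa hpb))]
  have e2 : (γ a * γ b)⁻¹ ≤ (m ^ 2)⁻¹ := by
    rw [sq]; gcongr
  have hL := tr.lip hk hl hs a b ha.1 hb.1
  calc _ ≤ (((k + H) * R ^ 2 + 2 * lam * R + s) * |a - b|) * (m ^ 2)⁻¹ :=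
        mul_le_mul hL e2 (by positivity) ((abs_nonneg _).trans hL)
    _ = _ := by ring

lemma Traj.inv_deriv {k lam s R H : ℝ} (hk : 0 ≤ k) (hl : 0 ≤ lam) (hs : 0 ≤ s) {h γ : ℝ → ℝ}
    (tr : Traj k lam s R H h γ) (h0 : 0 < γ 0) {T : ℝ} (hT : 0 ≤ T) :
    ∀ᵐ t, t ∈ Icc 0 T → HasDerivAt (fun t => (γ t)⁻¹)
      (k + h t + 2 * lam * (γ t)⁻¹ - s * (γ t)⁻¹ ^ 2) t := by
  filter_upwards [tr.deriv hk hl hs hT] with t h1 ht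
  have hp := tr.pos hk hl hs h0 t ht.1
  have e : k + h t + 2 * lam * (γ t)⁻¹ - s * (γ t)⁻¹ ^ 2
      = -(-(k + h t) * γ t ^ 2 - 2 * lam * γ t + s) / γ t ^ 2 := by
    field_simp; ring
  rw [e]
  exact (h1 ht).fun_inv hp.ne'

lemma Traj.harm {k lam s R H : ℝ} (hk : 0 ≤ k) (hl : 0 ≤ lam) (hs : 0 ≤ s)
    {h h₁ h₂ γ γ₁ γ₂ : ℝ → ℝ} {p q : ℝ}
    (tr : Traj k lam s R H h γ) (tr1 : Traj k lam s R H h₁ γ₁) (tr2 : Traj k lam s R H h₂ γ₂)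
    (hp : 0 ≤ p) (hq : 0 ≤ q) (hpq : p + q = 1)
    (hh : ∀ t, h t = p * h₁ t + q * h₂ t)
    (hg : 0 < γ 0) (hg1 : 0 < γ₁ 0) (hg2 : 0 < γ₂ 0)
    (h0 : (γ 0)⁻¹ = p * (γ₁ 0)⁻¹ + q * (γ₂ 0)⁻¹)
    (T : ℝ) (hT : 0 ≤ T) : p * (γ₁ T)⁻¹ + q * (γ₂ T)⁻¹ ≤ (γ T)⁻¹ := by
  have hexp : ∀ t, HasDerivAt (fun t => Real.exp (-(2 * lam) * t))
      (Real.exp (-(2 * lam) * t) * -(2 * lam)) t := by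
    intro t
    simpa using ((hasDerivAt_id t).const_mul (-(2 * lam))).exp
  have hE : AbsolutelyContinuousOnInterval (fun t => Real.exp (-(2 * lam) * t)) 0 T :=
    ContDiffOn.absolutelyContinuousOnInterval (by fun_prop)
  have hac : AbsolutelyContinuousOnInterval (fun t => Real.exp (-(2 * lam) * t) *
      ((γ t)⁻¹ - (p * (γ₁ t)⁻¹ + q * (γ₂ t)⁻¹))) 0 T :=
    hE.fun_mul ((tr.inv_ac hk hl hs hg hT).fun_sub
      (((tr1.inv_ac hk hl hs hg1 hT).const_mul p).fun_add
        ((tr2.inv_ac hk hl hs hg2 hT).const_mul q)))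
  have key := aux_nonneg_s11 (D' := fun t => (Real.exp (-(2 * lam) * t) * -(2 * lam)) *
      ((γ t)⁻¹ - (p * (γ₁ t)⁻¹ + q * (γ₂ t)⁻¹)) + Real.exp (-(2 * lam) * t) *
      ((k + h t + 2 * lam * (γ t)⁻¹ - s * (γ t)⁻¹ ^ 2) -
        (p * (k + h₁ t + 2 * lam * (γ₁ t)⁻¹ - s * (γ₁ t)⁻¹ ^ 2)
        + q * (k + h₂ t + 2 * lam * (γ₂ t)⁻¹ - s * (γ₂ t)⁻¹ ^ 2)))) hT hac (by simp [h0]) ?_ ?_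
  · have := nonneg_of_mul_nonneg_right key (Real.exp_pos _)
    linarith
  · filter_upwards [tr.inv_deriv hk hl hs hg hT, tr1.inv_deriv hk hl hs hg1 hT,
      tr2.inv_deriv hk hl hs hg2 hT] with t h1 h2 h3 ht
    exact (hexp t).mul ((h1 ht).sub (((h2 ht).const_mul p).add ((h3 ht).const_mul q)))
  · intro t ht hneg
    have hneg := neg_of_mul_neg_right hneg (Real.exp_pos _).le
    rw [hh t]
    have hq' : q = 1 - p := by linarith
    subst hq'
    have g0 := inv_pos.2 (tr.pos hk hl hs hg t ht.1)
    have g1 := inv_pos.2 (tr1.pos hk hl hs hg1 t ht.1)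
    have g2 := inv_pos.2 (tr2.pos hk hl hs hg2 t ht.1)
    generalize (γ t)⁻¹ = y at *
    generalize (γ₁ t)⁻¹ = y₁ at *
    generalize (γ₂ t)⁻¹ = y₂ at *
    have hD : 0 ≤ -(y - (p * y₁ + (1 - p) * y₂)) := by linarith
    have hm : 0 ≤ p * y₁ + (1 - p) * y₂ := by positivity
    have e1 : 0 ≤ Real.exp (-(2 * lam) * t) * (s * (y + (p * y₁ + (1 - p) * y₂)) *
       (-(y - (p * y₁ + (1 - p) * y₂))) + s * (p * (1 - p) * (y₁ - y₂) ^ 2)) := by positivity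
    linear_combination e1

lemma Traj.harm' {k lam s R H : ℝ} (hk : 0 ≤ k) (hl : 0 ≤ lam) (hs : 0 ≤ s)
    {h h₁ h₂ γ γ₁ γ₂ : ℝ → ℝ} {p q : ℝ}
    (tr : Traj k lam s R H h γ) (tr1 : Traj k lam s R H h₁ γ₁) (tr2 : Traj k lam s R H h₂ γ₂)
    (hp : 0 ≤ p) (hq : 0 ≤ q) (hpq : p + q = 1)
    (hh : ∀ t, h t = p * h₁ t + q * h₂ t)
    (hg : 0 < γ 0) (hg1 : 0 < γ₁ 0) (hg2 : 0 < γ₂ 0)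
    (h0 : (γ 0)⁻¹ = p * (γ₁ 0)⁻¹ + q * (γ₂ 0)⁻¹)
    (T : ℝ) (hT : 0 ≤ T) : γ T ≤ p * γ₁ T + q * γ₂ T := by
  have key := tr.harm hk hl hs tr1 tr2 hp hq hpq hh hg hg1 hg2 h0 T hT
  have g0 := tr.pos hk hl hs hg T hT
  have g1 := tr1.pos hk hl hs hg1 T hT
  have g2 := tr2.pos hk hl hs hg2 T hT
  have hq' : q = 1 - p := by linarith
  subst hq'
  generalize γ T = x at *
  generalize γ₁ T = x₁ at *
  generalize γ₂ T = x₂ at *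
  have hpos : 0 < p * x₁⁻¹ + (1 - p) * x₂⁻¹ := by
    rcases hp.lt_or_eq with h | h
    · positivity
    · subst h; simp [g2]
  have h1 : x ≤ (p * x₁⁻¹ + (1 - p) * x₂⁻¹)⁻¹ := by
    rw [le_inv_comm₀ g0 hpos]; exact key
  refine h1.trans ?_
  rw [inv_le_iff_one_le_mul₀ hpos]
  have e : (p * x₁ + (1 - p) * x₂) * (p * x₁⁻¹ + (1 - p) * x₂⁻¹)
      = 1 + p * (1 - p) * ((x₁ - x₂) ^ 2 / (x₁ * x₂)) := by
    field_simp; ring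
  rw [e]
  have : 0 ≤ p * (1 - p) * ((x₁ - x₂) ^ 2 / (x₁ * x₂)) := by positivity
  linarith

lemma cost_int {k lam s R H δ abar : ℝ} (hδ : 0 < δ) (habar : 0 < abar) {c h γ : ℝ → ℝ}
    (hc_nonneg : ∀ x : ℝ, 0 ≤ x → 0 ≤ c x) (hc_mono : StrictMonoOn c (Ici 0))
    (hc : ContinuousOn c (Ici 0)) (tr : Traj k lam s R H h γ) :
    IntegrableOn (fun t => Real.exp (-δ * t) * (abar * γ t + c (h t))) (Ioi 0) := by
  have hexp : IntegrableOn (fun t => Real.exp (-δ * t)) (Ioi 0) :=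
    integrableOn_exp_mul_Ioi (by linarith) 0
  have hg : AEStronglyMeasurable γ (volume.restrict (Ioi 0)) :=
    (tr.cont.mono Ioi_subset_Ici_self).aestronglyMeasurable measurableSet_Ioi
  have hch : AEStronglyMeasurable (fun t => c (h t)) (volume.restrict (Ioi 0)) := by
    have h1 : Continuous (fun x : ℝ => c (max x 0)) :=
      hc.comp_continuous (by fun_prop) (fun x => le_max_right x 0)
    have h2 : (fun t => c (h t)) = fun t => c (max (h t) 0) := by
      funext t; rw [max_eq_left (tr.hb t).1]
    rw [h2]
    exact (h1.measurable.comp tr.meas).aestronglyMeasurable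
  refine Integrable.mul_bdd (c := abar * R + c H) hexp ?_ ?_
  · exact (hg.const_mul abar).add hch
  · rw [ae_restrict_iff' measurableSet_Ioi]
    refine Eventually.of_forall fun t ht => ?_
    have ht : 0 < t := ht
    obtain ⟨g1, g2⟩ := tr.mem t ht.le
    obtain ⟨h1, h2⟩ := tr.hb t
    have e1 : abar * γ t ≤ abar * R := by gcongr
    have e2 : c (h t) ≤ c H := hc_mono.monotoneOn h1 (h1.trans h2) h2
    have e3 := hc_nonneg _ h1
    have e4 : 0 ≤ abar * γ t := by positivity
    rw [Real.norm_eq_abs, abs_le]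
    constructor <;> linarith

/-- The value function v of the reduced deterministic control problem is
continuously differentiable on the open interval (0, γ_max). -/
theorem stmt_11
    (σ₁ σ₂ lam δ abar γmax hmax : ℝ)
    (hσ₁ : 0 < σ₁) (hσ₂ : 0 ≤ σ₂) (hlam : 0 ≤ lam) (hδ : 0 < δ) (habar : 0 < abar)
    (f : ℝ → ℝ → ℝ)
    (hf : ∀ γ h : ℝ, f γ h = -(1 / σ₁ ^ 2 + h) * γ ^ 2 - 2 * lam * γ + σ₂ ^ 2)
    (γinf : ℝ)
    (hγinf : γinf = -lam * σ₁ ^ 2 + Real.sqrt (lam ^ 2 * σ₁ ^ 4 + σ₁ ^ 2 * σ₂ ^ 2))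
    (hγmax : γinf < γmax)
    (c c' : ℝ → ℝ)
    (hc_nonneg : ∀ x : ℝ, 0 ≤ x → 0 ≤ c x)
    (hc_conv : StrictConvexOn ℝ (Set.Ici 0) c)
    (hc_mono : StrictMonoOn c (Set.Ici 0))
    (hc_smooth : ContDiffOn ℝ 2 c (Set.Ici 0))
    (hc_deriv : ∀ x ∈ Set.Ici (0 : ℝ), HasDerivWithinAt c (c' x) (Set.Ici 0) x)
    (hhmax : 0 < hmax) (hc_hmax : c' hmax = γmax ^ 2 * (abar / δ))
    (Adm : (ℝ → ℝ) → Prop)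
    (hAdm : ∀ h : ℝ → ℝ, Adm h ↔ Measurable h ∧ ∀ t : ℝ, h t ∈ Set.Icc 0 hmax)
    (sol : (ℝ → ℝ) → ℝ → ℝ → ℝ)
    (hsol : ∀ h : ℝ → ℝ, Adm h → ∀ γ₀ ∈ Set.Icc (0 : ℝ) γmax,
      sol h γ₀ 0 = γ₀ ∧
      ContinuousOn (sol h γ₀) (Set.Ici 0) ∧
      (∀ t ∈ Set.Ici (0 : ℝ), sol h γ₀ t ∈ Set.Icc 0 γmax) ∧
      (∀ t ∈ Set.Ici (0 : ℝ),
        sol h γ₀ t = γ₀ + ∫ s in (0 : ℝ)..t, f (sol h γ₀ s) (h s)))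
    (J : (ℝ → ℝ) → ℝ → ℝ)
    (hJ : ∀ (h : ℝ → ℝ) (γ₀ : ℝ), J h γ₀ =
      ∫ t in Set.Ioi (0 : ℝ), Real.exp (-δ * t) * (abar * sol h γ₀ t + c (h t)))
    (v : ℝ → ℝ)
    (hv : ∀ γ₀ ∈ Set.Icc (0 : ℝ) γmax,
      v γ₀ = sInf ((fun h => J h γ₀) '' {h : ℝ → ℝ | Adm h}))
    : ∃ d : ℝ → ℝ,
      (∀ x ∈ Set.Ioo (0 : ℝ) γmax, HasDerivAt v (d x) x) ∧
      ContinuousOn d (Set.Ioo 0 γmax) := by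
  
  have hk : 0 ≤ 1 / σ₁ ^ 2 := by positivity
  have hs : 0 ≤ σ₂ ^ 2 := by positivity
  have hcc : ContinuousOn c (Ici 0) := hc_smooth.continuousOn
  have hR : 0 < γmax := by
    refine lt_of_le_of_lt ?_ hγmax
    rw [hγinf]
    have : lam * σ₁ ^ 2 ≤ Real.sqrt (lam ^ 2 * σ₁ ^ 4 + σ₁ ^ 2 * σ₂ ^ 2) := by
      apply Real.le_sqrt_of_sq_le
      have : 0 ≤ σ₁ ^ 2 * σ₂ ^ 2 := by positivity
      linear_combination this
    linarith
  have htraj : ∀ h, Adm h → ∀ x ∈ Icc 0 γmax,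
      Traj (1 / σ₁ ^ 2) lam (σ₂ ^ 2) γmax hmax h (sol h x) := by
    intro h hA x hx
    obtain ⟨a, b, c, d⟩ := hsol h hA x hx
    obtain ⟨m1, m2⟩ := (hAdm h).1 hA
    refine ⟨m1, m2, b, c, fun t ht => ?_⟩
    rw [a]
    have := d t ht
    simp only [hf] at this
    exact this
  have hinit : ∀ h, Adm h → ∀ x ∈ Icc 0 γmax, sol h x 0 = x := fun h hA x hx => (hsol h hA x hx).1
  have hint : ∀ h, Adm h → ∀ x ∈ Icc 0 γmax,
      IntegrableOn (fun t => Real.exp (-δ * t) * (abar * sol h x t + c (h t))) (Ioi 0) :=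
    fun h hA x hx => cost_int hδ habar hc_nonneg hc_mono hcc (htraj h hA x hx)
  have hJ0 : ∀ h, Adm h → ∀ x ∈ Icc 0 γmax, 0 ≤ J h x := by
    intro h hA x hx
    rw [hJ]
    apply setIntegral_nonneg measurableSet_Ioi
    intro t ht
    have ht : 0 < t := ht
    have h1 := ((htraj h hA x hx).mem t ht.le).1
    have h2 := hc_nonneg _ ((htraj h hA x hx).hb t).1
    positivity
  have hA0 : Adm (fun _ => 0) := (hAdm _).2 ⟨measurable_const, fun _ => ⟨le_rfl, hhmax.le⟩⟩
  have hne : ∀ x, ((fun h => J h x) '' {h : ℝ → ℝ | Adm h}).Nonempty :=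
    fun x => ⟨_, _, hA0, rfl⟩
  have hvle : ∀ h, Adm h → ∀ x ∈ Icc 0 γmax, v x ≤ J h x := by
    intro h hA x hx
    rw [hv x hx]
    refine csInf_le ⟨0, ?_⟩ ⟨h, hA, rfl⟩
    rintro _ ⟨g, hg, rfl⟩
    exact hJ0 g hg x hx
  have hvlt : ∀ x ∈ Icc 0 γmax, ∀ ε > 0, ∃ h, Adm h ∧ J h x < v x + ε := by
    intro x hx ε hε
    obtain ⟨_, ⟨h, hA, rfl⟩, hlt⟩ := exists_lt_of_csInf_lt (hne x)
      (show sInf ((fun h => J h x) '' {h : ℝ → ℝ | Adm h}) < v x + ε by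
        rw [← hv x hx]; linarith)
    exact ⟨h, hA, hlt⟩
  -- the value function is concave in the initial state
  have hconc : ConcaveOn ℝ (Ioo 0 γmax) v := by
    refine ⟨convex_Ioo _ _, ?_⟩
    intro x hx y hy p q hp hq hpq
    have hz := convex_Ioo (0 : ℝ) γmax hx hy hp hq hpq
    simp only [smul_eq_mul] at hz ⊢
    have hx' := Ioo_subset_Icc_self hx
    have hy' := Ioo_subset_Icc_self hy
    have hz' := Ioo_subset_Icc_self hz
    rw [hv _ hz']
    refine le_csInf (hne _) ?_
    rintro _ ⟨h, hA, rfl⟩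
    have hA : Adm h := hA
    have h1 : p * J h x + q * J h y ≤ J h (p * x + q * y) := by
      rw [hJ, hJ, hJ, ← integral_const_mul, ← integral_const_mul,
        ← integral_add ((hint h hA x hx').const_mul p) ((hint h hA y hy').const_mul q)]
      refine setIntegral_mono_on (((hint h hA x hx').const_mul p).add
        ((hint h hA y hy').const_mul q)) (hint h hA _ hz') measurableSet_Ioi ?_
      intro t ht
      have ht : 0 < t := ht
      have key := (htraj h hA _ hz').concave hk hlam hs (htraj h hA x hx') (htraj h hA y hy')
        hp hq hpq (by rw [hinit h hA _ hz', hinit h hA x hx', hinit h hA y hy']) t ht.le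
      have key2 : 0 ≤ Real.exp (-δ * t) * (abar * (sol h (p * x + q * y) t
        - (p * sol h x t + q * sol h y t))) := by
        have := sub_nonneg.2 key
        positivity
      have hq' : q = 1 - p := by linarith
      subst hq'
      linear_combination key2
    refine le_trans ?_ h1
    gcongr
    · exact hvle h hA x hx'
    · exact hvle h hA y hy'
  -- the value function is convex in the reciprocal of the initial state
  have hharm : ConvexOn ℝ (Ioi γmax⁻¹) (fun y => v y⁻¹) := by
    refine ⟨convex_Ioi _, ?_⟩
    intro x hx y hy p q hp hq hpq
    have hz := convex_Ioi (γmax⁻¹) hx hy hp hq hpq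
    simp only [smul_eq_mul] at hz ⊢
    have hRi : 0 < γmax⁻¹ := inv_pos.2 hR
    have hmem : ∀ u, u ∈ Ioi γmax⁻¹ → 0 < u⁻¹ ∧ u⁻¹ ∈ Icc 0 γmax := by
      intro u hu
      have hu : γmax⁻¹ < u := hu
      have hu0 : 0 < u := hRi.trans hu
      refine ⟨inv_pos.2 hu0, (inv_pos.2 hu0).le, ?_⟩
      rw [inv_le_comm₀ hu0 hR]
      exact hu.le
    obtain ⟨hx0, hx'⟩ := hmem x hx
    obtain ⟨hy0, hy'⟩ := hmem y hy
    obtain ⟨hz0, hz'⟩ := hmem _ hz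
    apply le_of_forall_pos_le_add
    intro ε hε
    obtain ⟨h₁, hA₁, hl₁⟩ := hvlt _ hx' ε hε
    obtain ⟨h₂, hA₂, hl₂⟩ := hvlt _ hy' ε hε
    obtain ⟨m₁, b₁⟩ := (hAdm _).1 hA₁
    obtain ⟨m₂, b₂⟩ := (hAdm _).1 hA₂
    have hA : Adm (fun t => p * h₁ t + q * h₂ t) :=
      (hAdm _).2 ⟨(m₁.const_mul p).add (m₂.const_mul q),
        fun t => convex_Icc 0 hmax (b₁ t) (b₂ t) hp hq hpq⟩
    have h1 : J (fun t => p * h₁ t + q * h₂ t) (p * x + q * y)⁻¹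
        ≤ p * J h₁ x⁻¹ + q * J h₂ y⁻¹ := by
      rw [hJ, hJ, hJ, ← integral_const_mul, ← integral_const_mul,
        ← integral_add ((hint h₁ hA₁ _ hx').const_mul p) ((hint h₂ hA₂ _ hy').const_mul q)]
      refine setIntegral_mono_on (hint _ hA _ hz') (((hint h₁ hA₁ _ hx').const_mul p).add
        ((hint h₂ hA₂ _ hy').const_mul q)) measurableSet_Ioi ?_
      intro t ht
      have ht : 0 < t := ht
      have key := (htraj _ hA _ hz').harm' hk hlam hs (htraj h₁ hA₁ _ hx') (htraj h₂ hA₂ _ hy')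
        hp hq hpq (fun _ => rfl) (by rwa [hinit _ hA _ hz']) (by rwa [hinit _ hA₁ _ hx'])
        (by rwa [hinit _ hA₂ _ hy'])
        (by rw [hinit _ hA _ hz', hinit _ hA₁ _ hx', hinit _ hA₂ _ hy', inv_inv, inv_inv, inv_inv])
        t ht.le
      have keyc : c (p * h₁ t + q * h₂ t) ≤ p * c (h₁ t) + q * c (h₂ t) :=
        hc_conv.convexOn.2 (b₁ t).1 (b₂ t).1 hp hq hpq
      have key2 : 0 ≤ Real.exp (-δ * t) * (abar * ((p * sol h₁ x⁻¹ t + q * sol h₂ y⁻¹ t)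
        - sol (fun t => p * h₁ t + q * h₂ t) (p * x + q * y)⁻¹ t)
        + (p * c (h₁ t) + q * c (h₂ t) - c (p * h₁ t + q * h₂ t))) := by
        have := sub_nonneg.2 key
        have := sub_nonneg.2 keyc
        positivity
      linear_combination key2
    have h2 := hvle _ hA _ hz'
    have h3 : p * J h₁ x⁻¹ ≤ p * (v x⁻¹ + ε) := by gcongr
    have h4 : q * J h₂ y⁻¹ ≤ q * (v y⁻¹ + ε) := by gcongr
    have hq' : q = 1 - p := by linarith
    subst hq'
    linarith
  have hd := aux_diff_s11 hR hconc hharm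
  refine ⟨deriv v, hd, ?_⟩
  have := aux_contDeriv hconc.neg (m := fun x => -deriv v x) (fun x hx => (hd x hx).neg)
  refine this.neg.congr fun x _ => ?_
  simp
end
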